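/- Let G be the simple graph on six vertices v1,...,v6 whose edges are the path edges v1v2, v2v3, v3v4, v4v5, v5v6 together with the chords v3v5 and v3v6 (this is the graph G^6_62 in Harary's enumeration of six-vertex graphs). Then for every integer n ≥ 1, the crossing number of the Cartesian product G □ S_n equals 5⌊n/2⌋⌊(n−1)/2⌋ + 2⌊n/2⌋. -/

import Mathlib

open SimpleGraph

/-- A drawing of a simple graph in the plane: vertices are mapped to distinct
points, and each edge is mapped to a simple arc (parametrised by `[0,1]`)
joining the images of its endpoints and avoiding the images of all vertices
in its interior. -/
structure Drawing {V : Type*} (G : SimpleGraph V) where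
  vertexMap : V → ℝ × ℝ
  vertexMap_injective : Function.Injective vertexMap
  arc : G.edgeSet → ℝ → ℝ × ℝ
  arc_continuousOn : ∀ e, ContinuousOn (arc e) (Set.Icc 0 1)
  arc_injOn : ∀ e, Set.InjOn (arc e) (Set.Icc 0 1)
  arc_endpoints : ∀ e : G.edgeSet, ∃ u v : V,
    (e : Sym2 V) = s(u, v) ∧ arc e 0 = vertexMap u ∧ arc e 1 = vertexMap v
  arc_avoids_vertices : ∀ e : G.edgeSet, ∀ t ∈ Set.Ioo (0 : ℝ) 1, ∀ w : V,
    arc e t ≠ vertexMap w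

/-- The crossings of a drawing: an unordered pair of distinct edges together
with a point of the plane where the two corresponding arcs intersect away
from their endpoints. -/
def Drawing.crossings {V : Type*} {G : SimpleGraph V} (D : Drawing G) :
    Set (Sym2 G.edgeSet × (ℝ × ℝ)) :=
  { x | ∃ e f : G.edgeSet, e ≠ f ∧ x.1 = s(e, f) ∧
      (∃ s ∈ Set.Ioo (0 : ℝ) 1, D.arc e s = x.2) ∧
      (∃ t ∈ Set.Ioo (0 : ℝ) 1, D.arc f t = x.2) }

/-- The crossing number of a simple graph: the minimum number of crossings
over all drawings of the graph in the plane. -/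
noncomputable def crossingNumber {V : Type*} (G : SimpleGraph V) : ℕ :=
  sInf { n : ℕ | ∃ D : Drawing G, D.crossings.Finite ∧ D.crossings.ncard = n }

/-- The graph `G⁶₆₂`: the path `v1 v2 v3 v4 v5 v6` together with the chords `v3v5` and `v3v6`. -/
def G6_62 : SimpleGraph (Fin 6) :=
  SimpleGraph.fromEdgeSet {s(0, 1), s(1, 2), s(2, 3), s(3, 4), s(4, 5), s(2, 4), s(2, 5)}

/-- The combinatorial properties of the crossing counts `C i j` between the stars of two vertices
`i`, `j` and the crossing counts `Γ i` of a star with the central tree which force the crossing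
number bound for the join of a five-vertex star with a discrete graph. -/
structure IsStarSystem {ι : Type*} (C : ι → ι → ℕ) (Γ : ι → ℕ) : Prop where
  symm : ∀ i j, C i j = C j i
  self : ∀ i, C i i = 0
  even_triangle : ∀ i j k, Even (C i j + C j k + C i k)
  four_le_triangle : ∀ i j k, i ≠ j → j ≠ k → i ≠ k → 4 ≤ C i j + C j k + C i k
  two_le_center : ∀ i j, i ≠ j → 2 ≤ C i j + Γ i + Γ j
  no_fan_four : ∀ k a b c d, C k a = 1 → C k b = 1 → C k c = 1 → C k d = 1 →
    C a b = 2 → C a c = 2 → C a d = 2 → C b c = 2 → C b d = 2 → C c d = 2 → False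
  no_bipartite : ∀ k l a b c, C k l = 2 → C a b = 2 → C a c = 2 → C b c = 2 →
    C k a = 1 → C k b = 1 → C k c = 1 → C l a = 1 → C l b = 1 → C l c = 1 → False
  no_path_zero : ∀ k a b, Γ k = 0 → Γ a = 1 → Γ b = 1 → C k a = 1 → C k b = 1 → C a b = 2 → False
  no_path_one : ∀ k a b, Γ k = 1 → Γ a = 0 → Γ b = 0 → C k a = 1 → C k b = 1 → C a b = 2 → False
  no_triangle : ∀ a b c, Γ a = 0 → Γ b = 0 → Γ c = 0 → C a b = 2 → C b c = 2 → C a c = 2 → False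

namespace IsStarSystem

variable {ι : Type*} {C : ι → ι → ℕ} {Γ : ι → ℕ}

/-- The stars meeting the star of `i` exactly once. -/
def nbr (C : ι → ι → ℕ) (S : Finset ι) (i : ι) : Finset ι := {j ∈ S | C i j = 1}

/-- The stars meeting the star of `i` an odd number of times. -/
def opp (C : ι → ι → ℕ) (S : Finset ι) (i : ι) : Finset ι := {j ∈ S | Odd (C i j)}

lemma nbr_subset_opp {S : Finset ι} (i : ι) : nbr C S i ⊆ opp C S i := fun j hj => by
  simp only [nbr, opp, Finset.mem_filter] at hj ⊢
  exact ⟨hj.1, by rw [hj.2]; exact odd_one⟩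

lemma opp_congr (h : IsStarSystem C Γ) {S : Finset ι} {i j : ι} (hij : Even (C i j)) :
    opp C S i = opp C S j := by
  refine Finset.filter_congr fun y _ => ?_
  have := h.even_triangle i j y
  simp only [Nat.odd_iff, Nat.even_iff] at *
  omega

section Excess

variable [DecidableEq ι]

/-- The number of crossings of two stars in excess of the average value two. -/
def dev (C : ι → ι → ℕ) (i j : ι) : ℤ := if i = j then 0 else (C i j : ℤ) - 2

/-- The excess over the claimed bound of the substructure spanned by `S`. -/
def excess (C : ι → ι → ℕ) (Γ : ι → ℕ) (S : Finset ι) : ℤ :=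
  ∑ i ∈ S, ∑ j ∈ S, dev C i j + 2 * ∑ i ∈ S, (Γ i : ℤ)

lemma dev_of_ne {i j : ι} (h : i ≠ j) : dev C i j = (C i j : ℤ) - 2 := if_neg h

lemma dev_self (i : ι) : dev C i i = 0 := if_pos rfl

lemma dev_comm (h : IsStarSystem C Γ) (i j : ι) : dev C i j = dev C j i := by
  unfold dev; rw [h.symm i j]; simp only [eq_comm]

lemma excess_union (h : IsStarSystem C Γ) {T K : Finset ι} (hd : Disjoint T K) :
    excess C Γ (T ∪ K) = excess C Γ T + excess C Γ K + 2 * ∑ y ∈ T, ∑ k ∈ K, dev C k y := by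
  unfold excess
  simp only [Finset.sum_union hd, Finset.sum_add_distrib]
  have h1 : ∑ i ∈ T, ∑ j ∈ K, dev C i j = ∑ y ∈ T, ∑ k ∈ K, dev C k y :=
    Finset.sum_congr rfl fun y _ => Finset.sum_congr rfl fun k _ => h.dev_comm _ _
  have h2 : ∑ i ∈ K, ∑ j ∈ T, dev C i j = ∑ y ∈ T, ∑ k ∈ K, dev C k y := Finset.sum_comm
  rw [h1, h2]
  ring

lemma excess_eq (h : IsStarSystem C Γ) (S : Finset ι) :
    excess C Γ S = ∑ i ∈ S, ∑ j ∈ S, (C i j : ℤ) + 2 * ∑ i ∈ S, (Γ i : ℤ)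
      - 2 * (S.card * (S.card - 1)) := by
  unfold excess
  have : ∀ i ∈ S, ∑ j ∈ S, dev C i j = ∑ j ∈ S, (C i j : ℤ) - 2 * (S.card - 1) := by
    intro i hi
    rw [← Finset.add_sum_erase _ _ hi, ← Finset.add_sum_erase S (fun j => (C i j : ℤ)) hi, dev_self,
      h.self]
    rw [Finset.sum_congr rfl (g := fun j => (C i j : ℤ) - 2)
      fun j hj => dev_of_ne (Finset.ne_of_mem_erase hj).symm]
    rw [Finset.sum_sub_distrib, Finset.sum_const, Finset.card_erase_of_mem hi, nsmul_eq_mul,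
      Nat.cast_sub (Finset.card_pos.2 ⟨i, hi⟩)]
    push_cast
    ring
  rw [Finset.sum_congr rfl this, Finset.sum_sub_distrib, Finset.sum_const, nsmul_eq_mul]
  ring

end Excess

/-- A set all of whose nonempty subsets lower the excess. -/
def Critical [DecidableEq ι] (C : ι → ι → ℕ) (Γ : ι → ℕ) (S : Finset ι) : Prop :=
  ∀ K ⊆ S, K.Nonempty → excess C Γ K + 2 * ∑ y ∈ S \ K, ∑ k ∈ K, dev C k y < 0

section Critical

variable [DecidableEq ι] {S : Finset ι}

lemma ne_zero (h : IsStarSystem C Γ) (hS : Critical C Γ S) {i j : ι} (hi : i ∈ S) (hj : j ∈ S)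
    (hij : i ≠ j) : C i j ≠ 0 := by
  intro h0
  have hK := hS {i, j} (by simp [Finset.insert_subset_iff, hi, hj]) (by simp)
  have h1 : 0 ≤ excess C Γ {i, j} := by
    have := h.two_le_center i j hij
    have hs := h.symm i j
    simp only [excess, Finset.sum_pair hij, dev_self, dev_of_ne hij, dev_of_ne hij.symm]
    omega
  have h2 : 0 ≤ ∑ y ∈ S \ {i, j}, ∑ k ∈ {i, j}, dev C k y := by
    refine Finset.sum_nonneg fun y hy => ?_
    simp only [Finset.mem_sdiff, Finset.mem_insert, Finset.mem_singleton, not_or] at hy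
    have := h.four_le_triangle i j y hij (Ne.symm hy.2.2) (Ne.symm hy.2.1)
    rw [Finset.sum_pair hij, dev_of_ne (Ne.symm hy.2.1), dev_of_ne (Ne.symm hy.2.2)]
    omega
  omega

lemma no_tight_cycle (h : IsStarSystem C Γ) (hS : Critical C Γ S) {k l a b : ι} (hk : k ∈ S)
    (hl : l ∈ S) (ha : a ∈ S) (hb : b ∈ S) (hkl : C k l = 2) (hab : C a b = 2) (hka : C k a = 1)
    (hkb : C k b = 1) (hla : C l a = 1) (hlb : C l b = 1) : False := by
  have ne : ∀ {x y}, C x y ≠ 0 → x ≠ y := by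
    rintro x y hxy rfl
    exact hxy (h.self x)
  have n1 : k ≠ l := ne (by omega)
  have n2 : k ≠ a := ne (by omega)
  have n3 : k ≠ b := ne (by omega)
  have n4 : l ≠ a := ne (by omega)
  have n5 : l ≠ b := ne (by omega)
  have n6 : a ≠ b := ne (by omega)
  have hK := hS {k, l, a, b} (by simp [Finset.insert_subset_iff, *]) (by simp)
  have expand : ∀ f : ι → ℤ, ∑ x ∈ ({k, l, a, b} : Finset ι), f x = f k + f l + f a + f b := by
    intro f
    rw [Finset.sum_insert (by simp [*]), Finset.sum_insert (by simp [*]), Finset.sum_pair n6]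
    ring
  have hΓ : 4 ≤ Γ k + Γ l + Γ a + Γ b := by
    have c1 := h.two_le_center k a n2
    have c2 := h.two_le_center k b n3
    have c3 := h.two_le_center l a n4
    have c4 := h.two_le_center l b n5
    have hak := (h.symm a k).trans hka
    have hbk := (h.symm b k).trans hkb
    have hal := (h.symm a l).trans hla
    have hbl := (h.symm b l).trans hlb
    have p : ∀ x y z, C x y = 1 → C x z = 1 → C y z = 2 → ¬ (Γ x = 0 ∧ Γ y = 1 ∧ Γ z = 1) :=
      fun x y z h1 h2 h3 hΓ => h.no_path_zero x y z hΓ.1 hΓ.2.1 hΓ.2.2 h1 h2 h3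
    have q : ∀ x y z, C x y = 1 → C x z = 1 → C y z = 2 → ¬ (Γ x = 1 ∧ Γ y = 0 ∧ Γ z = 0) :=
      fun x y z h1 h2 h3 hΓ => h.no_path_one x y z hΓ.1 hΓ.2.1 hΓ.2.2 h1 h2 h3
    have p1 := p k a b hka hkb hab
    have p2 := p l a b hla hlb hab
    have p3 := p a k l hak hal hkl
    have p4 := p b k l hbk hbl hkl
    have q1 := q k a b hka hkb hab
    have q2 := q l a b hla hlb hab
    have q3 := q a k l hak hal hkl
    have q4 := q b k l hbk hbl hkl
    omega
  have h1 : 0 ≤ excess C Γ {k, l, a, b} := by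
    unfold excess
    simp only [dev_self, dev_of_ne n1, dev_of_ne n2, dev_of_ne n3, dev_of_ne n4,
      dev_of_ne n5, dev_of_ne n6, dev_of_ne n1.symm, dev_of_ne n2.symm, dev_of_ne n3.symm,
      dev_of_ne n4.symm, dev_of_ne n5.symm, dev_of_ne n6.symm, h.symm l k, h.symm a k, h.symm b k,
      h.symm a l, h.symm b l, h.symm b a, *]
    push_cast
    omega
  have h2 : 0 ≤ ∑ y ∈ S \ {k, l, a, b}, ∑ x ∈ {k, l, a, b}, dev C x y := by
    refine Finset.sum_nonneg fun y hy => ?_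
    simp only [Finset.mem_sdiff, Finset.mem_insert, Finset.mem_singleton, not_or] at hy
    obtain ⟨hy, y1, y2, y3, y4⟩ := hy
    rw [expand, dev_of_ne (Ne.symm y1), dev_of_ne (Ne.symm y2), dev_of_ne (Ne.symm y3),
      dev_of_ne (Ne.symm y4)]
    have z1 := h.ne_zero hS hk hy (Ne.symm y1)
    have z2 := h.ne_zero hS hl hy (Ne.symm y2)
    have z3 := h.ne_zero hS ha hy (Ne.symm y3)
    have z4 := h.ne_zero hS hb hy (Ne.symm y4)
    have e1 := Nat.even_iff.1 (h.even_triangle k l y)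
    have e2 := Nat.even_iff.1 (h.even_triangle a b y)
    have e3 := Nat.even_iff.1 (h.even_triangle k a y)
    have f : ∀ x z u v, C x z = 2 → C u v = 2 → C x u = 1 → C x v = 1 → C z u = 1 → C z v = 1 →
        ¬ (C u y = 2 ∧ C v y = 2 ∧ C x y = 1 ∧ C z y = 1) := fun x z u v h1 h2 h3 h4 h5 h6 h7 =>
      h.no_bipartite x z u v y h1 h2 h7.1 h7.2.1 h3 h4 h7.2.2.1 h5 h6 h7.2.2.2
    have f1 := f a b k l hab hkl ((h.symm a k).trans hka) ((h.symm a l).trans hla)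
      ((h.symm b k).trans hkb) ((h.symm b l).trans hlb)
    have f2 := f k l a b hkl hab hka hkb hla hlb
    rw [hkl] at e1
    rw [hab] at e2
    rw [hka] at e3
    omega
  omega

/-- The other stars meeting the star of `i` an even number of times different from two. -/
def far (C : ι → ι → ℕ) (S : Finset ι) (i : ι) : Finset ι :=
  {j ∈ S | j ≠ i ∧ Even (C i j) ∧ C i j ≠ 2}

lemma card_opp_lt (h : IsStarSystem C Γ) (hS : Critical C Γ S) {i : ι} (hi : i ∈ S) :
    (opp C S i).card + 1 + Γ i + 2 * (far C S i).card ≤ 2 * (nbr C S i).card := by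
  have hK := hS {i} (by simpa using hi) (by simp)
  simp only [excess, Finset.sum_singleton, dev_self] at hK
  have key : ∑ y ∈ S \ {i}, ((if y ∈ opp C S i then (1 : ℤ) else 0)
      + 2 * (if y ∈ far C S i then 1 else 0) - 2 * (if y ∈ nbr C S i then 1 else 0))
      ≤ ∑ y ∈ S \ {i}, dev C i y := by
    refine Finset.sum_le_sum fun y hy => ?_
    simp only [Finset.mem_sdiff, Finset.mem_singleton] at hy
    have hz := h.ne_zero hS hi hy.1 (Ne.symm hy.2)
    rw [dev_of_ne (Ne.symm hy.2)]
    simp only [opp, far, nbr, Finset.mem_filter, hy.1, true_and, ne_eq, hy.2, not_false_eq_true,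
      Nat.odd_iff, Nat.even_iff]
    split_ifs <;> omega
  have sub : ∀ T ⊆ S, i ∉ T → ∑ y ∈ S \ {i}, (if y ∈ T then (1 : ℤ) else 0) = T.card := by
    intro T hT hiT
    rw [Finset.sum_ite_mem, Finset.inter_eq_right.2 fun y hy => ?_]
    · simp
    · simp only [Finset.mem_sdiff, Finset.mem_singleton]
      exact ⟨hT hy, fun e => hiT (e ▸ hy)⟩
  rw [Finset.sum_sub_distrib, Finset.sum_add_distrib, ← Finset.mul_sum, ← Finset.mul_sum,
    sub (opp C S i) (Finset.filter_subset _ _) (by simp [opp, h.self]),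
    sub (far C S i) (Finset.filter_subset _ _) (by simp [far]),
    sub (nbr C S i) (Finset.filter_subset _ _) (by simp [nbr, h.self])] at key
  omega

lemma exists_isolated (h : IsStarSystem C Γ) (hS : Critical C Γ S) (hne : S.Nonempty) :
    ∃ k ∈ S, ∀ j ∈ S, C k j ≠ 2 := by
  obtain ⟨i, hi, hmax⟩ := S.exists_max_image (fun i => (far C S i).card) hne
  have step : ∀ i ∈ S, (∀ j ∈ S, (far C S j).card ≤ (far C S i).card) → ∀ j ∈ S, C i j = 2 →
      Γ i = 0 ∧ ∃ k ∈ S, C i k = 1 ∧ (far C S k).card = (far C S i).card := by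
    intro i hi hmax j hj hij
    have c1 := h.card_opp_lt hS hi
    have c2 := h.card_opp_lt hS hj
    have he := h.opp_congr (S := S) (i := i) (j := j) (by rw [hij]; exact even_two)
    have hu : (nbr C S i ∪ nbr C S j).card ≤ (opp C S i).card := by
      refine Finset.card_le_card (Finset.union_subset (nbr_subset_opp i) ?_)
      rw [he]
      exact nbr_subset_opp j
    have hui := Finset.card_union_add_card_inter (nbr C S i) (nbr C S j)
    rw [← he] at c2
    have hpos : 0 < (nbr C S i ∩ nbr C S j).card := by omega
    obtain ⟨k, hk⟩ := Finset.card_pos.1 hpos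
    have hsub : (nbr C S i ∩ nbr C S j).erase k ⊆ far C S k := by
      intro l hl
      simp only [Finset.mem_erase, Finset.mem_inter, nbr, Finset.mem_filter, far] at hl hk ⊢
      have hkl := h.even_triangle i k l
      refine ⟨hl.2.1.1, hl.1, ?_, fun h2 => ?_⟩
      · rw [hk.1.2, hl.2.1.2] at hkl
        simp only [Nat.even_iff] at hkl ⊢
        omega
      · exact h.no_tight_cycle hS hi hj hk.1.1 hl.2.1.1 hij h2 hk.1.2 hl.2.1.2 hk.2.2 hl.2.2.2
    have hle := Finset.card_le_card hsub
    rw [Finset.card_erase_of_mem hk] at hle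
    simp only [Finset.mem_inter, nbr, Finset.mem_filter] at hk
    have := hmax k hk.1.1
    exact ⟨by omega, k, hk.1.1, hk.1.2, by omega⟩
  by_cases hc : ∃ j ∈ S, C i j = 2
  · obtain ⟨j, hj, hij⟩ := hc
    obtain ⟨h0, k, hk, hik, hcard⟩ := step i hi hmax j hj hij
    refine ⟨k, hk, fun l hl hkl => ?_⟩
    have hk0 := (step k hk (fun j hj => by rw [hcard]; exact hmax j hj) l hl hkl).1
    have := h.two_le_center i k (by rintro rfl; simp [h.self] at hik)
    omega
  · push Not at hc
    exact ⟨i, hi, hc⟩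

lemma exists_compatible (h : IsStarSystem C Γ) {k i : ι} {T : Finset ι}
    (hi : i ∈ nbr C S k) (hT : T ⊆ nbr C S k) (m : ℕ) (hcard : (far C S i).card + m < T.card) :
    ∃ U ⊆ T, m ≤ U.card ∧ ∀ j ∈ U, C i j = 2 := by
  refine ⟨(T.erase i) \ far C S i, ?_, ?_, ?_⟩
  · exact Finset.sdiff_subset.trans (Finset.erase_subset _ _)
  · have h1 := Finset.le_card_sdiff (far C S i) (T.erase i)
    have h2 := Finset.pred_card_le_card_erase (s := T) (a := i)
    omega
  · intro j hj
    simp only [Finset.mem_sdiff, Finset.mem_erase] at hj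
    have hjk := hT hj.1.2
    simp only [nbr, far, Finset.mem_filter] at hi hj hjk
    have he := h.even_triangle k i j
    by_contra h2
    refine hj.2 ⟨hjk.1, hj.1.1, ?_, h2⟩
    rw [hi.2, hjk.2] at he
    simp only [Nat.even_iff] at he ⊢
    omega

lemma card_nbr_le (h : IsStarSystem C Γ) {k i : ι} (hi : i ∈ nbr C S k)
    (D : ℕ) (hD : ∀ j ∈ nbr C S k, (far C S j).card ≤ D) :
    (nbr C S k).card ≤ 3 + (far C S i).card + 2 * D := by
  by_contra! hlt
  obtain ⟨U, hU, hUc, hUi⟩ := h.exists_compatible hi subset_rfl (2 * D + 3) (by omega)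
  obtain ⟨j, hj⟩ : U.Nonempty := Finset.card_pos.1 (by omega)
  have hDj := hD j (hU hj)
  obtain ⟨V, hV, hVc, hVj⟩ := h.exists_compatible (hU hj) hU (D + 2) (by omega)
  obtain ⟨l, hl⟩ : V.Nonempty := Finset.card_pos.1 (by omega)
  have hDl := hD l (hU (hV hl))
  obtain ⟨W, hW, hWc, hWl⟩ := h.exists_compatible (hU (hV hl)) (hV.trans hU) 1 (by omega)
  obtain ⟨m, hm⟩ : W.Nonempty := Finset.card_pos.1 (by omega)
  have e : ∀ {x}, x ∈ nbr C S k → C k x = 1 := fun hx => (Finset.mem_filter.1 hx).2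
  exact h.no_fan_four k i j l m (e hi) (e (hU hj)) (e (hU (hV hl))) (e (hU (hV (hW hm))))
    (hUi j hj) (hUi l (hV hl)) (hUi m (hV (hW hm))) (hVj l hl) (hVj m (hW hm)) (hWl m hm)

lemma not_critical (h : IsStarSystem C Γ) (hne : S.Nonempty) : ¬ Critical C Γ S := by
  intro hS
  obtain ⟨k, hk, hiso⟩ := h.exists_isolated hS hne
  have hc := h.card_opp_lt hS hk
  have hno := Finset.card_le_card (nbr_subset_opp (C := C) (S := S) k)
  obtain ⟨b, hb⟩ : ∃ b, (far C S k).card = b := ⟨_, rfl⟩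
  have hopp : ∀ i ∈ nbr C S k, (opp C S i).card = b + 1 := by
    intro i hi
    simp only [nbr, Finset.mem_filter] at hi
    have : opp C S i = insert k (far C S k) := by
      ext y
      have he := h.even_triangle k i y
      rw [hi.2] at he
      simp only [opp, far, Finset.mem_filter, Finset.mem_insert, Nat.odd_iff, Nat.even_iff] at he ⊢
      by_cases hy : y = k
      · subst hy
        simp [hk, h.symm i y, hi.2]
      · simp only [hy, false_or, ne_eq, not_false_eq_true, true_and]
        refine and_congr_right fun hyS => ?_
        have := hiso y hyS
        omega
    rw [this, Finset.card_insert_of_notMem (by simp [far]), hb]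
  have hfar : ∀ i ∈ nbr C S k, 2 * (far C S i).card + Γ i ≤ b := by
    intro i hi
    have h1 := h.card_opp_lt hS (Finset.mem_filter.1 hi).1
    have h2 := Finset.card_le_card (nbr_subset_opp (C := C) (S := S) i)
    rw [hopp i hi] at h1 h2
    omega
  have hcen : ∀ i ∈ nbr C S k, 1 ≤ Γ k + Γ i := by
    intro i hi
    have hki := (Finset.mem_filter.1 hi).2
    have := h.two_le_center k i (by rintro rfl; simp [h.self] at hki)
    omega
  obtain ⟨i, hi⟩ : (nbr C S k).Nonempty := Finset.card_pos.1 (by omega)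
  have hki := (Finset.mem_filter.1 hi).2
  have hub := h.card_nbr_le hi (b / 2) fun j hj => by have := hfar j hj; omega
  have hfi := hfar i hi
  have hci := hcen i hi
  have two : (far C S i).card + 1 < (nbr C S k).card → ∃ j ∈ nbr C S k, C k j = 1 ∧ C i j = 2 := by
    intro hlt
    obtain ⟨U, hU, hUc, hUi⟩ := h.exists_compatible hi subset_rfl 1 hlt
    obtain ⟨j, hj⟩ : U.Nonempty := Finset.card_pos.1 (by omega)
    exact ⟨j, hU hj, (Finset.mem_filter.1 (hU hj)).2, hUi j hj⟩
  rcases Nat.lt_or_ge (Γ k) 1 with hΓ | hΓ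
  · have hub' := h.card_nbr_le hi ((b - 1) / 2) fun j hj => by
      have := hfar j hj; have := hcen j hj; omega
    obtain ⟨j, hj, hkj, hij⟩ := two (by omega)
    have := hfar j hj
    have := hcen j hj
    exact h.no_path_zero k i j (by omega) (by omega) (by omega) hki hkj hij
  rcases Nat.lt_or_ge (Γ k) 2 with hΓ' | hΓ'
  · obtain ⟨j, hj, hkj, hij⟩ := two (by omega)
    have hub' := h.card_nbr_le hj (b / 2) fun j hj => by have := hfar j hj; omega
    have := hfar j hj
    have := hcen j hj
    exact h.no_path_one k i j (by omega) (by omega) (by omega) hki hkj hij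
  · obtain ⟨U, hU, hUc, hUi⟩ := h.exists_compatible hi subset_rfl 2 (by omega)
    obtain ⟨j, hj⟩ : U.Nonempty := Finset.card_pos.1 (by omega)
    have hfj := hfar j (hU hj)
    obtain ⟨V, hV, hVc, hVj⟩ := h.exists_compatible (hU hj) hU 1 (by omega)
    obtain ⟨l, hl⟩ : V.Nonempty := Finset.card_pos.1 (by omega)
    have hfl := hfar l (hU (hV hl))
    exact h.no_triangle i j l (by omega) (by omega) (by omega) (hUi j hj) (hVj l hl)
      (hUi l (hV hl))

end Critical

theorem excess_nonneg [DecidableEq ι] (h : IsStarSystem C Γ) (S : Finset ι) :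
    0 ≤ excess C Γ S := by
  induction S using Finset.strongInduction with
  | H S ih =>
    rcases S.eq_empty_or_nonempty with rfl | hne
    · simp [excess]
    by_contra! hneg
    refine h.not_critical hne fun K hK hKne => ?_
    have hlt : S \ K ⊂ S := Finset.sdiff_ssubset hK hKne
    have h1 := ih _ hlt
    have h2 := h.excess_union (T := S \ K) (K := K) Finset.sdiff_disjoint
    rw [Finset.sdiff_union_of_subset hK] at h2
    omega

theorem le_sum [DecidableEq ι] (h : IsStarSystem C Γ) (S : Finset ι) :
    2 * (S.card * (S.card - 1)) ≤ ∑ i ∈ S, ∑ j ∈ S, C i j + 2 * ∑ i ∈ S, Γ i := by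
  have h1 := h.excess_nonneg S
  rw [h.excess_eq] at h1
  rcases Nat.eq_zero_or_pos S.card with h0 | h0
  · simp [h0]
  · zify [h0]
    linarith

end IsStarSystem

/-- The number of nonzero entries of a binary array. -/
def weight {m n : ℕ} (A : Fin m → Fin n → ZMod 2) : ℕ := ∑ p, ∑ q, (A p q).val

/-- The number of unordered pairs on which a binary vector is constant. -/
def sameCount {n : ℕ} (σ : Fin n → ZMod 2) : ℕ := ∑ p, ∑ q, if p < q ∧ σ p = σ q then 1 else 0

lemma ZMod.val_add_le_two (a b : ZMod 2) : (a + b).val ≤ a.val + b.val := by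
  revert a b; decide

lemma ZMod.eq_zero_or_one (a : ZMod 2) : a = 0 ∨ a = 1 := by
  revert a; decide

lemma sum_sum_eq_sum_lt {n : ℕ} (f : Fin n → Fin n → ℕ) (hf : ∀ p, f p p = 0) :
    ∑ p, ∑ q, f p q = ∑ p, ∑ q, if p < q then f p q + f q p else 0 := by
  have h1 : ∀ p q, f p q = (if p < q then f p q else 0) + (if q < p then f p q else 0) := by
    intro p q
    rcases lt_trichotomy p q with h | rfl | h
    · simp [h, h.not_gt]
    · simp [hf]
    · simp [h, h.not_gt]
  have h2 : ∑ p, ∑ q, (if q < p then f p q else 0) = ∑ p, ∑ q, (if p < q then f q p else 0) :=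
    Finset.sum_comm
  rw [Finset.sum_congr rfl fun p _ => Finset.sum_congr rfl fun q _ => h1 p q]
  simp only [Finset.sum_add_distrib]
  rw [h2]
  simp only [← Finset.sum_add_distrib]
  refine Finset.sum_congr rfl fun p _ => Finset.sum_congr rfl fun q _ => ?_
  split_ifs <;> rfl

lemma sameCount_le {n : ℕ} (f : Fin n → Fin n → ℕ) (σ : Fin n → ZMod 2) (hf : ∀ p, f p p = 0)
    (h : ∀ p q, p ≠ q → ((f p q + f q p : ℕ) : ZMod 2) = 1 + σ p + σ q) :
    sameCount σ ≤ ∑ p, ∑ q, f p q := by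
  rw [sum_sum_eq_sum_lt f hf]
  refine Finset.sum_le_sum fun p _ => Finset.sum_le_sum fun q _ => ?_
  split_ifs with h1 h2 h2
  · have := h p q h2.ne
    rw [h1.2, add_assoc, CharTwo.add_self_eq_zero, add_zero, ZMod.natCast_eq_one_iff_odd] at this
    exact this.pos
  · exact absurd h1.1 h2
  · exact Nat.zero_le _
  · exact Nat.zero_le _

lemma sum_modEq_sameCount {n : ℕ} (f : Fin n → Fin n → ℕ) (σ : Fin n → ZMod 2)
    (hf : ∀ p, f p p = 0)
    (h : ∀ p q, p ≠ q → ((f p q + f q p : ℕ) : ZMod 2) = 1 + σ p + σ q) :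
    ((∑ p, ∑ q, f p q : ℕ) : ZMod 2) = (sameCount σ : ZMod 2) := by
  rw [sum_sum_eq_sum_lt f hf, sameCount]
  push_cast
  refine Finset.sum_congr rfl fun p _ => Finset.sum_congr rfl fun q _ => ?_
  by_cases h1 : p < q
  · have := h p q h1.ne
    push_cast at this
    simp only [h1, if_true, true_and, this]
    generalize σ p = a
    generalize σ q = b
    revert a b
    decide
  · simp [h1]

lemma four_le_sameCount (σ : Fin 5 → ZMod 2) : 4 ≤ sameCount σ := by
  revert σ; decide +kernel

lemma even_sameCount (σ : Fin 5 → ZMod 2) : Even (sameCount σ) := by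
  revert σ; decide +kernel

lemma two_le_sameCount (σ : Fin 4 → ZMod 2) : 2 ≤ sameCount σ := by
  revert σ; decide +kernel

/-- Parity data of a drawing of the join of a star with five vertices and a discrete graph:
`Y i p q` and `s i j p` count how often the edge from the hub `p` to the vertex `i` winds around
the hub `q` and around the vertex `j`; `h` and `g` do the same for the edges of the star. -/
structure ParityModel (ι : Type*) where
  Y : ι → Fin 5 → Fin 5 → ZMod 2
  s : ι → ι → Fin 5 → ZMod 2
  τ : Fin 5 → Fin 5 → ZMod 2
  ω : ι → ι → ZMod 2
  h : ι → Fin 4 → ZMod 2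
  g : Fin 4 → Fin 4 → ZMod 2
  τ_swap : ∀ p q, p ≠ q → τ p q + τ q p = 1
  ω_swap : ∀ i j, i ≠ j → ω i j + ω j i = 1

namespace ParityModel

variable {ι : Type*} (P : ParityModel ι)

/-- The parity of the number of crossings of the edges `p i` and `q j`. -/
def X (i j : ι) (p q : Fin 5) : ZMod 2 :=
  if p = q then 0 else P.Y i p q + P.Y j q p + P.s i j p + P.s j i q + P.τ p q + P.ω i j

/-- The parity of the number of crossings of the edge from the hub `p` to `i` and the edge of the
star ending at `q`. -/
def G (i : ι) (p q : Fin 4) : ZMod 2 :=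
  if p = q then 0 else
    P.Y i p.castSucc (Fin.last 4) + P.Y i p.castSucc q.castSucc + P.h i q + P.g p q

open Classical in
/-- The crossings forced between the stars of `i` and `j`. -/
noncomputable def C (i j : ι) : ℕ := if i = j then 0 else weight (P.X i j)

/-- The crossings forced between the star of `i` and the central star. -/
def Γ (i : ι) : ℕ := weight (P.G i)

/-- The crossings forced between the stars of `i` and `j` on the leaves of the central star. -/
def inner (i j : ι) : Fin 4 → Fin 4 → ZMod 2 := fun p q => P.X i j p.castSucc q.castSucc

variable {P}

lemma X_self (i j : ι) (p : Fin 5) : P.X i j p p = 0 := if_pos rfl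

lemma X_of_ne {i j : ι} {p q : Fin 5} (h : p ≠ q) :
    P.X i j p q = P.Y i p q + P.Y j q p + P.s i j p + P.s j i q + P.τ p q + P.ω i j := if_neg h

lemma G_self (i : ι) (p : Fin 4) : P.G i p p = 0 := if_pos rfl

lemma G_of_ne {i : ι} {p q : Fin 4} (h : p ≠ q) :
    P.G i p q = P.Y i p.castSucc (Fin.last 4) + P.Y i p.castSucc q.castSucc + P.h i q + P.g p q :=
  if_neg h

lemma C_self (i : ι) : P.C i i = 0 := if_pos rfl

lemma C_of_ne {i j : ι} (h : i ≠ j) : P.C i j = weight (P.X i j) := if_neg h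

lemma ne_of_C_ne_zero {i j : ι} (h : P.C i j ≠ 0) : i ≠ j := by
  rintro rfl; exact h (C_self i)

lemma X_swap {i j : ι} (hij : i ≠ j) (p q : Fin 5) : P.X i j p q = P.X j i q p := by
  by_cases hpq : p = q
  · subst hpq; simp [X_self]
  · rw [X_of_ne hpq, X_of_ne (Ne.symm hpq)]
    have := P.τ_swap p q hpq
    have := P.ω_swap i j hij
    grind

lemma C_comm (i j : ι) : P.C i j = P.C j i := by
  by_cases hij : i = j
  · rw [hij]
  · rw [C_of_ne hij, C_of_ne (Ne.symm hij), weight, weight, Finset.sum_comm]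
    simp only [X_swap hij]

lemma weight_eq_inner (i j : ι) : weight (P.X i j) = weight (P.inner i j) +
    ∑ p : Fin 4, (P.X i j p.castSucc (Fin.last 4)).val +
    ∑ q : Fin 4, (P.X i j (Fin.last 4) q.castSucc).val := by
  simp only [weight, inner, Fin.sum_univ_castSucc (n := 4), X_self, Finset.sum_add_distrib,
    ZMod.val_zero, add_zero]

lemma triangle_aux {i j k : ι} (hij : i ≠ j) (hjk : j ≠ k) (hik : i ≠ k) :
    4 ≤ P.C i j + P.C j k + P.C i k ∧ Even (P.C i j + P.C j k + P.C i k) := by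
  let f : Fin 5 → Fin 5 → ℕ := fun p q =>
    (P.X i j p q).val + (P.X j k p q).val + (P.X i k p q).val
  let σ : Fin 5 → ZMod 2 := fun p =>
    P.s i j p + P.s j i p + P.s j k p + P.s k j p + P.s i k p + P.s k i p
  have hf : ∀ p, f p p = 0 := fun p => by simp [f, X_self]
  have hσ : ∀ p q, p ≠ q → ((f p q + f q p : ℕ) : ZMod 2) = 1 + σ p + σ q := by
    intro p q hpq
    have := P.τ_swap p q hpq
    simp only [f, σ, Nat.cast_add, ZMod.natCast_val, ZMod.cast_id', id_eq, X_of_ne hpq,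
      X_of_ne (Ne.symm hpq)]
    grind
  have hC : P.C i j + P.C j k + P.C i k = ∑ p, ∑ q, f p q := by
    simp only [C_of_ne hij, C_of_ne hjk, C_of_ne hik, weight, f, Finset.sum_add_distrib]
  rw [hC]
  refine ⟨(four_le_sameCount σ).trans (sameCount_le f σ hf hσ), ?_⟩
  rw [← ZMod.natCast_eq_zero_iff_even, sum_modEq_sameCount f σ hf hσ,
    ZMod.natCast_eq_zero_iff_even]
  exact even_sameCount σ

lemma even_triangle (i j k : ι) : Even (P.C i j + P.C j k + P.C i k) := by
  by_cases hij : i = j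
  · subst hij; simp [C_self]
  by_cases hjk : j = k
  · subst hjk; simp [C_self]
  by_cases hik : i = k
  · subst hik; simp [C_self, C_comm j i]
  exact (triangle_aux hij hjk hik).2

lemma two_le_inner (i j : ι) : 2 ≤ weight (P.inner i j) + P.Γ i + P.Γ j := by
  let f : Fin 4 → Fin 4 → ℕ := fun p q =>
    (P.X i j p.castSucc q.castSucc).val + (P.G i p q).val + (P.G j p q).val
  let σ : Fin 4 → ZMod 2 := fun p => P.s i j p.castSucc + P.s j i p.castSucc
    + P.Y i p.castSucc (Fin.last 4) + P.Y j p.castSucc (Fin.last 4) + P.h i p + P.h j p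
  have hf : ∀ p, f p p = 0 := fun p => by simp [f, X_self, G_self]
  have hσ : ∀ p q, p ≠ q → ((f p q + f q p : ℕ) : ZMod 2) = 1 + σ p + σ q := by
    intro p q hpq
    have hpq' : p.castSucc ≠ q.castSucc := by simpa using hpq
    have := P.τ_swap _ _ hpq'
    simp only [f, σ, Nat.cast_add, ZMod.natCast_val, ZMod.cast_id', id_eq, X_of_ne hpq',
      X_of_ne (Ne.symm hpq'), G_of_ne hpq, G_of_ne (Ne.symm hpq)]
    grind
  have hC : weight (P.inner i j) + P.Γ i + P.Γ j = ∑ p, ∑ q, f p q := by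
    simp only [Γ, weight, inner, f, Finset.sum_add_distrib]
  rw [hC]
  exact (two_le_sameCount σ).trans (sameCount_le f σ hf hσ)

lemma inner_le {i j : ι} (hij : i ≠ j) : weight (P.inner i j) ≤ P.C i j := by
  rw [C_of_ne hij, weight_eq_inner]; omega

lemma two_le_center {i j : ι} (hij : i ≠ j) : 2 ≤ P.C i j + P.Γ i + P.Γ j := by
  have := two_le_inner (P := P) i j
  have := inner_le (P := P) hij
  omega

end ParityModel

lemma ZMod.add_eq_one_of_ne {a b : ZMod 2} (h : a ≠ b) : a + b = 1 := by
  revert a b; decide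

/-- The number of unordered pairs on which a binary vector is not constant. -/
def splitCount {n : ℕ} (σ : Fin n → ZMod 2) : ℕ := ∑ p, ∑ q, if p < q ∧ σ p ≠ σ q then 1 else 0

lemma splitCount_le {n : ℕ} (f : Fin n → Fin n → ℕ) (σ : Fin n → ZMod 2) (hf : ∀ p, f p p = 0)
    (h : ∀ p q, p ≠ q → ((f p q + f q p : ℕ) : ZMod 2) = σ p + σ q) :
    splitCount σ ≤ ∑ p, ∑ q, f p q := by
  rw [sum_sum_eq_sum_lt f hf]
  refine Finset.sum_le_sum fun p _ => Finset.sum_le_sum fun q _ => ?_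
  split_ifs with h1 h2 h2
  · have h3 := h p q h2.ne
    rw [ZMod.add_eq_one_of_ne h1.2, ZMod.natCast_eq_one_iff_odd] at h3
    exact h3.pos
  · exact absurd h1.1 h2
  · exact Nat.zero_le _
  · exact Nat.zero_le _

lemma eq_const_of_splitCount (σ : Fin 4 → ZMod 2) (h : splitCount σ ≤ 2) : ∀ p q, σ p = σ q := by
  revert σ; decide +kernel

lemma two_le_sum_val (σ : Fin 4 → ZMod 2) (h : sameCount σ ≤ 2) (c : ZMod 2) :
    2 ≤ ∑ p, (σ p + c).val := by
  revert σ; revert c; decide +kernel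

lemma four_le_sameCount_add (σ : Fin 4 → ZMod 2) (c : ZMod 2) :
    4 ≤ sameCount (fun p => σ p + c) + ∑ p, (σ p).val := by
  revert σ; revert c; decide +kernel

lemma eq_zero_of_sum_val_eq_zero {n : ℕ} {r : Fin n → ZMod 2} (h : ∑ p, (r p).val = 0) (p : Fin n) :
    r p = 0 := by
  rw [Finset.sum_eq_zero_iff] at h
  exact (ZMod.val_eq_zero _).1 (h p (Finset.mem_univ p))

lemma eq_zero_of_weight_eq_zero {m n : ℕ} {A : Fin m → Fin n → ZMod 2} (h : weight A = 0)
    (p : Fin m) (q : Fin n) : A p q = 0 := by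
  rw [weight, Finset.sum_eq_zero_iff] at h
  exact eq_zero_of_sum_val_eq_zero (h p (Finset.mem_univ p)) q

lemma weight_add_le {m n : ℕ} (A B : Fin m → Fin n → ZMod 2) :
    weight (fun p q => A p q + B p q) ≤ weight A + weight B := by
  simp only [weight, ← Finset.sum_add_distrib]
  exact Finset.sum_le_sum fun p _ => Finset.sum_le_sum fun q _ => ZMod.val_add_le_two _ _

lemma weight_swap {m n : ℕ} (A : Fin m → Fin n → ZMod 2) :
    weight (fun p q => A q p) = weight A := Finset.sum_comm

lemma natCast_weight {m n : ℕ} (A : Fin m → Fin n → ZMod 2) :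
    (weight A : ZMod 2) = ∑ p, ∑ q, A p q := by
  simp [weight]

lemma exists_unit_of_weight_eq_one {m n : ℕ} {A : Fin m → Fin n → ZMod 2} (h : weight A = 1) :
    ∃ a b, ∀ p q, A p q = if p = a ∧ q = b then 1 else 0 := by
  have aux : ∀ {n : ℕ} (f : Fin n → ℕ), ∑ p, f p = 1 → ∃ a, f a = 1 ∧ ∀ p, p ≠ a → f p = 0 := by
    intro n f hf
    obtain ⟨a, -, ha⟩ := Finset.exists_ne_zero_of_sum_ne_zero (s := Finset.univ) (f := f) (by omega)
    rw [← Finset.add_sum_erase _ _ (Finset.mem_univ a)] at hf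
    refine ⟨a, by omega, fun p hp => ?_⟩
    have h0 : ∑ x ∈ Finset.univ.erase a, f x = 0 := by omega
    exact Finset.sum_eq_zero_iff.1 h0 p (by simp [hp])
  obtain ⟨a, ha, ha'⟩ := aux _ h
  obtain ⟨b, hb, hb'⟩ := aux _ ha
  refine ⟨a, b, fun p q => ?_⟩
  by_cases hp : p = a
  · subst hp
    by_cases hq : q = b
    · subst hq
      rcases ZMod.eq_zero_or_one (A p q) with h0 | h0
      · simp [h0] at hb
      · simp [h0]
    · simp [hq, (ZMod.val_eq_zero _).1 (hb' q hq)]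
  · simp [hp, eq_zero_of_sum_val_eq_zero (ha' p hp) q]

lemma unit_cases {m n : ℕ} {A B C D : Fin m → Fin n → ZMod 2} (hA : weight A = 1)
    (hB : weight B = 1) (hC : weight C = 1) (hD : weight D = 1)
    (h : ∀ p q, A p q + B p q + C p q + D p q = 0) :
    (∀ p q, A p q = B p q) ∨ (∀ p q, A p q = C p q) ∨ (∀ p q, A p q = D p q) := by
  obtain ⟨a, a', hA⟩ := exists_unit_of_weight_eq_one hA
  obtain ⟨b, b', hB⟩ := exists_unit_of_weight_eq_one hB
  obtain ⟨c, c', hC⟩ := exists_unit_of_weight_eq_one hC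
  obtain ⟨d, d', hD⟩ := exists_unit_of_weight_eq_one hD
  have h1 := h a a'
  simp only [hA, hB, hC, hD, and_self, if_true] at h1 ⊢
  by_cases h2 : a = b ∧ a' = b'
  · obtain ⟨rfl, rfl⟩ := h2; simp
  by_cases h3 : a = c ∧ a' = c'
  · obtain ⟨rfl, rfl⟩ := h3; simp
  by_cases h4 : a = d ∧ a' = d'
  · obtain ⟨rfl, rfl⟩ := h4; simp
  simp [h2, h3, h4] at h1

lemma sum_offDiag_eq (r : Fin 4 → ℕ) : ∑ p, ∑ q : Fin 4, (if p = q then 0 else r p) =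
    3 * ∑ p, r p := by
  rw [Finset.mul_sum]
  refine Finset.sum_congr rfl fun p _ => ?_
  fin_cases p <;> simp [Fin.sum_univ_succ] <;> ring

lemma three_mul_le_weight {D : Fin 4 → Fin 4 → ZMod 2} {r : Fin 4 → ZMod 2}
    (h : ∀ p q, p ≠ q → D p q = r p) : 3 * ∑ p, (r p).val ≤ weight D := by
  rw [← sum_offDiag_eq]
  refine Finset.sum_le_sum fun p _ => Finset.sum_le_sum fun q _ => ?_
  split_ifs with hpq
  · exact Nat.zero_le _
  · rw [h p q hpq]

lemma natCast_weight_rows {D : Fin 4 → Fin 4 → ZMod 2} {r : Fin 4 → ZMod 2} (hD : ∀ p, D p p = 0)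
    (h : ∀ p q, p ≠ q → D p q = r p) : (weight D : ZMod 2) = ((∑ p, (r p).val : ℕ) : ZMod 2) := by
  have : weight D = 3 * ∑ p, (r p).val := by
    rw [← sum_offDiag_eq]
    refine Finset.sum_congr rfl fun p _ => Finset.sum_congr rfl fun q _ => ?_
    split_ifs with hpq
    · rw [← hpq, hD, ZMod.val_zero]
    · rw [h p q hpq]
  rw [this, Nat.cast_mul]
  have : ((3 : ℕ) : ZMod 2) = 1 := by decide
  rw [this, one_mul]

namespace ParityModel

variable {ι : Type*} {P : ParityModel ι}

/-- The tournament on the leaves of the central star determined by the parity data. -/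
def T (P : ParityModel ι) (p q : Fin 4) : ZMod 2 :=
  P.g p q + P.g q p + P.τ p.castSucc q.castSucc

/-- The parity of the winding of the edge from the centre of the star. -/
def y (P : ParityModel ι) (i : ι) (q : Fin 4) : ZMod 2 :=
  P.Y i (Fin.last 4) q.castSucc + P.h i q + P.τ (Fin.last 4) q.castSucc

lemma T_swap {p q : Fin 4} (h : p ≠ q) : P.T p q + P.T q p = 1 := by
  have := P.τ_swap p.castSucc q.castSucc (by simpa using h)
  unfold T
  grind

lemma inner_self (i j : ι) (p : Fin 4) : P.inner i j p p = 0 := X_self i j _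

lemma exists_inner_eq (i j : ι) : ∃ c, ∀ p q, p ≠ q → P.inner i j p q =
    P.G i p q + P.G j q p + P.X i j p.castSucc (Fin.last 4) + P.y j p
      + P.X i j (Fin.last 4) q.castSucc + P.y i q + P.T p q + c := by
  refine ⟨1 + P.s j i (Fin.last 4) + P.s i j (Fin.last 4) + P.ω i j, fun p q hpq => ?_⟩
  have hpq' : p.castSucc ≠ q.castSucc := by simpa using hpq
  have hp : p.castSucc ≠ Fin.last 4 := (Fin.castSucc_lt_last p).ne
  have hq : Fin.last 4 ≠ q.castSucc := (Fin.castSucc_lt_last q).ne'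
  have := P.τ_swap _ _ hp
  simp only [inner, X_of_ne hpq', X_of_ne hp, X_of_ne hq, G_of_ne hpq, G_of_ne hpq.symm, y, T]
  grind

lemma border_eq_zero {i j : ι} (hij : i ≠ j) (h : P.C i j ≤ weight (P.inner i j)) (p : Fin 4) :
    P.X i j p.castSucc (Fin.last 4) = 0 ∧ P.X i j (Fin.last 4) p.castSucc = 0 := by
  rw [C_of_ne hij, weight_eq_inner] at h
  exact ⟨eq_zero_of_sum_val_eq_zero (n := 4)
    (r := fun p => P.X i j p.castSucc (Fin.last 4)) (by omega) p,
    eq_zero_of_sum_val_eq_zero (n := 4)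
    (r := fun p => P.X i j (Fin.last 4) p.castSucc) (by omega) p⟩

lemma exists_inner_eq_of_le {i j : ι} (hij : i ≠ j) (h : P.C i j ≤ weight (P.inner i j)) :
    ∃ c, ∀ p q, p ≠ q →
      P.inner i j p q = P.G i p q + P.G j q p + P.y j p + P.y i q + P.T p q + c := by
  obtain ⟨c, hc⟩ := exists_inner_eq (P := P) i j
  refine ⟨c, fun p q hpq => ?_⟩
  rw [hc p q hpq, (border_eq_zero hij h p).1, (border_eq_zero hij h q).2]
  ring

lemma G_eq_zero {i : ι} (h : P.Γ i = 0) (p q : Fin 4) : P.G i p q = 0 :=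
  eq_zero_of_weight_eq_zero h p q

lemma sameCount_y_le {i j : ι} (hij : i ≠ j) (hC : P.C i j ≤ 2) (hi : P.Γ i = 0) (hj : P.Γ j = 0) :
    sameCount (fun p => P.y i p + P.y j p) ≤ 2 := by
  have h2 := two_le_inner (P := P) i j
  obtain ⟨c, hc⟩ := exists_inner_eq_of_le (P := P) hij (by omega)
  refine (sameCount_le (fun p q => (P.inner i j p q).val) _ (fun p => by simp [inner_self])
    fun p q hpq => ?_).trans ((inner_le hij).trans hC)
  have := T_swap (P := P) hpq
  simp only [Nat.cast_add, ZMod.natCast_val, ZMod.cast_id', id_eq, hc p q hpq, hc q p hpq.symm,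
    G_eq_zero hi, G_eq_zero hj]
  grind

lemma no_triangle {i j k : ι} (hi : P.Γ i = 0) (hj : P.Γ j = 0) (hk : P.Γ k = 0)
    (hij : P.C i j = 2) (hjk : P.C j k = 2) (hik : P.C i k = 2) : False := by
  have nij := ne_of_C_ne_zero (P := P) (i := i) (j := j) (by omega)
  have njk := ne_of_C_ne_zero (P := P) (i := j) (j := k) (by omega)
  have nik := ne_of_C_ne_zero (P := P) (i := i) (j := k) (by omega)
  obtain ⟨c, hc⟩ := exists_inner_eq_of_le (P := P) nij (by have := two_le_inner (P := P) i j; omega)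
  obtain ⟨d, hd⟩ := exists_inner_eq_of_le (P := P) nik (by have := two_le_inner (P := P) i k; omega)
  have h1 := two_le_sum_val _ (sameCount_y_le njk hjk.le hj hk) (c + d)
  have h2 : 3 * ∑ p, (P.y j p + P.y k p + (c + d)).val ≤
      weight (fun p q => P.inner i j p q + P.inner i k p q) := by
    refine three_mul_le_weight fun p q hpq => ?_
    rw [hc p q hpq, hd p q hpq, G_eq_zero hi, G_eq_zero hj, G_eq_zero hk]
    grind
  have h3 := weight_add_le (P.inner i j) (P.inner i k)
  have h4 := inner_le (P := P) nij
  have h5 := inner_le (P := P) nik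
  omega

lemma no_path_one {k i j : ι} (hk : P.Γ k = 1) (hi : P.Γ i = 0) (hj : P.Γ j = 0)
    (hki : P.C k i = 1) (hkj : P.C k j = 1) (hij : P.C i j = 2) : False := by
  have nij := ne_of_C_ne_zero (P := P) (i := i) (j := j) (by omega)
  have nki := ne_of_C_ne_zero (P := P) (i := k) (j := i) (by omega)
  have nkj := ne_of_C_ne_zero (P := P) (i := k) (j := j) (by omega)
  obtain ⟨c, hc⟩ := exists_inner_eq_of_le (P := P) nki (by have := two_le_inner (P := P) k i; omega)
  obtain ⟨d, hd⟩ := exists_inner_eq_of_le (P := P) nkj (by have := two_le_inner (P := P) k j; omega)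
  have h1 := two_le_sum_val _ (sameCount_y_le nij hij.le hi hj) (c + d)
  have h2 : 3 * ∑ p, (P.y i p + P.y j p + (c + d)).val ≤
      weight (fun p q => P.inner k i p q + P.inner k j p q) := by
    refine three_mul_le_weight fun p q hpq => ?_
    rw [hc p q hpq, hd p q hpq, G_eq_zero hi, G_eq_zero hj]
    grind
  have h3 := weight_add_le (P.inner k i) (P.inner k j)
  have h4 := inner_le (P := P) nki
  have h5 := inner_le (P := P) nkj
  omega

lemma no_path_zero {k i j : ι} (hk : P.Γ k = 0) (hi : P.Γ i = 1) (hj : P.Γ j = 1)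
    (hki : P.C k i = 1) (hkj : P.C k j = 1) (hij : P.C i j = 2) : False := by
  have nij := ne_of_C_ne_zero (P := P) (i := i) (j := j) (by omega)
  have nki := ne_of_C_ne_zero (P := P) (i := k) (j := i) (by omega)
  have nkj := ne_of_C_ne_zero (P := P) (i := k) (j := j) (by omega)
  have wki : weight (P.inner k i) = 1 := by
    have := two_le_inner (P := P) k i; have := inner_le (P := P) nki; omega
  have wkj : weight (P.inner k j) = 1 := by
    have := two_le_inner (P := P) k j; have := inner_le (P := P) nkj; omega
  obtain ⟨c, hc⟩ := exists_inner_eq_of_le (P := P) nki (by omega)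
  obtain ⟨d, hd⟩ := exists_inner_eq_of_le (P := P) nkj (by omega)
  obtain ⟨e, he⟩ := exists_inner_eq (P := P) i j
  simp only [G_eq_zero hk, zero_add] at hc hd
  have hrow : ∀ p q, p ≠ q → (P.inner k i p q + P.G i q p) + (P.inner k j p q + P.G j q p) =
      P.y i p + P.y j p + (c + d) := by
    intro p q hpq
    rw [hc p q hpq, hd p q hpq]
    grind
  have hle := three_mul_le_weight hrow
  have hpar := natCast_weight_rows
    (fun p => by simp [inner_self, G_self] : ∀ p, (P.inner k i p p + P.G i p p)
      + (P.inner k j p p + P.G j p p) = 0) hrow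
  have h4 : ∀ A B C D : Fin 4 → Fin 4 → ZMod 2, weight A = 1 → weight B = 1 → weight C = 1 →
      weight D = 1 → weight (fun p q => (A p q + B q p) + (C p q + D q p)) ≤ 4 ∧
      (weight (fun p q => (A p q + B q p) + (C p q + D q p)) : ZMod 2) = 0 := by
    intro A B C D hA hB hC hD
    have h1 := weight_add_le A (fun p q => B q p)
    have h2 := weight_add_le C (fun p q => D q p)
    have h3 := weight_add_le (fun p q => A p q + B q p) (fun p q => C p q + D q p)
    rw [weight_swap B] at h1
    rw [weight_swap D] at h2
    refine ⟨by omega, ?_⟩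
    have e1 := natCast_weight A
    have e2 := natCast_weight (fun p q => B q p)
    have e3 := natCast_weight C
    have e4 := natCast_weight (fun p q => D q p)
    rw [weight_swap B] at e2
    rw [weight_swap D] at e4
    rw [natCast_weight]
    simp only [Finset.sum_add_distrib]
    rw [← e1, ← e2, ← e3, ← e4, hA, hB, hC, hD]
    decide
  obtain ⟨hw1, hw2⟩ := h4 _ _ _ _ wki hi wkj hj
  rw [hw2, eq_comm, ZMod.natCast_eq_zero_iff_even, Nat.even_iff] at hpar
  have hy : ∀ p, P.y i p + P.y j p + (c + d) = 0 := eq_zero_of_sum_val_eq_zero (by omega)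
  have hzero : ∀ p q, P.inner k i p q + P.inner k j p q + P.G i q p + P.G j q p = 0 := by
    intro p q
    by_cases hpq : p = q
    · subst hpq; simp [inner_self, G_self]
    · have h1 := hrow p q hpq
      rw [hy] at h1
      rw [← h1]
      ring
  have hν := C_of_ne (P := P) nij
  rw [weight_eq_inner, hij] at hν
  rcases unit_cases wki wkj ((weight_swap (P.G i)).trans hi) ((weight_swap (P.G j)).trans hj) hzero
    with h | h | h
  · have hG : ∀ p q, P.G i p q = P.G j p q := by
      intro p q
      have h1 := hzero q p
      have h2 := h q p
      grind
    have h1 := sameCount_le (fun p q => (P.inner i j p q).val)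
      (fun p => P.X i j p.castSucc (Fin.last 4) + P.X i j (Fin.last 4) p.castSucc + (c + d))
      (fun p => by simp [inner_self]) (fun p q hpq => by
        have h1 := T_swap (P := P) hpq
        have h2 := hy p
        have h3 := hy q
        simp only [Nat.cast_add, ZMod.natCast_val, ZMod.cast_id', id_eq, he p q hpq,
          he q p hpq.symm, hG]
        grind)
    have h2 := four_le_sameCount_add
      (fun p => P.X i j p.castSucc (Fin.last 4) + P.X i j (Fin.last 4) p.castSucc) (c + d)
    have h3 : ∑ p : Fin 4, (P.X i j p.castSucc (Fin.last 4) + P.X i j (Fin.last 4) p.castSucc).val ≤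
        ∑ p : Fin 4, (P.X i j p.castSucc (Fin.last 4)).val +
          ∑ p : Fin 4, (P.X i j (Fin.last 4) p.castSucc).val := by
      rw [← Finset.sum_add_distrib]
      exact Finset.sum_le_sum fun p _ => ZMod.val_add_le_two _ _
    simp only [weight] at hν
    omega
  · have h1 := sameCount_le (fun _ _ : Fin 4 => 0) (fun p => P.y i p + P.y k p)
      (fun p => rfl) (fun p q hpq => by
        have h1 := T_swap (P := P) hpq
        have h2 := hc p q hpq
        have h3 := hc q p hpq.symm
        have h4 := h p q
        have h5 := h q p
        simp only [Nat.cast_add, Nat.cast_zero]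
        grind)
    have h2 := two_le_sameCount (fun p => P.y i p + P.y k p)
    simp only [Finset.sum_const_zero] at h1
    omega
  · have hs0 := sameCount_le (fun p q => (P.G i p q).val + (P.G j p q).val)
      (fun p => P.y i p + P.y k p) (fun p => by simp [G_self]) (fun p q hpq => by
        have h1 := T_swap (P := P) hpq
        have h2 := hc p q hpq
        have h3 := hc q p hpq.symm
        have h4 := h p q
        have h5 := h q p
        simp only [Nat.cast_add, ZMod.natCast_val, ZMod.cast_id', id_eq]
        grind)
    have hs1 : ∑ p, ∑ q, ((P.G i p q).val + (P.G j p q).val) = 2 := by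
      simp only [Finset.sum_add_distrib]
      change P.Γ i + P.Γ j = 2
      omega
    rw [hs1] at hs0
    have hinner : ∀ p q, p ≠ q → P.inner i j p q = P.G i p q + P.G i q p +
        P.X i j p.castSucc (Fin.last 4) + P.X i j (Fin.last 4) q.castSucc + P.y i q + P.y k q +
        (d + e) := by
      intro p q hpq
      have h2 := hd p q hpq
      have h4 := h p q
      have h5 := hzero p q
      rw [he p q hpq]
      grind
    have hs := splitCount_le (fun p q => (P.inner i j p q).val)
      (fun p => P.y i p + P.y k p + P.X i j p.castSucc (Fin.last 4) +
        P.X i j (Fin.last 4) p.castSucc)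
      (fun p => by simp [inner_self]) (fun p q hpq => by
        simp only [Nat.cast_add, ZMod.natCast_val, ZMod.cast_id', id_eq, hinner p q hpq,
          hinner q p hpq.symm]
        grind)
    have hconst := eq_const_of_splitCount _ (hs.trans ((inner_le nij).trans hij.le))
    have h2 := two_le_sum_val _ hs0 (P.y i 0 + P.y k 0 + P.X i j (Fin.castSucc 0) (Fin.last 4) +
        P.X i j (Fin.last 4) (Fin.castSucc 0))
    have h3 : ∑ p : Fin 4, (P.y i p + P.y k p + (P.y i 0 + P.y k 0 +
          P.X i j (Fin.castSucc 0) (Fin.last 4) + P.X i j (Fin.last 4) (Fin.castSucc 0))).val ≤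
        ∑ p : Fin 4, (P.X i j p.castSucc (Fin.last 4)).val +
          ∑ p : Fin 4, (P.X i j (Fin.last 4) p.castSucc).val := by
      rw [← Finset.sum_add_distrib]
      refine Finset.sum_le_sum fun p _ => ?_
      refine le_trans (le_of_eq ?_) (ZMod.val_add_le_two _ _)
      have := hconst p 0
      congr 1
      grind
    have hw0 : weight (P.inner i j) = 0 := by omega
    have hzero' := fun p q => eq_zero_of_weight_eq_zero hw0 p q
    obtain ⟨a, b, hab⟩ := exists_unit_of_weight_eq_one hi
    have hne : a ≠ b := by
      rintro rfl
      have h1 := hab a a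
      rw [G_self] at h1
      simp at h1
    have hGν : ∃ c', ∀ p q, p ≠ q → P.G i p q + P.G i q p =
        P.X i j p.castSucc (Fin.last 4) + P.X i j q.castSucc (Fin.last 4) + c' := by
      refine ⟨P.y i 0 + P.y k 0 + P.X i j (Fin.castSucc 0) (Fin.last 4) +
        P.X i j (Fin.last 4) (Fin.castSucc 0) + (d + e), fun p q hpq => ?_⟩
      have h1 := hinner p q hpq
      have h2 := hconst q 0
      rw [hzero' p q] at h1
      grind
    obtain ⟨c', hc'⟩ := hGν
    rcases ZMod.eq_zero_or_one c' with rfl | rfl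
    · have h5 := splitCount_le (fun p q => (P.G i p q).val)
        (fun p => P.X i j p.castSucc (Fin.last 4)) (fun p => by simp [G_self]) (fun p q hpq => by
          have h1 := hc' p q hpq
          simp only [Nat.cast_add, ZMod.natCast_val, ZMod.cast_id', id_eq]
          grind)
      have h6 : ∑ p, ∑ q, (P.G i p q).val = 1 := hi
      have h7 := eq_const_of_splitCount _ (h5.trans (h6.le.trans one_le_two)) a b
      have h8 := hc' a b hne
      rw [hab, hab, if_pos ⟨rfl, rfl⟩, if_neg (by simp [hne.symm]), h7,
        CharTwo.add_self_eq_zero] at h8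
      simp at h8
    · have h5 := sameCount_le (fun p q => (P.G i p q).val)
        (fun p => P.X i j p.castSucc (Fin.last 4)) (fun p => by simp [G_self]) (fun p q hpq => by
          have h1 := hc' p q hpq
          simp only [Nat.cast_add, ZMod.natCast_val, ZMod.cast_id', id_eq]
          grind)
      have h6 : ∑ p, ∑ q, (P.G i p q).val = 1 := hi
      have h7 := two_le_sameCount (fun p => P.X i j p.castSucc (Fin.last 4))
      omega

end ParityModel

/-- The bit mask `m`, scaled by an element of `ZMod 2`. -/
def maskSMul (a : ZMod 2) (m : ℕ) : ℕ := if a = 1 then m else 0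

/-- All sums modulo two of a list of bit masks. -/
def maskSpan : List ℕ → List ℕ
  | [] => [0]
  | m :: l => maskSpan l ++ (maskSpan l).map (m ^^^ ·)

/-- A linear combination modulo two of bit masks. -/
def maskSum : List (ZMod 2 × ℕ) → ℕ
  | [] => 0
  | x :: l => maskSMul x.1 x.2 ^^^ maskSum l

/-- The number of ones among the five lowest bits of `n`, read off from a table. -/
def rowCount (n : ℕ) : ℕ := (55157063682984551670960690248 >>> (3 * (n % 32))) % 8

/-- The number of ones among the 25 lowest bits of `n`. -/
def bitCount (n : ℕ) : ℕ :=
  rowCount n + rowCount (n >>> 5) + rowCount (n >>> 10) + rowCount (n >>> 15) + rowCount (n >>> 20)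

lemma maskSum_mem_maskSpan (l : List (ZMod 2 × ℕ)) : maskSum l ∈ maskSpan (l.map Prod.snd) := by
  induction l with
  | nil => simp [maskSum, maskSpan]
  | cons x l ih =>
    simp only [maskSum, maskSpan, List.map_cons, maskSMul, List.mem_append, List.mem_map]
    split_ifs with h
    · exact Or.inr ⟨_, ih, rfl⟩
    · left; simpa using ih

lemma rowCount_eq_sum (n : ℕ) : rowCount n = ∑ i : Fin 5, (n.testBit i).toNat := by
  have h1 : ∀ k : Fin 32, rowCount k = ∑ i : Fin 5, ((k : ℕ).testBit i).toNat := by decide +kernel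
  have h2 := h1 ⟨n % 32, Nat.mod_lt _ (by norm_num)⟩
  simp only [rowCount, Nat.mod_mod] at h2 ⊢
  rw [h2]
  refine Finset.sum_congr rfl fun i _ => ?_
  rw [show 32 = 2 ^ 5 by norm_num, Nat.testBit_mod_two_pow]
  simp [i.isLt]

/-- The five-by-five binary array encoded by `n` is `A`. -/
def IsCode (n : ℕ) (A : Fin 5 → Fin 5 → ZMod 2) : Prop :=
  ∀ p q : Fin 5, n.testBit (5 * p + q) = decide (A p q = 1)

lemma IsCode.bitCount_eq {n : ℕ} {A : Fin 5 → Fin 5 → ZMod 2} (h : IsCode n A) :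
    bitCount n = weight A := by
  have h1 : ∀ p q : Fin 5, (A p q).val = (n.testBit (5 * p + q)).toNat := by
    intro p q
    rw [h p q]
    rcases ZMod.eq_zero_or_one (A p q) with h | h <;> simp [h, ZMod.val_one]
  simp only [weight, h1, bitCount, rowCount_eq_sum, Nat.testBit_shiftRight]
  simp [Fin.sum_univ_five (f := fun p : Fin 5 => ∑ q : Fin 5, (n.testBit (5 * p + q)).toNat)]

/-- The masks of the bits that distinguish switching classes of tournaments on five vertices. -/
def pairMasks : List ℕ :=
  [2 ^ 8 + 2 ^ 16, 2 ^ 9 + 2 ^ 21, 2 ^ 13 + 2 ^ 17, 2 ^ 14 + 2 ^ 22, 2 ^ 19 + 2 ^ 23]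

/-- The masks of the off-diagonal parts of the rows, and of all columns but the first. -/
def lineMasks : List ℕ :=
  [2 ^ 1 + 2 ^ 2 + 2 ^ 3 + 2 ^ 4, 2 ^ 5 + 2 ^ 7 + 2 ^ 8 + 2 ^ 9, 2 ^ 10 + 2 ^ 11 + 2 ^ 13 + 2 ^ 14,
    2 ^ 15 + 2 ^ 16 + 2 ^ 17 + 2 ^ 19, 2 ^ 20 + 2 ^ 21 + 2 ^ 22 + 2 ^ 23,
    2 ^ 1 + 2 ^ 11 + 2 ^ 16 + 2 ^ 21, 2 ^ 2 + 2 ^ 7 + 2 ^ 17 + 2 ^ 22,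
    2 ^ 3 + 2 ^ 8 + 2 ^ 13 + 2 ^ 23, 2 ^ 4 + 2 ^ 9 + 2 ^ 14 + 2 ^ 19]

/-- The code of the transitive tournament. -/
def transitiveCode : ℕ :=
  2 ^ 5 + 2 ^ 10 + 2 ^ 15 + 2 ^ 20 + 2 ^ 11 + 2 ^ 16 + 2 ^ 21 + 2 ^ 17 + 2 ^ 22 + 2 ^ 23

/-- The arrays of weight at most four in the class of a tournament modulo rows and columns. -/
def lightCodes (t : ℕ) : List ℕ :=
  ((maskSpan lineMasks).map (t ^^^ ·)).filter fun n => Nat.ble (bitCount n) 4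

/-- The positions linked to `a`: the union of the arrays in the list which contain the transpose
of `a`. -/
def links (L : List ℕ) (a : ℕ) : ℕ :=
  L.foldr (fun n s => bif n.testBit (5 * (a % 5) + a / 5) then n ||| s else s) 0

/-- The positions, other than `x` and `y`, in some array of the list containing `x` and `y`. -/
def extensions (L : List ℕ) (x y : ℕ) : ℕ :=
  L.foldr (fun n s => bif n.testBit x && n.testBit y then (n ^^^ 2 ^ x ^^^ 2 ^ y) ||| s else s) 0

/-- The set `m` does not contain two linked positions. -/
def noLinkedTwo (L : List ℕ) (m : ℕ) : Bool :=
  Nat.beq m 0 || (List.range 25).all fun b => !m.testBit b || Nat.beq (m &&& links L b) 0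

/-- The set `m` does not contain three pairwise linked positions. -/
def noLinkedThree (L : List ℕ) (m : ℕ) : Bool :=
  (List.range 25).all fun a => !m.testBit a || noLinkedTwo L (m &&& links L a)

/-- There are no four pairwise linked positions, nor three which extend the same pair. -/
def goodList (L : List ℕ) : Bool :=
  (List.range 25).all (fun a => noLinkedThree L (links L a)) &&
  L.all fun n => (List.range 25).all fun x => !n.testBit x || (List.range x).all fun y =>
    !n.testBit y || noLinkedThree L (extensions L x y)

lemma goodList_lightCodes :
    ((maskSpan pairMasks).all fun t => goodList (lightCodes (transitiveCode ^^^ t))) = true := by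
  decide +kernel

/-- A binary digit, as an element of `ZMod 2`. -/
def digit (n i : ℕ) : ZMod 2 := if n.testBit i then 1 else 0

lemma digit_xor (m n i : ℕ) : digit (m ^^^ n) i = digit m i + digit n i := by
  unfold digit
  rw [Nat.testBit_xor]
  cases m.testBit i <;> cases n.testBit i <;> decide

lemma digit_maskSMul (a : ZMod 2) (m i : ℕ) : digit (maskSMul a m) i = a * digit m i := by
  rcases ZMod.eq_zero_or_one a with rfl | rfl <;> simp [maskSMul, digit]

lemma digit_maskSum_nil (i : ℕ) : digit (maskSum []) i = 0 := by simp [maskSum, digit]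

lemma digit_maskSum_cons (x : ZMod 2 × ℕ) (l : List (ZMod 2 × ℕ)) (i : ℕ) :
    digit (maskSum (x :: l)) i = x.1 * digit x.2 i + digit (maskSum l) i := by
  rw [maskSum, digit_xor, digit_maskSMul]

lemma isCode_of_digit {n : ℕ} {A : Fin 5 → Fin 5 → ZMod 2}
    (h : ∀ p q : Fin 5, digit n (5 * p + q) = A p q) : IsCode n A := by
  intro p q
  rw [← h p q]
  by_cases h1 : n.testBit (5 * p + q) <;> simp [digit, h1]

lemma digit_pair_1_3 (p q : Fin 5) : digit (2 ^ 8 + 2 ^ 16) (5 * p + q) =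
    if p = 1 ∧ q = 3 ∨ p = 3 ∧ q = 1 then 1 else 0 := by
  revert p q; decide +kernel

lemma digit_pair_1_4 (p q : Fin 5) : digit (2 ^ 9 + 2 ^ 21) (5 * p + q) =
    if p = 1 ∧ q = 4 ∨ p = 4 ∧ q = 1 then 1 else 0 := by
  revert p q; decide +kernel

lemma digit_pair_2_3 (p q : Fin 5) : digit (2 ^ 13 + 2 ^ 17) (5 * p + q) =
    if p = 2 ∧ q = 3 ∨ p = 3 ∧ q = 2 then 1 else 0 := by
  revert p q; decide +kernel

lemma digit_pair_2_4 (p q : Fin 5) : digit (2 ^ 14 + 2 ^ 22) (5 * p + q) =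
    if p = 2 ∧ q = 4 ∨ p = 4 ∧ q = 2 then 1 else 0 := by
  revert p q; decide +kernel

lemma digit_pair_3_4 (p q : Fin 5) : digit (2 ^ 19 + 2 ^ 23) (5 * p + q) =
    if p = 3 ∧ q = 4 ∨ p = 4 ∧ q = 3 then 1 else 0 := by
  revert p q; decide +kernel

lemma digit_row_0 (p q : Fin 5) : digit (2 ^ 1 + 2 ^ 2 + 2 ^ 3 + 2 ^ 4) (5 * p + q) =
    if p = 0 ∧ q ≠ 0 then 1 else 0 := by
  revert p q; decide +kernel

lemma digit_row_1 (p q : Fin 5) : digit (2 ^ 5 + 2 ^ 7 + 2 ^ 8 + 2 ^ 9) (5 * p + q) =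
    if p = 1 ∧ q ≠ 1 then 1 else 0 := by
  revert p q; decide +kernel

lemma digit_row_2 (p q : Fin 5) : digit (2 ^ 10 + 2 ^ 11 + 2 ^ 13 + 2 ^ 14) (5 * p + q) =
    if p = 2 ∧ q ≠ 2 then 1 else 0 := by
  revert p q; decide +kernel

lemma digit_row_3 (p q : Fin 5) : digit (2 ^ 15 + 2 ^ 16 + 2 ^ 17 + 2 ^ 19) (5 * p + q) =
    if p = 3 ∧ q ≠ 3 then 1 else 0 := by
  revert p q; decide +kernel

lemma digit_row_4 (p q : Fin 5) : digit (2 ^ 20 + 2 ^ 21 + 2 ^ 22 + 2 ^ 23) (5 * p + q) =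
    if p = 4 ∧ q ≠ 4 then 1 else 0 := by
  revert p q; decide +kernel

lemma digit_col_1 (p q : Fin 5) : digit (2 ^ 1 + 2 ^ 11 + 2 ^ 16 + 2 ^ 21) (5 * p + q) =
    if q = 1 ∧ p ≠ 1 then 1 else 0 := by
  revert p q; decide +kernel

lemma digit_col_2 (p q : Fin 5) : digit (2 ^ 2 + 2 ^ 7 + 2 ^ 17 + 2 ^ 22) (5 * p + q) =
    if q = 2 ∧ p ≠ 2 then 1 else 0 := by
  revert p q; decide +kernel

lemma digit_col_3 (p q : Fin 5) : digit (2 ^ 3 + 2 ^ 8 + 2 ^ 13 + 2 ^ 23) (5 * p + q) =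
    if q = 3 ∧ p ≠ 3 then 1 else 0 := by
  revert p q; decide +kernel

lemma digit_col_4 (p q : Fin 5) : digit (2 ^ 4 + 2 ^ 9 + 2 ^ 14 + 2 ^ 19) (5 * p + q) =
    if q = 4 ∧ p ≠ 4 then 1 else 0 := by
  revert p q; decide +kernel

lemma digit_transitiveCode (p q : Fin 5) : digit (transitiveCode) (5 * p + q) =
    if q < p then 1 else 0 := by
  revert p q; decide +kernel

set_option maxHeartbeats 4000000 in
lemma exists_goodList {R : Fin 5 → Fin 5 → ZMod 2} (hR : ∀ p q, p ≠ q → R p q + R q p = 1) :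
    ∃ L, goodList L = true ∧ ∀ (D : Fin 5 → Fin 5 → ZMod 2) (r c : Fin 5 → ZMod 2),
      (∀ p, D p p = 0) → (∀ p q, p ≠ q → D p q = R p q + r p + c q) → weight D ≤ 4 →
      ∃ n ∈ L, IsCode n D := by
  let R' : Fin 5 → Fin 5 → ZMod 2 := fun p q => R p q + R 0 p + R 0 q
  let e := R' 1 2
  let l : List (ZMod 2 × ℕ) := [(R' 1 3 + e, 2 ^ 8 + 2 ^ 16), (R' 1 4 + e, 2 ^ 9 + 2 ^ 21),
    (R' 2 3 + e, 2 ^ 13 + 2 ^ 17), (R' 2 4 + e, 2 ^ 14 + 2 ^ 22), (R' 3 4 + e, 2 ^ 19 + 2 ^ 23)]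
  refine ⟨lightCodes (transitiveCode ^^^ maskSum l),
    List.all_eq_true.1 goodList_lightCodes _ (maskSum_mem_maskSpan l), fun D r c hD0 hD hw => ?_⟩
  let k : List (ZMod 2 × ℕ) := [(r 0 + c 0 + e, 2 ^ 1 + 2 ^ 2 + 2 ^ 3 + 2 ^ 4),
    (r 1 + R 0 1 + c 0, 2 ^ 5 + 2 ^ 7 + 2 ^ 8 + 2 ^ 9),
    (r 2 + R 0 2 + c 0, 2 ^ 10 + 2 ^ 11 + 2 ^ 13 + 2 ^ 14),
    (r 3 + R 0 3 + c 0, 2 ^ 15 + 2 ^ 16 + 2 ^ 17 + 2 ^ 19),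
    (r 4 + R 0 4 + c 0, 2 ^ 20 + 2 ^ 21 + 2 ^ 22 + 2 ^ 23),
    (c 1 + R 0 1 + c 0 + e, 2 ^ 1 + 2 ^ 11 + 2 ^ 16 + 2 ^ 21),
    (c 2 + R 0 2 + c 0 + e, 2 ^ 2 + 2 ^ 7 + 2 ^ 17 + 2 ^ 22),
    (c 3 + R 0 3 + c 0 + e, 2 ^ 3 + 2 ^ 8 + 2 ^ 13 + 2 ^ 23),
    (c 4 + R 0 4 + c 0 + e, 2 ^ 4 + 2 ^ 9 + 2 ^ 14 + 2 ^ 19)]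
  have hcode : IsCode (transitiveCode ^^^ maskSum l ^^^ maskSum k) D := by
    have hlt : ∀ p q : Fin 5, p < q → D q p = R p q + 1 + r q + c p := by
      intro p q hpq
      rw [hD q p hpq.ne', ← hR p q hpq.ne]
      have := CharTwo.add_self_eq_zero (R p q)
      grind
    refine isCode_of_digit fun p q => ?_
    simp only [l, k, digit_xor, digit_maskSum_cons, digit_maskSum_nil, digit_pair_1_3, digit_pair_1_4,
      digit_pair_2_3, digit_pair_2_4,
      digit_pair_3_4, digit_row_0, digit_row_1, digit_row_2,
      digit_row_3, digit_row_4, digit_col_1, digit_col_2,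
      digit_col_3, digit_col_4, digit_transitiveCode]
    rcases lt_trichotomy p q with h | h | h
    · rw [hD p q h.ne]
      fin_cases p <;> fin_cases q <;> first | exact absurd h (by decide) | skip
      all_goals
        simp [R', e]
        try grind
    · subst h
      rw [hD0]
      fin_cases p <;> simp
    · rw [hlt q p h]
      fin_cases q <;> fin_cases p <;> first | exact absurd h (by decide) | skip
      all_goals
        simp [R', e]
        try grind
  refine ⟨_, ?_, hcode⟩
  rw [lightCodes, List.mem_filter]
  exact ⟨List.mem_map_of_mem (maskSum_mem_maskSpan k), by
    rw [hcode.bitCount_eq, Nat.ble_eq]; exact hw⟩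

lemma foldr_testBit {L : List ℕ} (f : ℕ → Bool) (g : ℕ → ℕ) {n i : ℕ} (hn : n ∈ L) (hf : f n = true)
    (hg : (g n).testBit i = true) :
    (L.foldr (fun n s => bif f n then g n ||| s else s) 0).testBit i = true := by
  induction L with
  | nil => simp at hn
  | cons m L ih =>
    rw [List.foldr_cons]
    rcases List.mem_cons.1 hn with rfl | h
    · simp [hf, hg]
    · cases hm : f m <;> simp [ih h]

lemma links_testBit {L : List ℕ} {n b : ℕ} {p q : Fin 5} (hn : n ∈ L)
    (ha : n.testBit (5 * q + p) = true) (hb : n.testBit b = true) :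
    (links L (5 * p + q)).testBit b = true := by
  refine foldr_testBit _ _ hn ?_ hb
  rw [show (5 * (p : ℕ) + q) % 5 = q by omega, show (5 * (p : ℕ) + q) / 5 = p by omega, ha]

lemma extensions_testBit {L : List ℕ} {n x y a : ℕ} (hn : n ∈ L) (hx : n.testBit x = true)
    (hy : n.testBit y = true) (ha : n.testBit a = true) (hax : x ≠ a) (hay : y ≠ a) :
    (extensions L x y).testBit a = true := by
  refine foldr_testBit _ _ hn (by rw [hx, hy]; rfl) ?_
  rw [Nat.testBit_xor, Nat.testBit_xor, Nat.testBit_two_pow, Nat.testBit_two_pow, ha]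
  simp [hax, hay]

lemma noLinkedThree_false {L : List ℕ} {m a b c : ℕ} (h : noLinkedThree L m = true) (ha : a < 25)
    (hb : b < 25) (ma : m.testBit a = true) (mb : m.testBit b = true) (mc : m.testBit c = true)
    (hab : (links L a).testBit b = true) (hac : (links L a).testBit c = true)
    (hbc : (links L b).testBit c = true) : False := by
  have h1 := List.all_eq_true.1 h a (List.mem_range.2 ha)
  simp only [ma, Bool.not_true, Bool.false_or, noLinkedTwo, Bool.or_eq_true] at h1
  have h0 : ∀ n k : ℕ, n.testBit k = true → Nat.beq n 0 ≠ true := by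
    rintro n k h1 h2
    rw [Nat.beq_eq] at h2
    simp [h2] at h1
  rcases h1 with h1 | h1
  · exact h0 _ b (by simp [mb, hab]) h1
  · have h2 := List.all_eq_true.1 h1 b (List.mem_range.2 hb)
    simp only [Nat.testBit_and, mb, hab, Bool.and_self, Bool.not_true, Bool.false_or] at h2
    exact h0 _ c (by simp [mc, hac, hbc]) h2

lemma goodList_four {L : List ℕ} (h : goodList L = true) {a b c d : ℕ} (ha : a < 25) (hb : b < 25)
    (hc : c < 25) (hab : (links L a).testBit b = true) (hac : (links L a).testBit c = true)
    (had : (links L a).testBit d = true) (hbc : (links L b).testBit c = true)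
    (hbd : (links L b).testBit d = true) (hcd : (links L c).testBit d = true) : False := by
  rw [goodList, Bool.and_eq_true] at h
  exact noLinkedThree_false (List.all_eq_true.1 h.1 a (List.mem_range.2 ha)) hb hc hab hac had hbc
    hbd hcd

lemma goodList_three {L : List ℕ} (h : goodList L = true) {n x y a b c : ℕ} (hn : n ∈ L)
    (hx : x < 25) (hxy : y < x) (nx : n.testBit x = true) (ny : n.testBit y = true)
    (ha : a < 25) (hb : b < 25) (ma : (extensions L x y).testBit a = true)
    (mb : (extensions L x y).testBit b = true) (mc : (extensions L x y).testBit c = true)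
    (hab : (links L a).testBit b = true) (hac : (links L a).testBit c = true)
    (hbc : (links L b).testBit c = true) : False := by
  rw [goodList, Bool.and_eq_true] at h
  have h1 := List.all_eq_true.1 h.2 n hn
  have h2 := List.all_eq_true.1 h1 x (List.mem_range.2 hx)
  simp only [nx, Bool.not_true, Bool.false_or] at h2
  have h3 := List.all_eq_true.1 h2 y (List.mem_range.2 hxy)
  simp only [ny, Bool.not_true, Bool.false_or] at h3
  exact noLinkedThree_false h3 ha hb ma mb mc hab hac hbc

/-- The array with a single nonzero entry. -/
def unitArray (a b p q : Fin 5) : ZMod 2 := if p = a ∧ q = b then 1 else 0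

lemma four_le_weight {R D : Fin 5 → Fin 5 → ZMod 2} {r c : Fin 5 → ZMod 2}
    (hR : ∀ p q, p ≠ q → R p q + R q p = 1) (hD0 : ∀ p, D p p = 0)
    (hD : ∀ p q, p ≠ q → D p q = R p q + r p + c q) : 4 ≤ weight D := by
  refine (four_le_sameCount (fun p => r p + c p)).trans
    (sameCount_le (fun p q => (D p q).val) _ (fun p => by simp [hD0]) fun p q hpq => ?_)
  have := hR p q hpq
  simp only [Nat.cast_add, ZMod.natCast_val, ZMod.cast_id', id_eq, hD p q hpq, hD q p hpq.symm]
  grind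

lemma weight_unitArray (a b : Fin 5) : weight (unitArray a b) = 1 := by
  revert a b; decide +kernel

lemma val_add_unitArray {X : Fin 5 → Fin 5 → ZMod 2} (hX : weight X = 2) (a b a' b' : Fin 5)
    (h : 4 ≤ weight (fun p q => X p q + unitArray a b p q + unitArray a' b' p q)) (p q : Fin 5) :
    (X p q + unitArray a b p q + unitArray a' b' p q).val =
      (X p q).val + (unitArray a b p q).val + (unitArray a' b' p q).val := by
  have hle : ∀ p q, (X p q + unitArray a b p q + unitArray a' b' p q).val ≤
      (X p q).val + (unitArray a b p q).val + (unitArray a' b' p q).val := fun p q =>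
    (ZMod.val_add_le_two _ _).trans (Nat.add_le_add_right (ZMod.val_add_le_two _ _) _)
  have hsum : ∑ p, ∑ q, ((X p q).val + (unitArray a b p q).val + (unitArray a' b' p q).val) = 4 := by
    have h1 := weight_unitArray a b
    have h2 := weight_unitArray a' b'
    simp only [weight, Finset.sum_add_distrib] at hX h1 h2 ⊢
    omega
  have h1 := (Finset.sum_eq_sum_iff_of_le fun p _ => Finset.sum_le_sum fun q _ => hle p q).1
    (le_antisymm (Finset.sum_le_sum fun p _ => Finset.sum_le_sum fun q _ => hle p q)
      (hsum.le.trans h)) p (Finset.mem_univ p)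
  exact (Finset.sum_eq_sum_iff_of_le fun q _ => hle p q).1 h1 q (Finset.mem_univ q)

namespace ParityModel

variable {ι : Type*} {P : ParityModel ι}

/-- The tournament determined by the rotation at `k`. -/
def R (P : ParityModel ι) (k : ι) (p q : Fin 5) : ZMod 2 := P.Y k p q + P.Y k q p + P.τ q p

lemma R_swap (k : ι) (p q : Fin 5) (h : p ≠ q) : P.R k p q + P.R k q p = 1 := by
  have := P.τ_swap p q h
  unfold R
  grind

lemma exists_unitArray {k i : ι} (h : P.C k i = 1) :
    ∃ a b, a ≠ b ∧ ∀ p q, P.X k i p q = unitArray a b p q := by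
  rw [C_of_ne (ne_of_C_ne_zero (P := P) (i := k) (j := i) (by omega))] at h
  obtain ⟨a, b, hab⟩ := exists_unit_of_weight_eq_one h
  refine ⟨a, b, ?_, hab⟩
  rintro rfl
  have := hab a a
  simp [X_self] at this

lemma unitArray_self {a b : Fin 5} (h : a ≠ b) (p : Fin 5) : unitArray a b p p = 0 := by
  rw [unitArray, if_neg]
  rintro ⟨rfl, rfl⟩
  exact h rfl

lemma unitArray_swap (a b p q : Fin 5) : unitArray a b p q = unitArray b a q p := by
  simp only [unitArray, and_comm]

lemma exists_add_unitArray_eq {i j k : ι} {a b a' b' : Fin 5}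
    (hi : ∀ p q, P.X k i p q = unitArray a b p q) (hj : ∀ p q, P.X k j p q = unitArray a' b' p q) :
    ∃ r c : Fin 5 → ZMod 2, ∀ p q, p ≠ q →
      P.X i j p q + unitArray b a p q + unitArray a' b' p q = P.R k p q + r p + c q := by
  refine ⟨fun p => P.s i k p + P.s k j p + P.s i j p + P.ω k i + P.ω k j + P.ω i j,
    fun q => P.s k i q + P.s j k q + P.s j i q, fun p q hpq => ?_⟩
  have h1 := hi q p
  have h2 := hj p q
  rw [unitArray_swap] at h1
  rw [X_of_ne hpq.symm] at h1
  rw [X_of_ne hpq] at h2 ⊢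
  rw [← h1, ← h2, R]
  grind

lemma exists_add_unitArray_eq' {i k l : ι} {a b a' b' : Fin 5}
    (hk : ∀ p q, P.X k i p q = unitArray a b p q) (hl : ∀ p q, P.X l i p q = unitArray a' b' p q) :
    ∃ r c : Fin 5 → ZMod 2, ∀ p q, p ≠ q →
      P.X l k p q + unitArray a b p q + unitArray a' b' p q = P.R k p q + r p + c q := by
  refine ⟨fun p => P.s l i p + P.s k i p + P.s l k p + P.ω l i + P.ω k i + P.ω l k + 1,
    fun q => P.s i l q + P.s i k q + P.s k l q, fun p q hpq => ?_⟩
  have h1 := hk p q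
  have h2 := hl p q
  have h3 := P.τ_swap p q hpq
  rw [X_of_ne hpq] at h1 h2 ⊢
  rw [← h1, ← h2, R]
  grind

/-- The list `L` contains codes for all light arrays in the class determined by `k`. -/
def Covers (P : ParityModel ι) (L : List ℕ) (k : ι) : Prop :=
  ∀ (D : Fin 5 → Fin 5 → ZMod 2) (r c : Fin 5 → ZMod 2), (∀ p, D p p = 0) →
    (∀ p q, p ≠ q → D p q = P.R k p q + r p + c q) → weight D ≤ 4 → ∃ n ∈ L, IsCode n D

lemma exists_code_of_class {L : List ℕ} {k : ι} (hL : P.Covers L k) {X : Fin 5 → Fin 5 → ZMod 2}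
    (hX0 : ∀ p, X p p = 0) (hX : weight X = 2) {a b a' b' : Fin 5} (hab : a ≠ b) (hab' : a' ≠ b')
    {r c : Fin 5 → ZMod 2} (h : ∀ p q, p ≠ q →
      X p q + unitArray a b p q + unitArray a' b' p q = P.R k p q + r p + c q) :
    ∃ n ∈ L, n.testBit (5 * a + b) = true ∧ n.testBit (5 * a' + b') = true ∧ X a b ≠ 1 ∧
      ∀ p q : Fin 5, X p q = 1 → n.testBit (5 * p + q) = true := by
  have h0 : ∀ p, X p p + unitArray a b p p + unitArray a' b' p p = 0 := fun p => by
    rw [hX0, unitArray_self hab, unitArray_self hab', add_zero, add_zero]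
  have h4 : 4 ≤ weight (fun p q => X p q + unitArray a b p q + unitArray a' b' p q) :=
    four_le_weight (R_swap k) h0 h
  have hval := val_add_unitArray hX a b a' b' h4
  have hw : weight (fun p q => X p q + unitArray a b p q + unitArray a' b' p q) ≤ 4 := by
    have h1 := weight_add_le (fun p q => X p q + unitArray a b p q) (unitArray a' b')
    have h2 := weight_add_le X (unitArray a b)
    rw [weight_unitArray] at h1 h2
    omega
  obtain ⟨n, hn, hc⟩ := hL _ r c h0 h hw
  have key : ∀ p q : Fin 5, 1 ≤ (X p q).val + (unitArray a b p q).val + (unitArray a' b' p q).val →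
      n.testBit (5 * p + q) = true := by
    intro p q h1
    rw [← hval] at h1
    rw [hc, decide_eq_true_iff]
    rcases ZMod.eq_zero_or_one (X p q + unitArray a b p q + unitArray a' b' p q) with h2 | h2
    · simp [h2] at h1
    · exact h2
  have hu : ∀ a b : Fin 5, (unitArray a b a b).val = 1 := fun a b => by
    simp [unitArray, ZMod.val_one]
  refine ⟨n, hn, key a b (by have := hu a b; omega), key a' b' (by have := hu a' b'; omega), ?_,
    fun p q h1 => key p q (by rw [h1, ZMod.val_one]; omega)⟩
  intro h1
  have h2 := hval a b
  have h3 := hu a b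
  have h5 := ZMod.val_lt (X a b + unitArray a b a b + unitArray a' b' a b)
  rw [h1, ZMod.val_one] at h2
  rw [h1] at h5
  omega

lemma testBit_links {L : List ℕ} {k i j : ι} (hL : P.Covers L k) (hij : P.C i j = 2)
    {a b a' b' : Fin 5} (hab : a ≠ b) (hab' : a' ≠ b') (hi : ∀ p q, P.X k i p q = unitArray a b p q)
    (hj : ∀ p q, P.X k j p q = unitArray a' b' p q) :
    (links L (5 * a + b)).testBit (5 * a' + b') = true := by
  obtain ⟨r, c, h⟩ := exists_add_unitArray_eq hi hj
  rw [C_of_ne (ne_of_C_ne_zero (P := P) (i := i) (j := j) (by omega))] at hij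
  obtain ⟨n, hn, h1, h2, -⟩ := exists_code_of_class hL (X_self i j) hij hab.symm hab' h
  exact links_testBit hn h1 h2

lemma exists_covers (P : ParityModel ι) (k : ι) : ∃ L, goodList L = true ∧ P.Covers L k :=
  exists_goodList (R_swap k)

lemma no_fan_four {k i j l m : ι} (hki : P.C k i = 1) (hkj : P.C k j = 1) (hkl : P.C k l = 1)
    (hkm : P.C k m = 1) (hij : P.C i j = 2) (hil : P.C i l = 2) (him : P.C i m = 2)
    (hjl : P.C j l = 2) (hjm : P.C j m = 2) (hlm : P.C l m = 2) : False := by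
  obtain ⟨L, hg, hL⟩ := P.exists_covers k
  obtain ⟨a, a', ha, hi⟩ := exists_unitArray hki
  obtain ⟨b, b', hb, hj⟩ := exists_unitArray hkj
  obtain ⟨c, c', hc, hl⟩ := exists_unitArray hkl
  obtain ⟨d, d', hd, hm⟩ := exists_unitArray hkm
  exact goodList_four hg (a := 5 * a + a') (b := 5 * b + b') (c := 5 * c + c') (d := 5 * d + d')
    (by omega) (by omega) (by omega)
    (testBit_links hL hij ha hb hi hj) (testBit_links hL hil ha hc hi hl)
    (testBit_links hL him ha hd hi hm) (testBit_links hL hjl hb hc hj hl)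
    (testBit_links hL hjm hb hd hj hm) (testBit_links hL hlm hc hd hl hm)

lemma exists_two_of_weight_eq_two {X : Fin 5 → Fin 5 → ZMod 2} (h : weight X = 2) :
    ∃ p q p' q' : Fin 5, X p q = 1 ∧ X p' q' = 1 ∧ 5 * (p' : ℕ) + q' < 5 * (p : ℕ) + q := by
  have h1 : weight X = (Finset.univ.filter fun x : Fin 5 × Fin 5 => X x.1 x.2 = 1).card := by
    rw [weight, Finset.card_filter, ← Finset.univ_product_univ, Finset.sum_product]
    refine Finset.sum_congr rfl fun p _ => Finset.sum_congr rfl fun q _ => ?_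
    rcases ZMod.eq_zero_or_one (X p q) with h | h <;> simp [h, ZMod.val_one]
  obtain ⟨x, hx, y, hy, hxy⟩ := Finset.one_lt_card.1 (by omega : 1 <
    (Finset.univ.filter fun x : Fin 5 × Fin 5 => X x.1 x.2 = 1).card)
  simp only [Finset.mem_filter, Finset.mem_univ, true_and] at hx hy
  rcases lt_trichotomy (5 * (x.1 : ℕ) + x.2) (5 * (y.1 : ℕ) + y.2) with h | h | h
  · exact ⟨_, _, _, _, hy, hx, h⟩
  · exact absurd (Prod.ext (Fin.ext (by omega)) (Fin.ext (by omega))) hxy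
  · exact ⟨_, _, _, _, hx, hy, h⟩

lemma no_bipartite {k l i j m : ι} (hkl : P.C k l = 2) (hij : P.C i j = 2) (him : P.C i m = 2)
    (hjm : P.C j m = 2) (hki : P.C k i = 1) (hkj : P.C k j = 1) (hkm : P.C k m = 1)
    (hli : P.C l i = 1) (hlj : P.C l j = 1) (hlm : P.C l m = 1) : False := by
  obtain ⟨L, hg, hL⟩ := P.exists_covers k
  obtain ⟨a, a', ha, hi⟩ := exists_unitArray hki
  obtain ⟨b, b', hb, hj⟩ := exists_unitArray hkj
  obtain ⟨c, c', hc, hm⟩ := exists_unitArray hkm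
  have nlk : l ≠ k := (ne_of_C_ne_zero (P := P) (i := k) (j := l) (by omega)).symm
  rw [C_comm, C_of_ne nlk] at hkl
  obtain ⟨p, q, p', q', hp, hp', hlt⟩ := exists_two_of_weight_eq_two hkl
  have key : ∀ {i : ι} {a a' : Fin 5}, a ≠ a' → (∀ p q, P.X k i p q = unitArray a a' p q) →
      P.C l i = 1 → (∃ n ∈ L, n.testBit (5 * p + q) = true ∧ n.testBit (5 * p' + q') = true) ∧
        (extensions L (5 * p + q) (5 * p' + q')).testBit (5 * a + a') = true := by
    intro i a a' ha hi hli
    obtain ⟨d, d', hd, hl⟩ := exists_unitArray hli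
    obtain ⟨r, s, h⟩ := exists_add_unitArray_eq' hi hl
    obtain ⟨n, hn, h1, -, h2, h3⟩ := exists_code_of_class hL (X_self l k) hkl ha hd h
    refine ⟨⟨n, hn, h3 p q hp, h3 p' q' hp'⟩,
      extensions_testBit hn (h3 p q hp) (h3 p' q' hp') h1 ?_ ?_⟩
    · intro h4
      rw [show a = p from Fin.ext (by omega), show a' = q from Fin.ext (by omega)] at h2
      exact h2 hp
    · intro h4
      rw [show a = p' from Fin.ext (by omega), show a' = q' from Fin.ext (by omega)] at h2
      exact h2 hp'
  obtain ⟨⟨n, hn, h1, h2⟩, h3⟩ := key ha hi hli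
  exact goodList_three hg hn (by omega) hlt h1 h2 (by omega) (by omega) h3 (key hb hj hlj).2
    (key hc hm hlm).2 (testBit_links hL hij ha hb hi hj) (testBit_links hL him ha hc hi hm)
    (testBit_links hL hjm hb hc hj hm)

lemma isStarSystem (P : ParityModel ι) : IsStarSystem P.C P.Γ where
  symm := C_comm
  self := C_self
  even_triangle := even_triangle
  four_le_triangle _ _ _ hij hjk hik := (triangle_aux hij hjk hik).1
  two_le_center _ _ h := two_le_center h
  no_fan_four _ _ _ _ _ := no_fan_four
  no_bipartite _ _ _ _ _ := no_bipartite
  no_path_zero _ _ _ := no_path_zero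
  no_path_one _ _ _ := no_path_one
  no_triangle _ _ _ ha hb hc := no_triangle ha hb hc

end ParityModel

/-- A nowhere vanishing function on a simply connected space has a continuous logarithm, which is
unique once its value at one point is fixed. -/
lemma existsUnique_continuous_log {A : Type*} [TopologicalSpace A] [SimplyConnectedSpace A]
    [LocallyPathConnectedSpace A] {f : A → ℂ} (hf : Continuous f) (h0 : ∀ a, f a ≠ 0) {a₀ : A}
    {z₀ : ℂ} (hz : Complex.exp z₀ = f a₀) :
    ∃! θ : C(A, ℂ), θ a₀ = z₀ ∧ Complex.exp ∘ θ = f :=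
  Complex.isCoveringMapOn_exp.existsUnique_continuousMap_lifts ⟨f, hf⟩ hz h0

lemma exists_continuous_log {A : Type*} [TopologicalSpace A] [SimplyConnectedSpace A]
    [LocallyPathConnectedSpace A] {f : A → ℂ} (hf : Continuous f) (h0 : ∀ a, f a ≠ 0) :
    ∃ θ : A → ℂ, Continuous θ ∧ ∀ a, Complex.exp (θ a) = f a := by
  obtain ⟨a₀⟩ : Nonempty A := inferInstance
  obtain ⟨θ, ⟨-, h⟩, -⟩ := existsUnique_continuous_log hf h0 (Complex.exp_log (h0 a₀))
  exact ⟨θ, θ.continuous, fun a => congrFun h a⟩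

open Complex in
lemma exists_wind {γ : ℝ → ℂ} (hγ : Continuous γ) {v : ℂ} (hv : ∀ t, γ t ≠ v) :
    ∃ m : ℤ, ∀ θ : ℝ → ℂ, Continuous θ → (∀ t, exp (θ t) = γ t - v) →
      θ 1 - θ 0 = log (γ 1 - v) - log (γ 0 - v) + m * (2 * Real.pi * I) := by
  have h0 : ∀ t, γ t - v ≠ 0 := fun t => sub_ne_zero.2 (hv t)
  have hc : Continuous fun t => γ t - v := hγ.sub continuous_const
  obtain ⟨θ, hθ, hθe⟩ := exists_continuous_log hc h0
  obtain ⟨m, hm⟩ : ∃ m : ℤ, θ 1 - θ 0 =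
      log (γ 1 - v) - log (γ 0 - v) + m * (2 * Real.pi * I) := by
    rw [← exp_eq_exp_iff_exists_int, exp_sub, exp_sub, hθe, hθe, exp_log (h0 _), exp_log (h0 _)]
  refine ⟨m, fun η hη hηe => ?_⟩
  rw [← hm]
  have key := (existsUnique_continuous_log hc h0 (hηe 0)).unique
    (y₁ := ⟨η, hη⟩) (y₂ := ⟨fun t => θ t + (η 0 - θ 0), by fun_prop⟩)
    ⟨rfl, funext hηe⟩ ⟨by simp, funext fun t => by
      simp [exp_add, exp_sub, hθe, hηe, div_self (h0 0)]⟩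
  have h1 := DFunLike.congr_fun key 1
  simp only [ContinuousMap.coe_mk] at h1
  rw [h1]; ring

open Classical Complex in
/-- The number of full turns around `v` made by the curve `γ` on `[0, 1]`, up to the principal
arguments of the endpoints. -/
noncomputable def wind (γ : ℝ → ℂ) (v : ℂ) : ℤ :=
  if h : Continuous γ ∧ ∀ t, γ t ≠ v then (exists_wind h.1 h.2).choose else 0

open Complex in
lemma wind_spec {γ : ℝ → ℂ} (hγ : Continuous γ) {v : ℂ} (hv : ∀ t, γ t ≠ v) {θ : ℝ → ℂ}
    (hθ : Continuous θ) (h : ∀ t, exp (θ t) = γ t - v) :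
    θ 1 - θ 0 = log (γ 1 - v) - log (γ 0 - v) + wind γ v * (2 * Real.pi * I) := by
  rw [wind, dif_pos ⟨hγ, hv⟩]
  exact (exists_wind hγ hv).choose_spec θ hθ h

open Complex in
lemma exists_halfTurn {v w : ℂ} (h : v ≠ w) :
    ∃ b : ℤ, log (w - v) - log (v - w) = Real.pi * I + b * (2 * Real.pi * I) := by
  rw [← exp_eq_exp_iff_exists_int, exp_sub, exp_log (sub_ne_zero.2 h.symm),
    exp_log (sub_ne_zero.2 h), exp_pi_mul_I, div_eq_iff (sub_ne_zero.2 h)]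
  ring

open Classical in
/-- The discrepancy between the principal arguments of `w - v` and `v - w`. -/
noncomputable def halfTurn (v w : ℂ) : ℤ :=
  if h : v ≠ w then (exists_halfTurn h).choose else 0

open Complex in
lemma halfTurn_spec {v w : ℂ} (h : v ≠ w) :
    log (w - v) - log (v - w) = Real.pi * I + halfTurn v w * (2 * Real.pi * I) := by
  rw [halfTurn, dif_pos h]
  exact (exists_halfTurn h).choose_spec

lemma halfTurn_add_swap {v w : ℂ} (h : v ≠ w) : halfTurn v w + halfTurn w v = -1 := by
  have h1 := halfTurn_spec h
  have h2 := halfTurn_spec h.symm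
  have h3 : ((halfTurn v w + halfTurn w v + 1 : ℤ) : ℂ) * (2 * Real.pi * Complex.I) = 0 := by
    push_cast
    linear_combination -h1 - h2
  have h4 := (mul_eq_zero.1 h3).resolve_right Complex.two_pi_I_ne_zero
  have : halfTurn v w + halfTurn w v + 1 = 0 := by exact_mod_cast h4
  omega

open Complex in
/-- The relation between winding numbers satisfied by two disjoint curves. -/
lemma wind_relation {e f : ℝ → ℂ} (he : Continuous e) (hf : Continuous f)
    (h : ∀ s t, e s ≠ f t) :
    wind f (e 0) + wind e (f 1) + halfTurn (e 0) (f 1) + halfTurn (e 1) (f 0) =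
      wind f (e 1) + wind e (f 0) + halfTurn (e 0) (f 0) + halfTurn (e 1) (f 1) := by
  obtain ⟨Θ, hΘ, hΘe⟩ := exists_continuous_log (A := ℝ × ℝ) (f := fun x => f x.2 - e x.1)
    (by fun_prop) fun x => sub_ne_zero.2 (h _ _).symm
  have hpi : ∀ z, exp (z + Real.pi * I) = -exp z := fun z => by
    rw [exp_add, exp_pi_mul_I]; ring
  have h1 := wind_spec (v := e 0) hf (fun t => (h 0 t).symm) (θ := fun t => Θ (0, t))
    (by fun_prop) fun t => hΘe _
  have h2 := wind_spec (v := e 1) hf (fun t => (h 1 t).symm) (θ := fun t => Θ (1, t))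
    (by fun_prop) fun t => hΘe _
  have h3 := wind_spec (v := f 0) he (fun s => h s 0) (θ := fun s => Θ (s, 0) + Real.pi * I)
    (by fun_prop) fun s => by rw [hpi, hΘe]; ring
  have h4 := wind_spec (v := f 1) he (fun s => h s 1) (θ := fun s => Θ (s, 1) + Real.pi * I)
    (by fun_prop) fun s => by rw [hpi, hΘe]; ring
  have h5 : ((wind f (e 0) + wind e (f 1) + halfTurn (e 0) (f 1) + halfTurn (e 1) (f 0) -
      (wind f (e 1) + wind e (f 0) + halfTurn (e 0) (f 0) + halfTurn (e 1) (f 1)) : ℤ) : ℂ) *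
      (2 * Real.pi * I) = 0 := by
    push_cast
    linear_combination h2 + h3 - h1 - h4 - halfTurn_spec (h 0 1) - halfTurn_spec (h 1 0) +
      halfTurn_spec (h 0 0) + halfTurn_spec (h 1 1)
  have h6 := (mul_eq_zero.1 h5).resolve_right two_pi_I_ne_zero
  exact sub_eq_zero.1 (by exact_mod_cast h6)

/-- The parity of the winding number of a path in `A` from `x` to `y` around `v`. -/
noncomputable def turnParity {A : Set ℂ} {x y : ℂ} (h : JoinedIn A x y) (v : ℂ) : ZMod 2 :=
  wind h.somePath.extend v

/-- The parity of the half turn between two points. -/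
noncomputable def halfParity (v w : ℂ) : ZMod 2 := halfTurn v w

lemma halfParity_add_swap {v w : ℂ} (h : v ≠ w) : halfParity v w + halfParity w v = 1 := by
  rw [halfParity, halfParity, ← Int.cast_add, halfTurn_add_swap h]; decide

/-- If the two joining paths are disjoint then their winding parities are related. -/
lemma parity_eq_zero_of_disjoint {A B : Set ℂ} {x y z w : ℂ} (hA : JoinedIn A x y)
    (hB : JoinedIn B z w) (h : Disjoint A B) :
    turnParity hB x + turnParity hB y + turnParity hA z + turnParity hA w +
      halfParity x w + halfParity x z + halfParity y w + halfParity y z = 0 := by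
  have mem : ∀ {S : Set ℂ} {u v : ℂ} (hS : JoinedIn S u v) (t : ℝ), hS.somePath.extend t ∈ S :=
    fun hS t => hS.somePath_mem _
  have key := wind_relation (e := hA.somePath.extend) (f := hB.somePath.extend)
    hA.somePath.continuous_extend hB.somePath.continuous_extend
    fun s t => h.ne_of_mem (mem hA s) (mem hB t)
  simp only [Path.extend_zero, Path.extend_one] at key
  have key' := congrArg (Int.cast : ℤ → ZMod 2) key
  push_cast at key'
  simp only [turnParity, halfParity]
  grind

open Classical in
lemma val_le_ite_of_disjoint {A B : Set ℂ} {z : ZMod 2} (h : Disjoint A B → z = 0) :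
    z.val ≤ if ¬ Disjoint A B then 1 else 0 := by
  by_cases hd : Disjoint A B
  · simp [h hd]
  · have := ZMod.val_lt z
    rw [if_pos hd]; omega

/-- The sum over the ordered pairs in a finite set of counts any three of which are not all zero
is at least the Turán bound. -/
lemma two_mul_half_mul_half_le_sum {ι : Type*} [DecidableEq ι] (c : ι → ι → ℕ)
    (hc : ∀ i j, c i j = c j i)
    (h : ∀ i j k, i ≠ j → j ≠ k → i ≠ k → 1 ≤ c i j + c j k + c i k) (S : Finset ι) :
    2 * ((S.card / 2) * ((S.card - 1) / 2)) ≤ ∑ i ∈ S, ∑ j ∈ S, c i j := by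
  induction hs : S.card using Nat.strong_induction_on generalizing S with
  | _ s ih =>
  by_cases hz : ∃ i ∈ S, ∃ j ∈ S, i ≠ j ∧ c i j = 0
  · obtain ⟨i, hi, j, hj, hij, h0⟩ := hz
    have hji : j ∈ S.erase i := Finset.mem_erase.2 ⟨hij.symm, hj⟩
    set T := (S.erase i).erase j with hT
    have hcard : T.card = s - 2 := by
      rw [hT, Finset.card_erase_of_mem hji, Finset.card_erase_of_mem hi, hs]; omega
    have hs2 : 2 ≤ s := by
      rw [← hs, ← Finset.card_pair hij]
      exact Finset.card_le_card (by simp [Finset.insert_subset_iff, hi, hj])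
    have hsplit : ∀ f : ι → ℕ, ∑ k ∈ S, f k = ∑ k ∈ T, f k + f j + f i := fun f => by
      rw [hT, Finset.sum_erase_add _ _ hji, Finset.sum_erase_add _ _ hi]
    have hpair : T.card ≤ ∑ k ∈ T, (c i k + c j k) := by
      rw [Finset.card_eq_sum_ones]
      refine Finset.sum_le_sum fun k hk => ?_
      simp only [hT, Finset.mem_erase] at hk
      have := h i j k hij (Ne.symm hk.1) (Ne.symm hk.2.1)
      omega
    have hrec := ih (s - 2) (by omega) T hcard
    have h1 : ∑ k ∈ S, ∑ l ∈ S, c k l ≥ ∑ k ∈ T, ∑ l ∈ T, c k l + 2 * ∑ k ∈ T, (c i k + c j k) := by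
      simp only [hsplit, Finset.sum_add_distrib]
      have e1 : ∑ k ∈ T, c k i = ∑ k ∈ T, c i k := Finset.sum_congr rfl fun k _ => hc k i
      have e2 : ∑ k ∈ T, c k j = ∑ k ∈ T, c j k := Finset.sum_congr rfl fun k _ => hc k j
      omega
    have h2 : 2 * (s / 2 * ((s - 1) / 2)) =
        2 * ((s - 2) / 2 * ((s - 2 - 1) / 2)) + 2 * (s - 2) := by
      obtain ⟨k, rfl | rfl⟩ : ∃ k, s = 2 * k + 2 ∨ s = 2 * k + 3 := ⟨(s - 2) / 2, by omega⟩
      · rcases k with _ | k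
        · rfl
        · rw [show (2 * (k + 1) + 2) / 2 = k + 2 by omega,
            show (2 * (k + 1) + 2 - 1) / 2 = k + 1 by omega,
            show (2 * (k + 1) + 2 - 2) / 2 = k + 1 by omega,
            show (2 * (k + 1) + 2 - 2 - 1) / 2 = k by omega,
            show 2 * (k + 1) + 2 - 2 = 2 * (k + 1) by omega]
          ring
      · rw [show (2 * k + 3) / 2 = k + 1 by omega,
          show (2 * k + 3 - 1) / 2 = k + 1 by omega,
          show (2 * k + 3 - 2) / 2 = k by omega,
          show (2 * k + 3 - 2 - 1) / 2 = k by omega,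
          show 2 * k + 3 - 2 = 2 * k + 1 by omega]
        ring
    omega
  · push Not at hz
    have h1 : S.card * (S.card - 1) ≤ ∑ i ∈ S, ∑ j ∈ S, c i j := by
      rw [← smul_eq_mul]
      refine Finset.card_nsmul_le_sum _ _ _ fun i hi => ?_
      rw [← Finset.card_erase_of_mem hi, Finset.card_eq_sum_ones]
      refine (Finset.sum_le_sum fun j hj => ?_).trans
        (Finset.sum_le_sum_of_subset (Finset.erase_subset i S))
      rw [Finset.mem_erase] at hj
      exact Nat.one_le_iff_ne_zero.2 (hz i hi j hj.2 hj.1.symm)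
    rw [hs] at h1
    refine le_trans ?_ h1
    calc 2 * (s / 2 * ((s - 1) / 2)) = (2 * (s / 2)) * ((s - 1) / 2) := by ring
      _ ≤ s * (s - 1) := Nat.mul_le_mul (Nat.mul_div_le s 2) (Nat.div_le_self _ _)

lemma sum_sum_sum_sum_comm {ι κ : Type*} [Fintype ι] [Fintype κ] (f : ι → ι → κ → κ → ℕ) :
    ∑ i, ∑ j, ∑ p, ∑ q, f i j p q = ∑ p, ∑ i, ∑ q, ∑ j, f i j p q := by
  rw [Finset.sum_comm (f := fun p i => ∑ q, ∑ j, f i j p q)]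
  refine Finset.sum_congr rfl fun i _ => ?_
  rw [Finset.sum_comm]
  exact Finset.sum_congr rfl fun p _ => Finset.sum_comm

section Bipartite

variable {ι κ : Type*} {a : κ → ℂ} {b : ι → ℂ} {R : κ → ι → Set ℂ}
  (hR : ∀ p i, JoinedIn (R p i) (a p) (b i))

/-- The crossing parity of the paths from `a p` to `b i` and from `a q` to `b j`. -/
noncomputable def crossParity (i j : ι) (p q : κ) : ZMod 2 :=
  turnParity (hR p i) (a q) + turnParity (hR q j) (a p) +
    (turnParity (hR p i) (b j) + halfParity (a p) (b j)) +
    (turnParity (hR q j) (b i) + halfParity (a q) (b i)) +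
    halfParity (a p) (a q) + (halfParity (b i) (b j) + 1)

lemma crossParity_eq_zero (hab : ∀ p i, a p ≠ b i) {i j : ι} {p q : κ}
    (h : Disjoint (R p i) (R q j)) : crossParity hR i j p q = 0 := by
  have h1 := parity_eq_zero_of_disjoint (hR p i) (hR q j) h
  have h2 := halfParity_add_swap (hab q i)
  simp only [crossParity]
  grind

/-- The graph `K_{3,n}` has at least `⌊n/2⌋⌊(n-1)/2⌋` independent crossings. -/
theorem le_card_meeting_three {n : ℕ} {a : Fin 3 → ℂ} {b : Fin n → ℂ}
    (ha : Function.Injective a) (hb : Function.Injective b) (hab : ∀ p i, a p ≠ b i)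
    {R : Fin 3 × Fin n → Set ℂ} (hR : ∀ p i, JoinedIn (R (p, i)) (a p) (b i)) :
    2 * ((n / 2) * ((n - 1) / 2)) ≤ Nat.card {x : (Fin 3 × Fin n) × (Fin 3 × Fin n) //
      (x.1.1 ≠ x.2.1 ∧ x.1.2 ≠ x.2.2) ∧ ¬ Disjoint (R x.1) (R x.2)} := by
  classical
  let X : Fin n → Fin n → Fin 3 → Fin 3 → ZMod 2 := fun i j p q =>
    if p = q ∨ i = j then 0 else crossParity (R := fun p i => R (p, i)) hR i j p q
  have hX : ∀ i j, weight (X i j) = weight (X j i) := by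
    intro i j
    rw [weight, weight, Finset.sum_comm]
    refine Finset.sum_congr rfl fun p _ => Finset.sum_congr rfl fun q _ => ?_
    congr 1
    by_cases h : q = p ∨ i = j
    · rw [show X i j q p = 0 from if_pos h,
        show X j i p q = 0 from if_pos (h.imp Eq.symm Eq.symm)]
    · have h' : ¬ (p = q ∨ j = i) := fun h' => h (h'.imp Eq.symm Eq.symm)
      rw [show X i j q p = _ from if_neg h, show X j i p q = _ from if_neg h']
      push Not at h
      have := halfParity_add_swap (ha.ne h.1)
      have := halfParity_add_swap (hb.ne h.2)
      simp only [crossParity]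
      grind
  have hT : ∀ i j k, i ≠ j → j ≠ k → i ≠ k →
      1 ≤ weight (X i j) + weight (X j k) + weight (X i k) := by
    intro i j k hij hjk hik
    let f : Fin 3 → Fin 3 → ℕ := fun p q => (X i j p q).val + (X j k p q).val + (X i k p q).val
    let s : Fin n → Fin n → Fin 3 → ZMod 2 := fun i j p =>
      turnParity (hR p i) (b j) + halfParity (a p) (b j)
    let σ : Fin 3 → ZMod 2 := fun p =>
      s i j p + s j i p + s j k p + s k j p + s i k p + s k i p
    have hf : ∀ p, f p p = 0 := fun p => by simp [f, X]
    have hσ : ∀ p q, p ≠ q → ((f p q + f q p : ℕ) : ZMod 2) = 1 + σ p + σ q := by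
      intro p q hpq
      have := halfParity_add_swap (ha.ne hpq)
      simp only [f, σ, s, X, Nat.cast_add, ZMod.natCast_val, ZMod.cast_id', id_eq, hpq, hpq.symm,
        hij, hjk, hik, or_self, if_false, crossParity]
      grind
    have h1 : ∀ σ : Fin 3 → ZMod 2, 1 ≤ sameCount σ := by decide +kernel
    have h2 : weight (X i j) + weight (X j k) + weight (X i k) = ∑ p, ∑ q, f p q := by
      simp only [weight, f, Finset.sum_add_distrib]
    rw [h2]
    exact (h1 σ).trans (sameCount_le f σ hf hσ)
  have key := two_mul_half_mul_half_le_sum _ hX hT Finset.univ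
  rw [Finset.card_univ, Fintype.card_fin] at key
  refine key.trans ?_
  rw [Nat.card_eq_fintype_card, Fintype.card_subtype, Finset.card_filter]
  simp only [Fintype.sum_prod_type, weight]
  rw [sum_sum_sum_sum_comm]
  refine Finset.sum_le_sum fun p _ => Finset.sum_le_sum fun i _ => Finset.sum_le_sum fun q _ =>
    Finset.sum_le_sum fun j _ => ?_
  by_cases h : p = q ∨ i = j
  · simp [X, h]
  · simp only [X, if_neg h]
    push Not at h
    simp only [ne_eq, h, not_false_iff, and_self, true_and]
    exact val_le_ite_of_disjoint (crossParity_eq_zero (R := fun p i => R (p, i)) hR hab)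

/-- The labels of the edges of the join of a five-vertex star, whose centre is the last vertex, and
a discrete graph: the edges between both parts and the edges of the star. -/
abbrev JoinEdge (n : ℕ) := (Fin 5 × Fin n) ⊕ Fin 4

/-- Two edges, labelled by `JoinEdge n`, have no common endpoint, and are not both in the star. -/
def JoinEdge.Independent {n : ℕ} : JoinEdge n → JoinEdge n → Prop
  | .inl x, .inl y => x.1 ≠ y.1 ∧ x.2 ≠ y.2
  | .inl x, .inr w => x.1 ≠ Fin.last 4 ∧ x.1 ≠ w.castSucc
  | .inr w, .inl x => x.1 ≠ Fin.last 4 ∧ x.1 ≠ w.castSucc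
  | .inr _, .inr _ => False

/-- The join of a five-vertex star and a discrete graph on `n` vertices has at least `n (n - 1)`
independent crossings. -/
theorem le_card_meeting_join {n : ℕ} {a : Fin 5 → ℂ} {b : Fin n → ℂ}
    (ha : Function.Injective a) (hb : Function.Injective b) (hab : ∀ p i, a p ≠ b i)
    {R : JoinEdge n → Set ℂ} (hR : ∀ p i, JoinedIn (R (.inl (p, i))) (a p) (b i))
    (hC : ∀ w : Fin 4, JoinedIn (R (.inr w)) (a (Fin.last 4)) (a w.castSucc)) :
    2 * (n * (n - 1)) ≤ Nat.card {x : JoinEdge n × JoinEdge n //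
      x.1.Independent x.2 ∧ ¬ Disjoint (R x.1) (R x.2)} := by
  classical
  let P : ParityModel (Fin n) :=
    { Y := fun i p q => turnParity (hR p i) (a q)
      s := fun i j p => turnParity (hR p i) (b j) + halfParity (a p) (b j)
      τ := fun p q => halfParity (a p) (a q)
      ω := fun i j => halfParity (b i) (b j) + 1
      h := fun i w => turnParity (hC w) (b i) + halfParity (a (Fin.last 4)) (b i) +
        halfParity (a w.castSucc) (b i)
      g := fun p w => turnParity (hC w) (a p.castSucc) +
        halfParity (a (Fin.last 4)) (a p.castSucc) + halfParity (a w.castSucc) (a p.castSucc)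
      τ_swap := fun p q h => halfParity_add_swap (ha.ne h)
      ω_swap := fun i j h => by
        have := halfParity_add_swap (hb.ne h)
        grind }
  have hX : ∀ i j p q, (P.X i j p q).val ≤
      if p ≠ q ∧ ¬ Disjoint (R (.inl (p, i))) (R (.inl (q, j))) then 1 else 0 := by
    intro i j p q
    by_cases hpq : p = q
    · simp [hpq, ParityModel.X_self]
    · rw [ParityModel.X_of_ne hpq]
      simp only [ne_eq, hpq, not_false_iff, true_and]
      refine val_le_ite_of_disjoint fun h => ?_
      rw [← crossParity_eq_zero (R := fun p i => R (.inl (p, i))) hR hab h, crossParity]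
  have hG : ∀ i p q, (P.G i p q).val ≤
      if p ≠ q ∧ ¬ Disjoint (R (.inl (p.castSucc, i))) (R (.inr q)) then 1 else 0 := by
    intro i p q
    by_cases hpq : p = q
    · simp [hpq, ParityModel.G_self]
    · rw [ParityModel.G_of_ne hpq]
      simp only [ne_eq, hpq, not_false_iff, true_and]
      refine val_le_ite_of_disjoint fun h => ?_
      have := parity_eq_zero_of_disjoint (hC q) (hR p.castSucc i) h.symm
      simp only [P]
      grind
  have hstar : ∑ i, ∑ j, P.C i j ≤ ∑ p : Fin 5, ∑ i : Fin n, ∑ q : Fin 5, ∑ j : Fin n,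
      if (p ≠ q ∧ i ≠ j) ∧ ¬ Disjoint (R (.inl (p, i))) (R (.inl (q, j))) then 1 else 0 := by
    rw [← sum_sum_sum_sum_comm]
    refine Finset.sum_le_sum fun i _ => Finset.sum_le_sum fun j _ => ?_
    by_cases hij : i = j
    · simp [hij, ParityModel.C_self]
    · rw [ParityModel.C_of_ne hij]
      rw [weight]
      simpa only [ne_eq, hij, not_false_iff, and_true] using
        Finset.sum_le_sum fun p _ => Finset.sum_le_sum fun q _ => hX i j p q
  have hcentre : ∑ i, P.Γ i ≤ ∑ p : Fin 5, ∑ i : Fin n, ∑ w : Fin 4,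
      if (p ≠ Fin.last 4 ∧ p ≠ w.castSucc) ∧ ¬ Disjoint (R (.inl (p, i))) (R (.inr w))
        then 1 else 0 := by
    rw [Finset.sum_comm]
    refine Finset.sum_le_sum fun i _ => ?_
    rw [Fin.sum_univ_castSucc, ParityModel.Γ, weight]
    refine le_add_right (Finset.sum_le_sum fun p _ => Finset.sum_le_sum fun q _ => ?_)
    simpa only [ne_eq, Fin.castSucc_ne_last, not_false_iff, true_and,
      Fin.castSucc_inj] using hG i p q
  have key := (ParityModel.isStarSystem P).le_sum Finset.univ
  rw [Finset.card_univ, Fintype.card_fin] at key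
  refine key.trans ?_
  rw [Nat.card_eq_fintype_card, Fintype.card_subtype, Finset.card_filter]
  simp only [Fintype.sum_prod_type, Fintype.sum_sum_type, JoinEdge.Independent, false_and,
    if_false, Finset.sum_const_zero, add_zero, Finset.sum_add_distrib]
  have hswap : ∑ w : Fin 4, ∑ p : Fin 5, ∑ i : Fin n,
      (if (p ≠ Fin.last 4 ∧ p ≠ w.castSucc) ∧ ¬ Disjoint (R (.inr w)) (R (.inl (p, i)))
        then 1 else 0) = ∑ p : Fin 5, ∑ i : Fin n, ∑ w : Fin 4,
      if (p ≠ Fin.last 4 ∧ p ≠ w.castSucc) ∧ ¬ Disjoint (R (.inl (p, i))) (R (.inr w))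
        then 1 else 0 := by
    rw [Finset.sum_comm]
    refine Finset.sum_congr rfl fun p _ => ?_
    rw [Finset.sum_comm]
    simp only [disjoint_comm]
  refine (Nat.add_le_add hstar (Nat.mul_le_mul_left 2 hcentre)).trans (le_of_eq ?_)
  rw [two_mul, ← add_assoc]
  nth_rewrite 1 [← hswap]
  congr! 1
  · congr! 1
    · refine Finset.sum_congr rfl fun p _ => Finset.sum_congr rfl fun i _ =>
        Finset.sum_congr rfl fun q _ => Finset.sum_congr rfl fun j _ => by congr
    · exact Finset.sum_congr rfl fun p _ => Finset.sum_congr rfl fun i _ =>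
        Finset.sum_congr rfl fun q _ => by congr
  · exact Finset.sum_congr rfl fun p _ => Finset.sum_congr rfl fun i _ =>
      Finset.sum_congr rfl fun q _ => by congr

end Bipartite

/-- The product of `G6_62` and the star `K_{1,n}`. -/
abbrev starProd (n : ℕ) : SimpleGraph (Fin 6 × (Fin 1 ⊕ Fin n)) :=
  G6_62 □ completeBipartiteGraph (Fin 1) (Fin n)

/-- The first endpoints of the edges of `G6_62`. -/
def edgeFst : Fin 7 → Fin 6 := ![0, 1, 2, 3, 4, 2, 2]

/-- The second endpoints of the edges of `G6_62`. -/
def edgeSnd : Fin 7 → Fin 6 := ![1, 2, 3, 4, 5, 4, 5]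

/-- Labels for the edges at one leaf of the star: those joining the copies of a vertex of `G6_62`,
and the edges of the copy of `G6_62` at this leaf. -/
abbrev LeafKind := Fin 6 ⊕ Fin 7

/-- Labels for the edges of `starProd n`; the right summand labels the central copy of `G6_62`. -/
abbrev EdgeLabel (n : ℕ) := (LeafKind × Fin n) ⊕ Fin 7

namespace EdgeLabel

variable {n : ℕ}

/-- The first endpoint of an edge. -/
def fst : EdgeLabel n → Fin 6 × (Fin 1 ⊕ Fin n)
  | .inl (.inl v, _) => (v, .inl 0)
  | .inl (.inr k, i) => (edgeFst k, .inr i)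
  | .inr k => (edgeFst k, .inl 0)

/-- The second endpoint of an edge. -/
def snd : EdgeLabel n → Fin 6 × (Fin 1 ⊕ Fin n)
  | .inl (.inl v, i) => (v, .inr i)
  | .inl (.inr k, i) => (edgeSnd k, .inr i)
  | .inr k => (edgeSnd k, .inl 0)

lemma adj_edgeFst_edgeSnd (k : Fin 7) : G6_62.Adj (edgeFst k) (edgeSnd k) := by
  fin_cases k <;> simp [G6_62, edgeFst, edgeSnd]

lemma exists_eq_of_adj {u v : Fin 6} (h : G6_62.Adj u v) :
    ∃ k, s(edgeFst k, edgeSnd k) = s(u, v) := by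
  rw [G6_62, SimpleGraph.fromEdgeSet_adj] at h
  simp only [Set.mem_insert_iff, Set.mem_singleton_iff] at h
  obtain ⟨h | h | h | h | h | h | h, -⟩ := h <;> rw [h]
  exacts [⟨0, rfl⟩, ⟨1, rfl⟩, ⟨2, rfl⟩, ⟨3, rfl⟩, ⟨4, rfl⟩, ⟨5, rfl⟩, ⟨6, rfl⟩]

lemma adj (e : EdgeLabel n) : (starProd n).Adj e.fst e.snd := by
  match e with
  | .inl (.inl v, i) => simp [fst, snd, boxProd_adj]
  | .inl (.inr k, i) => simp [fst, snd, boxProd_adj, adj_edgeFst_edgeSnd]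
  | .inr k => simp [fst, snd, boxProd_adj, adj_edgeFst_edgeSnd]

/-- The edge with a given label. -/
def toEdge (e : EdgeLabel n) : (starProd n).edgeSet :=
  ⟨s(e.fst, e.snd), (SimpleGraph.mem_edgeSet _).2 e.adj⟩

lemma toEdge_eq_iff {e f : EdgeLabel n} :
    e.toEdge = f.toEdge ↔ e.fst = f.fst ∧ e.snd = f.snd ∨ e.fst = f.snd ∧ e.snd = f.fst := by
  rw [Subtype.ext_iff, toEdge, toEdge, Sym2.eq_iff]

lemma edge_eq_of_eq : ∀ k l : Fin 7, edgeFst k = edgeFst l → edgeSnd k = edgeSnd l → k = l := by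
  decide

lemma edge_ne_swap : ∀ k l : Fin 7, edgeFst k = edgeSnd l → edgeSnd k ≠ edgeFst l := by
  decide

lemma toEdge_injective : Function.Injective (toEdge (n := n)) := by
  intro e f h
  rw [toEdge_eq_iff] at h
  match e, f with
  | .inl (.inl v, i), .inl (.inl w, j) => simp [fst, snd] at h; simp [h]
  | .inl (.inl v, i), .inl (.inr l, j) => simp [fst, snd] at h
  | .inl (.inl v, i), .inr l => simp [fst, snd] at h
  | .inl (.inr k, i), .inl (.inl w, j) => simp [fst, snd] at h
  | .inr k, .inl (.inl w, j) => simp [fst, snd] at h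
  | .inr k, .inl (.inr l, j) => simp [fst, snd] at h
  | .inl (.inr k, i), .inr l => simp [fst, snd] at h
  | .inr k, .inr l =>
    simp only [fst, snd, Prod.mk.injEq, and_true] at h
    rw [edge_eq_of_eq k l (h.resolve_right fun h => edge_ne_swap k l h.1 h.2).1
      (h.resolve_right fun h => edge_ne_swap k l h.1 h.2).2]
  | .inl (.inr k, i), .inl (.inr l, j) =>
    simp only [fst, snd, Prod.mk.injEq, Sum.inr.injEq] at h
    obtain ⟨⟨h1, rfl⟩, h2, -⟩ | ⟨⟨h1, -⟩, h2, -⟩ := h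
    · rw [edge_eq_of_eq k l h1 h2]
    · exact absurd h2 (edge_ne_swap k l h1)

lemma toEdge_surjective : Function.Surjective (toEdge (n := n)) := by
  rintro ⟨e, he⟩
  induction e using Sym2.ind with
  | _ x y =>
  obtain ⟨u, x⟩ := x
  obtain ⟨v, y⟩ := y
  rw [SimpleGraph.mem_edgeSet, boxProd_adj] at he
  obtain ⟨h, hxy⟩ | ⟨h, huv⟩ := he
  · obtain rfl : x = y := hxy
    obtain ⟨k, hk⟩ := exists_eq_of_adj h
    rcases x with x | i
    · refine ⟨.inr k, Subtype.ext ?_⟩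
      simp only [toEdge, fst, snd]
      simp only [Sym2.eq_iff, Prod.mk.injEq] at hk ⊢
      simpa [Subsingleton.elim x 0] using hk
    · refine ⟨.inl (.inr k, i), Subtype.ext ?_⟩
      simp only [toEdge, fst, snd]
      simpa [Sym2.eq_iff] using hk
  · obtain rfl : u = v := huv
    rcases x with x | i <;> rcases y with y | j
    · simp at h
    · exact ⟨.inl (.inl u, j), Subtype.ext (by simp [toEdge, fst, snd, Subsingleton.elim x 0])⟩
    · exact ⟨.inl (.inl u, i), Subtype.ext (by simp [toEdge, fst, snd, Subsingleton.elim y 0])⟩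
    · simp at h

end EdgeLabel

namespace Drawing

variable {V : Type*} {G : SimpleGraph V} (D : Drawing G)

/-- The position of a vertex in the complex plane. -/
noncomputable def pos (v : V) : ℂ := Complex.equivRealProdCLM.symm (D.vertexMap v)

/-- The arc of an edge, with its endpoints, as a subset of the complex plane. -/
def arcSet (e : G.edgeSet) : Set ℂ :=
  (fun t => Complex.equivRealProdCLM.symm (D.arc e t)) '' Set.Icc 0 1

/-- Two distinct edges whose arcs meet in interior points. -/
def Crosses (e f : G.edgeSet) : Prop :=
  e ≠ f ∧ ∃ s ∈ Set.Ioo (0 : ℝ) 1, ∃ t ∈ Set.Ioo (0 : ℝ) 1, D.arc e s = D.arc f t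

lemma pos_injective : Function.Injective D.pos :=
  Complex.equivRealProdCLM.symm.injective.comp D.vertexMap_injective

lemma joinedIn_arcSet {e : G.edgeSet} {u v : V} (h : (e : Sym2 V) = s(u, v)) :
    JoinedIn (D.arcSet e) (D.pos u) (D.pos v) := by
  obtain ⟨x, y, hxy, hx, hy⟩ := D.arc_endpoints e
  have key : JoinedIn (D.arcSet e) (D.pos x) (D.pos y) := by
    have h01 : IsPathConnected (D.arcSet e) :=
      ((convex_Icc (0 : ℝ) 1).isPathConnected ⟨0, by simp⟩).image'
        (Complex.equivRealProdCLM.symm.continuous.comp_continuousOn (D.arc_continuousOn e))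
    exact h01.joinedIn _ ⟨0, by simp, by simp [pos, hx]⟩ _ ⟨1, by simp, by simp [pos, hy]⟩
  rw [h, Sym2.eq_iff] at hxy
  obtain ⟨rfl, rfl⟩ | ⟨rfl, rfl⟩ := hxy
  exacts [key, key.symm]

lemma arc_endpoint {e : G.edgeSet} {t : ℝ} (ht : t ∈ Set.Icc (0 : ℝ) 1) :
    t ∈ Set.Ioo (0 : ℝ) 1 ∨ ∃ v ∈ (e : Sym2 V), D.arc e t = D.vertexMap v := by
  obtain ⟨x, y, hxy, hx, hy⟩ := D.arc_endpoints e
  rcases ht.1.eq_or_lt with rfl | h0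
  · exact .inr ⟨x, by simp [hxy], hx⟩
  rcases ht.2.eq_or_lt with rfl | h1
  · exact .inr ⟨y, by simp [hxy], hy⟩
  exact .inl ⟨h0, h1⟩

lemma crosses_of_not_disjoint {e f : G.edgeSet}
    (hd : ∀ v, v ∈ (e : Sym2 V) → v ∉ (f : Sym2 V))
    (h : ¬ Disjoint (D.arcSet e) (D.arcSet f)) : D.Crosses e f := by
  have hef : e ≠ f := by
    rintro rfl
    obtain ⟨x, y, hxy, -⟩ := D.arc_endpoints e
    exact hd x (by simp [hxy]) (by simp [hxy])
  obtain ⟨z, ⟨s, hs, rfl⟩, t, ht, hst⟩ := Set.not_disjoint_iff.1 h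
  replace hst : D.arc f t = D.arc e s := Complex.equivRealProdCLM.symm.injective hst
  rcases D.arc_endpoint (e := e) hs with hs' | ⟨v, hv, hsv⟩
  · rcases D.arc_endpoint (e := f) ht with ht' | ⟨v, hv, htv⟩
    · exact ⟨hef, s, hs', t, ht', hst.symm⟩
    · exact absurd (hst.symm.trans htv) (D.arc_avoids_vertices e s hs' v)
  · rcases D.arc_endpoint (e := f) ht with ht' | ⟨w, hw, htw⟩
    · exact absurd (hst.trans hsv) (D.arc_avoids_vertices f t ht' v)
    · have := D.vertexMap_injective (htw.symm.trans (hst.trans hsv))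
      exact absurd hw (this ▸ hd v hv)

/-- The number of ordered pairs of crossing edges is at most twice the number of crossings. -/
lemma card_crosses_le [Finite G.edgeSet] (hD : D.crossings.Finite) :
    Nat.card {x : G.edgeSet × G.edgeSet // D.Crosses x.1 x.2} ≤ 2 * D.crossings.ncard := by
  classical
  have := Fintype.ofFinite G.edgeSet
  rw [Nat.card_eq_fintype_card, Fintype.card_subtype]
  set O := Finset.univ.filter fun x : G.edgeSet × G.edgeSet => D.Crosses x.1 x.2 with hO
  have h1 : O.card ≤ 2 * (O.image fun x => s(x.1, x.2)).card := by
    refine Finset.card_le_mul_card_image O 2 fun z hz => ?_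
    induction z using Sym2.ind with
    | _ a b =>
    refine (Finset.card_le_card (t := {(a, b), (b, a)}) fun x hx => ?_).trans Finset.card_le_two
    simp only [Finset.mem_filter, Sym2.eq_iff] at hx
    simpa [Prod.ext_iff] using hx.2
  have h2 : (O.image fun x => s(x.1, x.2)) ⊆ hD.toFinset.image Prod.fst := by
    intro z hz
    simp only [hO, Finset.mem_image, Finset.mem_filter, Finset.mem_univ, true_and] at hz
    obtain ⟨⟨e, f⟩, ⟨hef, s, hs, t, ht, hst⟩, rfl⟩ := hz
    simp only [Finset.mem_image, Set.Finite.mem_toFinset]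
    exact ⟨(s(e, f), D.arc e s), ⟨e, f, hef, rfl, ⟨s, hs, rfl⟩, t, ht, hst.symm⟩, rfl⟩
  have h3 := (Finset.card_le_card h2).trans Finset.card_image_le
  rw [← Set.ncard_eq_toFinset_card _ hD] at h3
  omega

end Drawing

namespace EdgeLabel

variable {n : ℕ}

/-- The part of a system of paths, given by the path through each edge, which is labelled `l`. -/
def pathSet {Λ : Type*} (D : Drawing (starProd n)) (path : EdgeLabel n → Option Λ) (l : Λ) :
    Set ℂ := ⋃ e ∈ {e | path e = some l}, D.arcSet e.toEdge

lemma joinedIn_pathSet {Λ : Type*} (D : Drawing (starProd n)) {path : EdgeLabel n → Option Λ}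
    {l : Λ} (e : EdgeLabel n) (he : path e = some l) :
    JoinedIn (pathSet D path l) (D.pos e.fst) (D.pos e.snd) :=
  (D.joinedIn_arcSet (e := e.toEdge) rfl).mono (Set.subset_biUnion_of_mem (u := fun e =>
    D.arcSet (toEdge e)) he)

/-- The pairs of edges on independent paths of a system. -/
def OnIndependent {Λ : Type*} (path : EdgeLabel n → Option Λ) (Ind : Λ → Λ → Prop)
    (e f : EdgeLabel n) : Prop :=
  ∃ l m, path e = some l ∧ path f = some m ∧ Ind l m

lemma card_meeting_le {Λ : Type*} (D : Drawing (starProd n)) (path : EdgeLabel n → Option Λ)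
    (Ind : Λ → Λ → Prop) (hInd : ∀ e f : EdgeLabel n, OnIndependent path Ind e f →
      ∀ v, v ∈ s(e.fst, e.snd) → v ∉ s(f.fst, f.snd)) :
    Nat.card {x : Λ × Λ // Ind x.1 x.2 ∧ ¬ Disjoint (pathSet D path x.1) (pathSet D path x.2)} ≤
      Nat.card {y : EdgeLabel n × EdgeLabel n //
        D.Crosses y.1.toEdge y.2.toEdge ∧ OnIndependent path Ind y.1 y.2} := by
  have key : ∀ x : {x : Λ × Λ // Ind x.1 x.2 ∧
      ¬ Disjoint (pathSet D path x.1) (pathSet D path x.2)},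
      ∃ y : {y : EdgeLabel n × EdgeLabel n //
        D.Crosses y.1.toEdge y.2.toEdge ∧ OnIndependent path Ind y.1 y.2},
        path y.1.1 = some x.1.1 ∧ path y.1.2 = some x.1.2 := by
    rintro ⟨⟨l, m⟩, hlm, h⟩
    obtain ⟨z, hz, hz'⟩ := Set.not_disjoint_iff.1 h
    simp only [pathSet, Set.mem_iUnion, Set.mem_ofPred_eq] at hz hz'
    obtain ⟨e, he, hze⟩ := hz
    obtain ⟨f, hf, hzf⟩ := hz'
    have hef : OnIndependent path Ind e f := ⟨l, m, he, hf, hlm⟩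
    exact ⟨⟨(e, f), D.crosses_of_not_disjoint (hInd e f hef)
      (Set.not_disjoint_iff.2 ⟨z, hze, hzf⟩), hef⟩, he, hf⟩
  choose y hy using key
  refine Nat.card_le_card_of_injective y fun x x' h => ?_
  have h1 := (hy x).1
  have h2 := (hy x).2
  rw [h, (hy x').1] at h1
  rw [h, (hy x').2] at h2
  exact Subtype.ext (Prod.ext (Option.some_injective _ h1).symm (Option.some_injective _ h2).symm)

/-- The path through an edge in a system of paths subdividing a five-vertex star joined to a
discrete graph. -/
def joinPath (hub : LeafKind → Option (Fin 5)) (cen : Fin 7 → Option (Fin 4)) :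
    EdgeLabel n → Option (JoinEdge n)
  | .inl (k, i) => (hub k).map fun p => .inl (p, i)
  | .inr c => (cen c).map .inr

/-- The path through an edge in a system of paths subdividing `K_{3,n}`. -/
def bipPath (hub : LeafKind → Option (Fin 3)) : EdgeLabel n → Option (Fin 3 × Fin n)
  | .inl (k, i) => (hub k).map fun p => (p, i)
  | .inr _ => none

/-- Two edges at different leaves of the star belong to paths at different hubs. -/
def Apart {m : ℕ} (hub : LeafKind → Option (Fin m)) (k l : LeafKind) : Prop :=
  hub k ≠ none ∧ hub l ≠ none ∧ hub k ≠ hub l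

instance {m : ℕ} (hub : LeafKind → Option (Fin m)) (k l : LeafKind) : Decidable (Apart hub k l) :=
  inferInstanceAs (Decidable (_ ∧ _))

lemma onIndependent_joinPath {hub : LeafKind → Option (Fin 5)} {cen : Fin 7 → Option (Fin 4)}
    {k l : LeafKind} {i j : Fin n}
    (h : OnIndependent (joinPath hub cen) JoinEdge.Independent (.inl (k, i)) (.inl (l, j))) :
    Apart hub k l ∧ i ≠ j := by
  obtain ⟨x, y, hx, hy, hxy⟩ := h
  simp only [joinPath, Option.map_eq_some_iff] at hx hy
  obtain ⟨p, hp, rfl⟩ := hx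
  obtain ⟨q, hq, rfl⟩ := hy
  exact ⟨by simpa [Apart, hp, hq] using hxy.1, hxy.2⟩

lemma onIndependent_bipPath {hub : LeafKind → Option (Fin 3)} {e f : EdgeLabel n}
    (h : OnIndependent (bipPath hub) (fun x y => x.1 ≠ y.1 ∧ x.2 ≠ y.2) e f) :
    ∃ k i l j, e = .inl (k, i) ∧ f = .inl (l, j) ∧ Apart hub k l ∧ i ≠ j := by
  obtain ⟨x, y, hx, hy, hxy⟩ := h
  match e, f with
  | .inr _, _ => simp [bipPath] at hx
  | .inl _, .inr _ => simp [bipPath] at hy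
  | .inl (k, i), .inl (l, j) =>
    simp only [bipPath, Option.map_eq_some_iff] at hx hy
    obtain ⟨p, hp, rfl⟩ := hx
    obtain ⟨q, hq, rfl⟩ := hy
    exact ⟨k, i, l, j, rfl, rfl, by simpa [Apart, hp, hq] using hxy.1, hxy.2⟩

lemma notMem_of_apart {m : ℕ} {hub : LeafKind → Option (Fin m)} {k l : LeafKind} {i j : Fin n}
    (h : Apart hub k l) (hij : i ≠ j) (v : Fin 6 × (Fin 1 ⊕ Fin n))
    (hv : v ∈ s(fst (.inl (k, i)), snd (.inl (k, i)))) :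
    v ∉ s(fst (.inl (l, j)), snd (.inl (l, j))) := by
  have hkl : k ≠ l := fun hkl => h.2.2 (by rw [hkl])
  rw [Sym2.mem_iff] at hv ⊢
  match k, l with
  | .inl u, .inl w =>
    have : u ≠ w := fun h => hkl (by rw [h])
    rcases hv with rfl | rfl <;> simp [fst, snd, this, hij]
  | .inl u, .inr l => rcases hv with rfl | rfl <;> simp [fst, snd, hij]
  | .inr k, .inl u => rcases hv with rfl | rfl <;> simp [fst, snd, hij]
  | .inr k, .inr l => rcases hv with rfl | rfl <;> simp [fst, snd, hij]

/-- The hub edges and the central edges of the system are disjoint where they should be. -/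
def CentreApart (hub : LeafKind → Option (Fin 5)) (cen : Fin 7 → Option (Fin 4)) : Prop :=
  ∀ (u : Fin 6) (c : Fin 7) (p : Fin 5) (w : Fin 4), hub (.inl u) = some p → cen c = some w →
    p ≠ Fin.last 4 → p ≠ w.castSucc → u ≠ edgeFst c ∧ u ≠ edgeSnd c

instance (hub : LeafKind → Option (Fin 5)) (cen : Fin 7 → Option (Fin 4)) :
    Decidable (CentreApart hub cen) :=
  inferInstanceAs (Decidable (∀ (u : Fin 6) (c : Fin 7) (p : Fin 5) (w : Fin 4),
    hub (.inl u) = some p → cen c = some w →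
    p ≠ Fin.last 4 → p ≠ w.castSucc → u ≠ edgeFst c ∧ u ≠ edgeSnd c))

lemma notMem_of_centreApart {hub : LeafKind → Option (Fin 5)} {cen : Fin 7 → Option (Fin 4)}
    (hc : CentreApart hub cen) {k : LeafKind} {i : Fin n} {c : Fin 7} {p : Fin 5} {w : Fin 4}
    (hp : hub k = some p) (hw : cen c = some w) (h1 : p ≠ Fin.last 4) (h2 : p ≠ w.castSucc)
    (v : Fin 6 × (Fin 1 ⊕ Fin n)) (hv : v ∈ s(fst (.inl (k, i)), snd (.inl (k, i)))) :
    v ∉ s(fst (.inr c : EdgeLabel n), snd (.inr c)) := by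
  rw [Sym2.mem_iff] at hv ⊢
  match k with
  | .inl u =>
    have := hc u c p w hp hw h1 h2
    rcases hv with rfl | rfl <;> simp [fst, snd, this]
  | .inr k => rcases hv with rfl | rfl <;> simp [fst, snd]

lemma not_common_joinPath {hub : LeafKind → Option (Fin 5)} {cen : Fin 7 → Option (Fin 4)}
    (hc : CentreApart hub cen) (e f : EdgeLabel n)
    (h : OnIndependent (joinPath hub cen) JoinEdge.Independent e f) (v : Fin 6 × (Fin 1 ⊕ Fin n))
    (hv : v ∈ s(e.fst, e.snd)) : v ∉ s(f.fst, f.snd) := by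
  match e, f with
  | .inl (k, i), .inl (l, j) =>
    exact notMem_of_apart (onIndependent_joinPath h).1 (onIndependent_joinPath h).2 v hv
  | .inl (k, i), .inr c =>
    obtain ⟨x, y, hx, hy, hxy⟩ := h
    simp only [joinPath, Option.map_eq_some_iff] at hx hy
    obtain ⟨p, hp, rfl⟩ := hx
    obtain ⟨w, hw, rfl⟩ := hy
    exact notMem_of_centreApart hc hp hw hxy.1 hxy.2 v hv
  | .inr c, .inl (k, i) =>
    obtain ⟨x, y, hx, hy, hxy⟩ := h
    simp only [joinPath, Option.map_eq_some_iff] at hx hy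
    obtain ⟨w, hw, rfl⟩ := hx
    obtain ⟨p, hp, rfl⟩ := hy
    exact fun hv' => notMem_of_centreApart hc hp hw hxy.1 hxy.2 v hv' hv
  | .inr c, .inr d =>
    obtain ⟨x, y, hx, hy, hxy⟩ := h
    simp only [joinPath, Option.map_eq_some_iff] at hx hy
    obtain ⟨w, hw, rfl⟩ := hx
    obtain ⟨p, hp, rfl⟩ := hy
    exact hxy.elim

/-- The hubs of the first system of paths from the vertices `v3, …, v6` and `v2`. -/
def hubNear : LeafKind → Option (Fin 5) := Sum.elim
  ![none, some 3, some 4, some 0, some 1, some 2]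
  ![none, some 3, some 0, none, none, some 1, some 2]

/-- The central edges of the first system. -/
def cenNear : Fin 7 → Option (Fin 4) := ![none, some 3, some 0, none, none, some 1, some 2]

/-- The hubs of the second system of paths from the vertices `v3, …, v6` and `v1`. -/
def hubFar : LeafKind → Option (Fin 5) := Sum.elim
  ![some 3, none, some 4, some 0, some 1, some 2]
  ![some 3, some 3, some 0, none, none, some 1, some 2]

/-- The central edges of the second system. -/
def cenFar : Fin 7 → Option (Fin 4) := ![some 3, some 3, some 0, none, none, some 1, some 2]

/-- The hubs of the system of paths from `v1`, `v2` and `v3`. -/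
def hubThree : LeafKind → Option (Fin 3) := Sum.elim
  ![some 0, some 1, some 2, none, none, none]
  ![some 0, some 2, none, none, none, none, none]

/-- The hubs of the system of paths from `v1`, `v2` and `v4`. -/
def hubFour : LeafKind → Option (Fin 3) := Sum.elim
  ![some 0, some 1, none, some 2, none, none]
  ![some 0, some 2, some 2, none, none, none, none]

lemma apart_add_le_two : ∀ k l : LeafKind,
    (if Apart hubNear k l then 1 else 0) + (if Apart hubFar k l then 1 else 0) +
      (if Apart hubThree k l then 1 else 0) + (if Apart hubFour k l then 1 else 0) ≤ 2 := by
  decide +kernel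

variable (D : Drawing (starProd n))

/-- The position of the copy of a vertex of `G6_62` at the centre of the star. -/
noncomputable def centrePos (v : Fin 6) : ℂ := D.pos (v, .inl 0)

/-- The position of the copy of a vertex of `G6_62` at a leaf of the star. -/
noncomputable def leafPos (v : Fin 6) (i : Fin n) : ℂ := D.pos (v, .inr i)

lemma centrePos_injective : Function.Injective (centrePos D) := fun v w h => by
  simpa using D.pos_injective h

lemma leafPos_injective (v : Fin 6) : Function.Injective (leafPos D v) := fun i j h => by
  simpa using D.pos_injective h

lemma centrePos_ne_leafPos (v w : Fin 6) (i : Fin n) : centrePos D v ≠ leafPos D w i := fun h => by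
  simpa using D.pos_injective h

section

variable {D}

lemma joinedIn_star {hub : LeafKind → Option (Fin 5)} {cen : Fin 7 → Option (Fin 4)} {p : Fin 5}
    {i : Fin n} (v : Fin 6) (h : hub (.inl v) = some p) :
    JoinedIn (pathSet D (joinPath hub cen) (.inl (p, i))) (centrePos D v) (leafPos D v i) :=
  joinedIn_pathSet D (.inl (.inl v, i)) (by simp [joinPath, h])

lemma joinedIn_leaf {hub : LeafKind → Option (Fin 5)} {cen : Fin 7 → Option (Fin 4)} {p : Fin 5}
    {i : Fin n} (k : Fin 7) (h : hub (.inr k) = some p) :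
    JoinedIn (pathSet D (joinPath hub cen) (.inl (p, i)))
      (leafPos D (edgeFst k) i) (leafPos D (edgeSnd k) i) :=
  joinedIn_pathSet D (.inl (.inr k, i)) (by simp [joinPath, h])

lemma joinedIn_centre {hub : LeafKind → Option (Fin 5)} {cen : Fin 7 → Option (Fin 4)} {w : Fin 4}
    (k : Fin 7) (h : cen k = some w) : JoinedIn (pathSet D (joinPath hub cen) (.inr w))
      (centrePos D (edgeFst k)) (centrePos D (edgeSnd k)) :=
  joinedIn_pathSet D (.inr k) (by simp [joinPath, h])

lemma joinedIn_bipStar {hub : LeafKind → Option (Fin 3)} {p : Fin 3} {i : Fin n} (v : Fin 6)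
    (h : hub (.inl v) = some p) :
    JoinedIn (pathSet D (bipPath hub) (p, i)) (centrePos D v) (leafPos D v i) :=
  joinedIn_pathSet D (.inl (.inl v, i)) (by simp [bipPath, h])

lemma joinedIn_bipLeaf {hub : LeafKind → Option (Fin 3)} {p : Fin 3} {i : Fin n} (k : Fin 7)
    (h : hub (.inr k) = some p) : JoinedIn (pathSet D (bipPath hub) (p, i))
      (leafPos D (edgeFst k) i) (leafPos D (edgeSnd k) i) :=
  joinedIn_pathSet D (.inl (.inr k, i)) (by simp [bipPath, h])

end

lemma le_card_near : 2 * (n * (n - 1)) ≤ Nat.card {y : EdgeLabel n × EdgeLabel n //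
    D.Crosses y.1.toEdge y.2.toEdge ∧
      OnIndependent (joinPath hubNear cenNear) JoinEdge.Independent y.1 y.2} := by
  refine le_trans (le_card_meeting_join (a := fun p => centrePos D (![3, 4, 5, 1, 2] p))
    (b := leafPos D 2) ?_ (leafPos_injective D 2) (fun p i => centrePos_ne_leafPos D _ _ _)
    (R := pathSet D (joinPath hubNear cenNear)) ?_ ?_)
    (card_meeting_le D _ _ (not_common_joinPath (by decide)))
  · exact (centrePos_injective D).comp (by decide)
  · intro p i
    match p with
    | 0 => exact (joinedIn_star 3 rfl).trans (joinedIn_leaf 2 rfl).symm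
    | 1 => exact (joinedIn_star 4 rfl).trans (joinedIn_leaf 5 rfl).symm
    | 2 => exact (joinedIn_star 5 rfl).trans (joinedIn_leaf 6 rfl).symm
    | 3 => exact (joinedIn_star 1 rfl).trans (joinedIn_leaf 1 rfl)
    | 4 => exact joinedIn_star 2 rfl
  · intro w
    match w with
    | 0 => exact joinedIn_centre 2 rfl
    | 1 => exact joinedIn_centre 5 rfl
    | 2 => exact joinedIn_centre 6 rfl
    | 3 => exact (joinedIn_centre 1 rfl).symm

lemma le_card_far : 2 * (n * (n - 1)) ≤ Nat.card {y : EdgeLabel n × EdgeLabel n //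
    D.Crosses y.1.toEdge y.2.toEdge ∧
      OnIndependent (joinPath hubFar cenFar) JoinEdge.Independent y.1 y.2} := by
  refine le_trans (le_card_meeting_join (a := fun p => centrePos D (![3, 4, 5, 0, 2] p))
    (b := leafPos D 2) ?_ (leafPos_injective D 2) (fun p i => centrePos_ne_leafPos D _ _ _)
    (R := pathSet D (joinPath hubFar cenFar)) ?_ ?_)
    (card_meeting_le D _ _ (not_common_joinPath (by decide)))
  · exact (centrePos_injective D).comp (by decide)
  · intro p i
    match p with
    | 0 => exact (joinedIn_star 3 rfl).trans (joinedIn_leaf 2 rfl).symm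
    | 1 => exact (joinedIn_star 4 rfl).trans (joinedIn_leaf 5 rfl).symm
    | 2 => exact (joinedIn_star 5 rfl).trans (joinedIn_leaf 6 rfl).symm
    | 3 => exact (joinedIn_star 0 rfl).trans ((joinedIn_leaf 0 rfl).trans (joinedIn_leaf 1 rfl))
    | 4 => exact joinedIn_star 2 rfl
  · intro w
    match w with
    | 0 => exact joinedIn_centre 2 rfl
    | 1 => exact joinedIn_centre 5 rfl
    | 2 => exact joinedIn_centre 6 rfl
    | 3 => exact ((joinedIn_centre 0 rfl).trans (joinedIn_centre 1 rfl)).symm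

lemma not_common_bipPath {hub : LeafKind → Option (Fin 3)} (e f : EdgeLabel n)
    (h : OnIndependent (bipPath hub) (fun x y => x.1 ≠ y.1 ∧ x.2 ≠ y.2) e f)
    (v : Fin 6 × (Fin 1 ⊕ Fin n)) (hv : v ∈ s(e.fst, e.snd)) : v ∉ s(f.fst, f.snd) := by
  obtain ⟨k, i, l, j, rfl, rfl, h1, h2⟩ := onIndependent_bipPath h
  exact notMem_of_apart h1 h2 v hv

lemma le_card_three : 2 * ((n / 2) * ((n - 1) / 2)) ≤ Nat.card {y : EdgeLabel n × EdgeLabel n //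
    D.Crosses y.1.toEdge y.2.toEdge ∧
      OnIndependent (bipPath hubThree) (fun x y => x.1 ≠ y.1 ∧ x.2 ≠ y.2) y.1 y.2} := by
  refine le_trans (le_card_meeting_three (a := fun p => centrePos D (![0, 1, 2] p))
    (b := leafPos D 1) ?_ (leafPos_injective D 1) (fun p i => centrePos_ne_leafPos D _ _ _)
    (R := pathSet D (bipPath hubThree)) ?_) (card_meeting_le D _ _ not_common_bipPath)
  · exact (centrePos_injective D).comp (by decide)
  · intro p i
    match p with
    | 0 => exact (joinedIn_bipStar 0 rfl).trans (joinedIn_bipLeaf 0 rfl)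
    | 1 => exact joinedIn_bipStar 1 rfl
    | 2 => exact (joinedIn_bipStar 2 rfl).trans (joinedIn_bipLeaf 1 rfl).symm

lemma le_card_four : 2 * ((n / 2) * ((n - 1) / 2)) ≤ Nat.card {y : EdgeLabel n × EdgeLabel n //
    D.Crosses y.1.toEdge y.2.toEdge ∧
      OnIndependent (bipPath hubFour) (fun x y => x.1 ≠ y.1 ∧ x.2 ≠ y.2) y.1 y.2} := by
  refine le_trans (le_card_meeting_three (a := fun p => centrePos D (![0, 1, 3] p))
    (b := leafPos D 1) ?_ (leafPos_injective D 1) (fun p i => centrePos_ne_leafPos D _ _ _)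
    (R := pathSet D (bipPath hubFour)) ?_) (card_meeting_le D _ _ not_common_bipPath)
  · exact (centrePos_injective D).comp (by decide)
  · intro p i
    match p with
    | 0 => exact (joinedIn_bipStar 0 rfl).trans (joinedIn_bipLeaf 0 rfl)
    | 1 => exact joinedIn_bipStar 1 rfl
    | 2 => exact
        (joinedIn_bipStar 3 rfl).trans ((joinedIn_bipLeaf 2 rfl).symm.trans (joinedIn_bipLeaf 1 rfl).symm)

open Classical in
lemma onIndependent_add_le_two (e f : EdgeLabel n) :
    (if OnIndependent (joinPath hubNear cenNear) JoinEdge.Independent e f then 1 else 0) +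
      (if OnIndependent (joinPath hubFar cenFar) JoinEdge.Independent e f then 1 else 0) +
      (if OnIndependent (bipPath hubThree) (fun x y => x.1 ≠ y.1 ∧ x.2 ≠ y.2) e f
        then 1 else 0) +
      (if OnIndependent (bipPath hubFour) (fun x y => x.1 ≠ y.1 ∧ x.2 ≠ y.2) e f
        then 1 else 0) ≤ 2 := by
  have ite_le : ∀ {p q : Prop} [Decidable p] [Decidable q], (p → q) →
      (if p then 1 else 0 : ℕ) ≤ if q then 1 else 0 := by
    intro p q _ _ h
    split_ifs with h1 h2 <;> simp_all
  by_cases hb : ∃ k i l j, e = .inl (k, i) ∧ f = .inl (l, j)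
  · obtain ⟨k, i, l, j, rfl, rfl⟩ := hb
    refine le_trans ?_ (apart_add_le_two k l)
    refine Nat.add_le_add (Nat.add_le_add (Nat.add_le_add ?_ ?_) ?_) ?_ <;> refine ite_le fun h => ?_
    · exact (onIndependent_joinPath h).1
    · exact (onIndependent_joinPath h).1
    · obtain ⟨_, _, _, _, h1, h2, h3, -⟩ := onIndependent_bipPath h
      cases h1; cases h2; exact h3
    · obtain ⟨_, _, _, _, h1, h2, h3, -⟩ := onIndependent_bipPath h
      cases h1; cases h2; exact h3
  · have h3 : ∀ hub, ¬ OnIndependent (bipPath hub) (fun x y => x.1 ≠ y.1 ∧ x.2 ≠ y.2) e f := by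
      intro hub h
      obtain ⟨k, i, l, j, he, hf, -⟩ := onIndependent_bipPath h
      exact hb ⟨k, i, l, j, he, hf⟩
    rw [if_neg (h3 _), if_neg (h3 _)]
    split_ifs <;> simp

/-- The lower bound for the number of crossings of a drawing. -/
theorem le_ncard_crossings (hD : D.crossings.Finite) :
    n * (n - 1) + (n / 2) * ((n - 1) / 2) ≤ D.crossings.ncard := by
  classical
  have h1 := le_card_near D
  have h2 := le_card_far D
  have h3 := le_card_three D
  have h4 := le_card_four D
  have h5 : Nat.card {y : EdgeLabel n × EdgeLabel n // D.Crosses y.1.toEdge y.2.toEdge} ≤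
      2 * D.crossings.ncard := by
    refine le_trans (Nat.card_le_card_of_injective
      (fun y => ⟨(y.1.1.toEdge, y.1.2.toEdge), y.2⟩) fun y z h => ?_) (D.card_crosses_le hD)
    simp only [Subtype.mk.injEq, Prod.mk.injEq] at h
    exact Subtype.ext (Prod.ext (toEdge_injective h.1) (toEdge_injective h.2))
  simp only [Nat.card_eq_fintype_card, Fintype.card_subtype] at h1 h2 h3 h4 h5
  simp only [← Finset.filter_filter] at h1 h2 h3 h4
  set O := Finset.univ.filter fun y : EdgeLabel n × EdgeLabel n =>
    D.Crosses y.1.toEdge y.2.toEdge with hO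
  have h6 : ∑ y ∈ O, _ ≤ ∑ y ∈ O, 2 :=
    Finset.sum_le_sum fun y _ => onIndependent_add_le_two y.1 y.2
  simp only [Finset.sum_add_distrib, ← Finset.card_filter, Finset.sum_const, smul_eq_mul] at h6
  omega

end EdgeLabel

namespace UpperDrawing

variable {n : ℕ}

/-- The scale of the copies of `v4`, `v5` and `v6` around the copies of `v3`. -/
noncomputable def scale (n : ℕ) : ℝ := 1 / (30 * (n + 1))

/-- The distance of a copy of `v3` from the vertical axis. -/
noncomputable def rad (i : Fin n) : ℝ := 8 + 30 * scale n * (i + 1)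

/-- The first coordinate of a copy of `v3`: even copies are on the right, odd ones on the left. -/
noncomputable def footX (i : Fin n) : ℝ := if (i : ℕ) % 2 = 1 then -rad i else rad i

/-- The first coordinate of a copy of `v2`, up to a translation. -/
noncomputable def baseX (i : Fin n) : ℝ := if (i : ℕ) % 2 = 1 then -(rad i + 12) else rad i + 12

/-- The slope of the edge between the copies of `v2` and `v3`. -/
def legSlope (i : Fin n) : ℝ := if (i : ℕ) % 2 = 1 then 12 else 0

lemma scale_pos : 0 < scale n := by unfold scale; positivity

lemma scale_le : scale n ≤ 1 / 30 := by
  unfold scale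
  gcongr
  have : (0 : ℝ) ≤ n := n.cast_nonneg
  linarith

lemma rad_lower (i : Fin n) : 8 + 30 * scale n ≤ rad i := by
  have := scale_pos (n := n)
  have : (0 : ℝ) ≤ (i : ℕ) := Nat.cast_nonneg _
  unfold rad
  nlinarith

lemma rad_lt (i : Fin n) : rad i < 9 := by
  have h1 : 30 * scale n * ((n : ℝ) + 1) = 1 := by
    unfold scale; field_simp
  have h2 : ((i : ℕ) : ℝ) + 1 ≤ n := by exact_mod_cast i.2
  have := scale_pos (n := n)
  unfold rad
  nlinarith

lemma rad_gap {i j : Fin n} (h : i < j) : rad i + 30 * scale n ≤ rad j := by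
  have h2 : ((i : ℕ) : ℝ) + 1 ≤ (j : ℕ) := by exact_mod_cast h
  have := scale_pos (n := n)
  unfold rad
  nlinarith

lemma rad_lt_iff {i j : Fin n} : rad i < rad j ↔ i < j := by
  have := scale_pos (n := n)
  refine ⟨fun h => ?_, fun h => ?_⟩
  · by_contra h'
    rcases (not_lt.1 h').eq_or_lt with rfl | h'
    · exact lt_irrefl _ h
    · linarith [rad_gap h']
  · linarith [rad_gap h]

lemma rad_injective : Function.Injective (rad (n := n)) := fun i j h => by
  rcases lt_trichotomy i j with h' | h' | h'
  · exact absurd h (rad_lt_iff.2 h').ne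
  · exact h'
  · exact absurd h (rad_lt_iff.2 h').ne'

lemma side_cases (i : Fin n) :
    ((i : ℕ) % 2 = 1 ∧ footX i = -rad i ∧ baseX i = -(rad i + 12) ∧ legSlope i = 12) ∨
    ((i : ℕ) % 2 = 0 ∧ footX i = rad i ∧ baseX i = rad i + 12 ∧ legSlope i = 0) := by
  unfold footX baseX legSlope
  rcases Nat.mod_two_eq_zero_or_one i with h | h <;> simp [h]

lemma footX_injective : Function.Injective (footX (n := n)) := fun i j h => by
  have := scale_pos (n := n)
  have := rad_lower i
  have := rad_lower j
  refine rad_injective ?_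
  rcases side_cases i with hi | hi <;> rcases side_cases j with hj | hj <;>
    rw [hi.2.1, hj.2.1] at h <;> linarith

lemma baseX_injective : Function.Injective (baseX (n := n)) := fun i j h => by
  have := scale_pos (n := n)
  have := rad_lower i
  have := rad_lower j
  refine rad_injective ?_
  rcases side_cases i with hi | hi <;> rcases side_cases j with hj | hj <;>
    rw [hi.2.2.1, hj.2.2.1] at h <;> linarith

lemma footX_ne_zero (i : Fin n) : footX i ≠ 0 := by
  have := scale_pos (n := n)
  have := rad_lower i
  rcases side_cases i with hi | hi <;> rw [hi.2.1] <;> intro h <;> linarith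

lemma baseX_ne_zero (i : Fin n) : baseX i ≠ 0 := by
  have := scale_pos (n := n)
  have := rad_lower i
  rcases side_cases i with hi | hi <;> rw [hi.2.2.1] <;> intro h <;> linarith

/-- The heights of the central copies of `v4`, `v5` and `v6`. -/
def hubY : Fin 3 → ℝ := ![3, 2, 1]

/-- Where the chords from the central copy of `v3` to `v4`, `v5` and `v6` meet the first axis. -/
def chordFoot : Fin 3 → ℝ := ![9, 8, 6]

/-- The vertices `v4`, `v5` and `v6`. -/
def hubVertex : Fin 3 → Fin 6 := ![3, 4, 5]

/-- The edges from `v3` to `v4`, `v5` and `v6`. -/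
def hubEdge : Fin 3 → Fin 7 := ![2, 5, 6]

/-- The interiors of the edges of the drawing. -/
inductive OnEdge : EdgeLabel n → ℝ → ℝ → Prop
  | star (w : Fin 3) (i : Fin n) {x y : ℝ} (h1 : scale n * hubY w < y) (h2 : y < hubY w)
      (h : hubY w * x = footX i * (hubY w - y)) : OnEdge (.inl (.inl (hubVertex w), i)) x y
  | leaf (w : Fin 3) (i : Fin n) {x y : ℝ} (h1 : 0 < y) (h2 : y < scale n * hubY w)
      (h : hubY w * x = footX i * (hubY w - y)) : OnEdge (.inl (.inr (hubEdge w), i)) x y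
  | chord (w : Fin 3) {x y : ℝ} (h1 : -1 < y) (h2 : y < hubY w)
      (h : hubY w * x = -chordFoot w * (hubY w - y)) : OnEdge (.inr (hubEdge w)) x y
  | clumpHigh (i : Fin n) {x y : ℝ} (h1 : 2 * scale n < y) (h2 : y < 3 * scale n)
      (h : x = (1 - scale n) * footX i) : OnEdge (.inl (.inr 3, i)) x y
  | clumpLow (i : Fin n) {x y : ℝ} (h1 : scale n < y) (h2 : y < 2 * scale n)
      (h : x = (1 - scale n) * footX i) : OnEdge (.inl (.inr 4, i)) x y
  | axisHigh {x y : ℝ} (h1 : 2 < y) (h2 : y < 3) (h : x = 0) : OnEdge (.inr 3) x y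
  | axisLow {x y : ℝ} (h1 : 1 < y) (h2 : y < 2) (h : x = 0) : OnEdge (.inr 4) x y
  | fan (i : Fin n) {x y : ℝ} (h1 : -1 < y) (h2 : y < 0)
      (h : x + 12 = (1 + y) * (footX i + 12)) : OnEdge (.inl (.inl 2, i)) x y
  | leg (i : Fin n) {x y : ℝ} (h1 : -2 < y) (h2 : y < 0)
      (h : x = footX i + legSlope i * y) : OnEdge (.inl (.inr 1, i)) x y
  | foot (i : Fin n) {x y : ℝ} (h1 : -3 < y) (h2 : y < -2)
      (h : x + 12 = (y + 3) * baseX i) : OnEdge (.inl (.inl 1, i)) x y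
  | pole (i : Fin n) {x y : ℝ} (h1 : -4 < y) (h2 : y < -2)
      (h : x + 12 = baseX i) : OnEdge (.inl (.inr 0, i)) x y
  | base (i : Fin n) {x y : ℝ} (h1 : -5 < y) (h2 : y < -4)
      (h : x + 12 = (y + 5) * baseX i) : OnEdge (.inl (.inl 0, i)) x y
  | spineLow {x y : ℝ} (h1 : -5 < y) (h2 : y < -3) (h : x = -12) : OnEdge (.inr 0) x y
  | spineHigh {x y : ℝ} (h1 : -3 < y) (h2 : y < -1) (h : x = -12) : OnEdge (.inr 1) x y

/-- The pairs of edges which cross in the drawing. -/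
inductive Allowed : EdgeLabel n → EdgeLabel n → Prop
  | stars {v w : Fin 3} (hvw : v < w) {i j : Fin n} (hij : i < j) (h2 : (i : ℕ) % 2 = (j : ℕ) % 2) :
      Allowed (.inl (.inl (hubVertex v), i)) (.inl (.inl (hubVertex w), j))
  | fanLeg {i j : Fin n} (hij : i < j) (h2 : (i : ℕ) % 2 = (j : ℕ) % 2) :
      Allowed (.inl (.inl 2, j)) (.inl (.inr 1, i))
  | footPole {i j : Fin n} (hij : i < j) (h2 : (i : ℕ) % 2 = (j : ℕ) % 2) :
      Allowed (.inl (.inl 1, j)) (.inl (.inr 0, i))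
  | chordStar {i : Fin n} (h2 : (i : ℕ) % 2 = 1) : Allowed (.inr 5) (.inl (.inl 5, i))
  | chordLeg {i : Fin n} (h2 : (i : ℕ) % 2 = 1) : Allowed (.inr 2) (.inl (.inr 1, i))

/-- How two rays from points of the vertical axis to the first axis can meet. -/
lemma ray_meet {H K X Y x y : ℝ} (hy : 0 < y) (hK : y < K) (hKH : K < H) (hK1 : 1 ≤ K)
    (h1 : H * x = X * (H - y)) (h2 : K * x = Y * (K - y)) :
    (0 < X → X < Y ∧ Y - X ≤ Y * y) ∧ (X < 0 → Y < X ∧ Y * y ≤ Y - X) := by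
  have hH : 0 < H := by linarith
  have key : X * (K * (H - y)) = Y * (H * (K - y)) := by
    linear_combination K * h1 * (-1) + H * h2
  have hB : 0 < H * (K - y) := mul_pos hH (by linarith)
  have hAB : H * (K - y) < K * (H - y) := by nlinarith
  have hA : 0 < K * (H - y) := hB.trans hAB
  have hC : (1 - y) * (K * (H - y)) ≤ H * (K - y) := by
    nlinarith [mul_nonneg (mul_nonneg hy.le (by linarith : (0 : ℝ) ≤ K - 1)) hH.le,
      mul_nonneg (mul_nonneg hy.le hy.le) (by linarith : (0 : ℝ) ≤ K),
      mul_pos hy (by linarith : (0 : ℝ) < K)]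
  constructor
  · intro hX
    have hY : 0 < Y := by
      by_contra hY
      nlinarith [mul_pos hX hA]
    constructor
    · by_contra hXY
      nlinarith
    · have : Y * ((1 - y) * (K * (H - y))) ≤ X * (K * (H - y)) := by nlinarith
      have : Y * (1 - y) ≤ X := by
        refine le_of_mul_le_mul_right ?_ hA
        linarith
      linarith
  · intro hX
    have hY : Y < 0 := by
      by_contra hY
      nlinarith [mul_pos (neg_pos.2 hX) hA]
    constructor
    · by_contra hXY
      nlinarith
    · have : X * (K * (H - y)) ≤ Y * ((1 - y) * (K * (H - y))) := by nlinarith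
      have : X ≤ Y * (1 - y) := by
        refine le_of_mul_le_mul_right ?_ hA
        linarith
      linarith

end UpperDrawing

namespace UpperDrawing

variable {n : ℕ}

lemma one_le_hubY (w : Fin 3) : 1 ≤ hubY w := by
  fin_cases w <;> norm_num [hubY]

lemma hubY_le (w : Fin 3) : hubY w ≤ 3 := by
  fin_cases w <;> norm_num [hubY]

lemma hubY_lt {v w : Fin 3} (h : v < w) : hubY w < hubY v := by
  revert h
  fin_cases v <;> fin_cases w <;> norm_num [hubY]

lemma footX_ne_chordFoot (i : Fin n) (w : Fin 3) : footX i ≠ -chordFoot w := by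
  have := scale_pos (n := n)
  have := rad_lower i
  have := rad_lt i
  intro h
  rcases side_cases i with hi | hi <;> rw [hi.2.1] at h <;>
    fin_cases w <;> simp [chordFoot] at h <;> linarith

lemma chordFoot_lt {v w : Fin 3} (h : v < w) : chordFoot w < chordFoot v := by
  revert h
  fin_cases v <;> fin_cases w <;> norm_num [chordFoot]

lemma chordFoot_pos (w : Fin 3) : 0 < chordFoot w := by
  fin_cases w <;> norm_num [chordFoot]

/-- The chords are also rays from the point `(-12, -1)`. -/
lemma chord_fan {w : Fin 3} {x y : ℝ} (h : hubY w * x = -chordFoot w * (hubY w - y)) :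
    x + 12 = (1 + y) * (-chordFoot w + 12) := by
  fin_cases w <;> simp [hubY, chordFoot] at h ⊢ <;> linarith

lemma eq_of_ray {H X Y x y : ℝ} (hy : y < H) (h1 : H * x = X * (H - y))
    (h2 : H * x = Y * (H - y)) : X = Y :=
  mul_right_cancel₀ (sub_pos.2 hy).ne' (h1.symm.trans h2)

lemma foot_ray_meet {v w : Fin 3} (hvw : v < w) {i j : Fin n} {x y : ℝ} (hy : 0 < y)
    (hw : y < hubY w) (h1 : hubY v * x = footX i * (hubY v - y))
    (h2 : hubY w * x = footX j * (hubY w - y)) :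
    i < j ∧ (i : ℕ) % 2 = (j : ℕ) % 2 ∧ 3 * scale n < y := by
  have hs := scale_pos (n := n)
  have ri := rad_lower i
  have rj := rad_lower j
  have rj' := rad_lt j
  obtain ⟨p, q⟩ := ray_meet hy hw (hubY_lt hvw) (one_le_hubY w) h1 h2
  rcases side_cases i with ⟨hi, hi', -⟩ | ⟨hi, hi', -⟩ <;>
    rcases side_cases j with ⟨hj, hj', -⟩ | ⟨hj, hj', -⟩ <;> rw [hi', hj'] at p q
  · obtain ⟨q1, q2⟩ := q (by linarith)
    have hij : i < j := rad_lt_iff.1 (by linarith)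
    have := rad_gap hij
    exact ⟨hij, by omega, by nlinarith⟩
  · linarith [q (by linarith)]
  · linarith [p (by linarith)]
  · obtain ⟨q1, q2⟩ := p (by linarith)
    have hij : i < j := rad_lt_iff.1 (by linarith)
    have := rad_gap hij
    exact ⟨hij, by omega, by nlinarith⟩

lemma chord_foot_ray_meet {v w : Fin 3} {i : Fin n} {x y : ℝ} (hy : 0 < y)
    (hv : y < hubY v) (hw : y < hubY w) (h1 : hubY v * x = -chordFoot v * (hubY v - y))
    (h2 : hubY w * x = footX i * (hubY w - y)) :
    v = 1 ∧ w = 2 ∧ (i : ℕ) % 2 = 1 ∧ 3 * scale n < y := by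
  have hs := scale_pos (n := n)
  have ri := rad_lower i
  have ri' := rad_lt i
  have hc := chordFoot_pos v
  rcases lt_trichotomy v w with h | rfl | h
  · obtain ⟨q1, q2⟩ := (ray_meet hy hw (hubY_lt h) (one_le_hubY w) h1 h2).2 (by linarith)
    rcases side_cases i with ⟨hi, hi', -⟩ | ⟨hi, hi', -⟩ <;> rw [hi'] at q1 q2
    · have hv : v = 0 ∨ v = 1 ∧ w = 2 := by omega
      rcases hv with rfl | ⟨rfl, rfl⟩
      · simp [chordFoot] at q1; linarith
      · simp only [chordFoot, Matrix.cons_val] at q1 q2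
        exact ⟨rfl, rfl, hi, by nlinarith⟩
    · linarith
  · exact absurd (eq_of_ray hv h2 h1) (footX_ne_chordFoot i v)
  · obtain ⟨p, q⟩ := ray_meet hy hv (hubY_lt h) (one_le_hubY v) h2 h1
    rcases side_cases i with ⟨hi, hi', -⟩ | ⟨hi, hi', -⟩ <;> rw [hi'] at p q
    · have : chordFoot v ≤ 8 := by
        revert h
        fin_cases v <;> fin_cases w <;> norm_num [chordFoot]
      linarith [(q (by linarith)).1]
    · linarith [(p (by linarith)).1]

lemma clump_ray_meet {w : Fin 3} {i j : Fin n} {x y : ℝ} (hy : 0 < y) (hs : y ≤ 3 * scale n)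
    (h1 : x = (1 - scale n) * footX i) (h2 : hubY w * x = footX j * (hubY w - y)) :
    i = j ∧ y = scale n * hubY w := by
  have hp := scale_pos (n := n)
  have hl := scale_le (n := n)
  have hw := one_le_hubY w
  have hw' := hubY_le w
  have ri := rad_lower i
  have ri' := rad_lt i
  have rj := rad_lower j
  have rj' := rad_lt j
  rw [h1] at h2
  have key : ∀ r r' : Fin n, hubY w * ((1 - scale n) * rad r) = rad r' * (hubY w - y) → r = r' := by
    intro r r' h
    have r1 := rad_lower r
    have r1' := rad_lt r
    have r2 := rad_lower r'
    have r2' := rad_lt r'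
    rcases lt_trichotomy r r' with hlt | hlt | hlt
    · have := rad_gap hlt
      nlinarith [mul_pos hp (by linarith : 0 < hubY w)]
    · exact hlt
    · have := rad_gap hlt
      nlinarith [mul_pos hp (by linarith : 0 < hubY w)]
  have hA : 0 < hubY w * ((1 - scale n) * rad i) := by
    have : 0 < (1 - scale n) * rad i := by apply mul_pos <;> linarith
    exact mul_pos (by linarith) this
  have hB : 0 < rad j * (hubY w - y) := by apply mul_pos <;> linarith
  have hij : i = j := by
    rcases side_cases i with ⟨hi, hi', -⟩ | ⟨hi, hi', -⟩ <;>
      rcases side_cases j with ⟨hj, hj', -⟩ | ⟨hj, hj', -⟩ <;> rw [hi', hj'] at h2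
    · exact key i j (by linarith)
    · linarith
    · linarith
    · exact key i j (by linarith)
  subst hij
  refine ⟨rfl, ?_⟩
  have := mul_left_cancel₀ (footX_ne_zero i)
    (show footX i * (hubY w * (1 - scale n)) = footX i * (hubY w - y) by linarith)
  linarith

lemma clump_chord_ne {w : Fin 3} {i : Fin n} {x y : ℝ} (hy : 0 < y) (hs : y ≤ 3 * scale n)
    (h1 : x = (1 - scale n) * footX i) (h2 : hubY w * x = -chordFoot w * (hubY w - y)) :
    False := by
  have hp := scale_pos (n := n)
  have hl := scale_le (n := n)
  have ri := rad_lower i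
  have ri' := rad_lt i
  rw [h1] at h2
  rcases side_cases i with ⟨-, hi, -⟩ | ⟨-, hi, -⟩ <;> rw [hi] at h2 <;> fin_cases w <;>
    simp [hubY, chordFoot] at h2 <;> nlinarith

lemma fan_leg_meet {X x y : ℝ} {i : Fin n} (hX : -12 < X) (h1 : -1 < y) (h2 : y < 0)
    (h3 : x + 12 = (1 + y) * (X + 12)) (h4 : x = footX i + legSlope i * y) :
    ((i : ℕ) % 2 = 1 ∧ X < -rad i) ∨ ((i : ℕ) % 2 = 0 ∧ rad i < X) := by
  have hp := scale_pos (n := n)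
  have ri := rad_lower i
  rcases side_cases i with ⟨hi, hi', -, hl⟩ | ⟨hi, hi', -, hl⟩ <;> rw [hi', hl] at h4
  · refine Or.inl ⟨hi, ?_⟩
    have : X * (1 + y) = -rad i := by linarith
    nlinarith
  · exact Or.inr ⟨hi, by nlinarith⟩

lemma foot_pole_meet {x y : ℝ} {i j : Fin n} (h1 : -3 < y) (h2 : y < -2)
    (h3 : x + 12 = (y + 3) * baseX j) (h4 : x + 12 = baseX i) :
    i < j ∧ (i : ℕ) % 2 = (j : ℕ) % 2 := by
  have hp := scale_pos (n := n)
  have ri := rad_lower i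
  have rj := rad_lower j
  rw [h4] at h3
  rcases side_cases i with ⟨hi, -, hi', -⟩ | ⟨hi, -, hi', -⟩ <;>
    rcases side_cases j with ⟨hj, -, hj', -⟩ | ⟨hj, -, hj', -⟩ <;> rw [hi', hj'] at h3
  · exact ⟨rad_lt_iff.1 (by nlinarith), by omega⟩
  · nlinarith
  · nlinarith
  · exact ⟨rad_lt_iff.1 (by nlinarith), by omega⟩

lemma leg_ne_of_le {x y : ℝ} {i : Fin n} (h2 : y ≤ -1)
    (h4 : x = footX i + legSlope i * y) : x ≠ -12 := by
  have hp := scale_pos (n := n)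
  have ri := rad_lower i
  intro h
  rcases side_cases i with ⟨hi, hi', -, hl⟩ | ⟨hi, hi', -, hl⟩ <;> rw [hi', hl] at h4 <;> linarith

lemma leg_meet {x y : ℝ} {i j : Fin n} (hy : y < 0) (h1 : x = footX i + legSlope i * y)
    (h2 : x = footX j + legSlope j * y) : i = j := by
  have hp := scale_pos (n := n)
  have ri := rad_lower i
  have rj := rad_lower j
  rw [h1] at h2
  rcases side_cases i with ⟨-, hi, -, hi'⟩ | ⟨-, hi, -, hi'⟩ <;>
    rcases side_cases j with ⟨-, hj, -, hj'⟩ | ⟨-, hj, -, hj'⟩ <;> rw [hi, hj, hi', hj'] at h2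
  · exact rad_injective (by linarith)
  · linarith
  · linarith
  · exact rad_injective (by linarith)

lemma neg_twelve_lt_footX (i : Fin n) : -12 < footX i := by
  have hp := scale_pos (n := n)
  have ri := rad_lower i
  have ri' := rad_lt i
  rcases side_cases i with ⟨-, hi, -⟩ | ⟨-, hi, -⟩ <;> rw [hi] <;> linarith

lemma neg_twelve_lt_chordFoot (w : Fin 3) : -12 < -chordFoot w := by
  fin_cases w <;> norm_num [chordFoot]

end UpperDrawing

namespace UpperDrawing

variable {n : ℕ}

/-- The conclusion of the analysis of the common points of two edges of the drawing. -/
abbrev EqOrAllowed (e f : EdgeLabel n) : Prop := e = f ∨ Allowed e f ∨ Allowed f e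

lemma EqOrAllowed.symm {e f : EdgeLabel n} (h : EqOrAllowed e f) : EqOrAllowed f e := by
  rcases h with h | h | h
  exacts [Or.inl h.symm, Or.inr (Or.inr h), Or.inr (Or.inl h)]

lemma scale_mul_hubY_le (w : Fin 3) : scale n * hubY w ≤ 3 * scale n := by
  have := scale_pos (n := n)
  have := hubY_le w
  nlinarith

lemma scale_mul_hubY_pos (w : Fin 3) : 0 < scale n * hubY w := by
  have := one_le_hubY w
  exact mul_pos scale_pos (by linarith)

lemma eqOrAllowed_star {w : Fin 3} {i : Fin n} {f : EdgeLabel n} {x y : ℝ}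
    (h1 : scale n * hubY w < y) (h2 : y < hubY w) (h : hubY w * x = footX i * (hubY w - y))
    (hf : OnEdge f x y) : EqOrAllowed (.inl (.inl (hubVertex w), i)) f := by
  have hy := (scale_mul_hubY_pos (n := n) w).trans h1
  have hs := scale_pos (n := n)
  have hw := one_le_hubY w
  have hax : x = 0 → False := by
    rintro rfl
    rw [mul_zero, eq_comm, mul_eq_zero] at h
    rcases h with h | h
    · exact footX_ne_zero i h
    · linarith
  cases hf with
  | star v j h1' h2' h' =>
    rcases lt_trichotomy v w with hvw | rfl | hvw
    · obtain ⟨a, b, -⟩ := foot_ray_meet hvw hy h2 h' h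
      exact Or.inr (Or.inr (.stars hvw a b))
    · rw [footX_injective (eq_of_ray h2 h h')]
      exact Or.inl rfl
    · obtain ⟨a, b, -⟩ := foot_ray_meet hvw hy h2' h h'
      exact Or.inr (Or.inl (.stars hvw a b))
  | leaf v j h1' h2' h' =>
    have hv := scale_mul_hubY_le (n := n) v
    have hl := scale_le (n := n)
    have hv' := one_le_hubY v
    rcases lt_trichotomy v w with hvw | rfl | hvw
    · linarith [(foot_ray_meet hvw hy h2 h' h).2.2]
    · linarith
    · linarith [(foot_ray_meet hvw hy (by linarith) h h').2.2]
  | chord v h1' h2' h' =>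
    obtain ⟨rfl, rfl, a, -⟩ := chord_foot_ray_meet hy h2' h2 h' h
    exact Or.inr (Or.inr (.chordStar a))
  | clumpHigh j h1' h2' h' => linarith [(clump_ray_meet hy h2'.le h' h).2]
  | clumpLow j h1' h2' h' => linarith [(clump_ray_meet hy (by linarith) h' h).2]
  | axisHigh h1' h2' h' => exact (hax h').elim
  | axisLow h1' h2' h' => exact (hax h').elim
  | _ => linarith

lemma eqOrAllowed_leaf {w : Fin 3} {i : Fin n} {f : EdgeLabel n} {x y : ℝ}
    (h1 : 0 < y) (h2 : y < scale n * hubY w) (h : hubY w * x = footX i * (hubY w - y))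
    (hf : OnEdge f x y) : EqOrAllowed (.inl (.inr (hubEdge w), i)) f := by
  have hs := scale_pos (n := n)
  have hl := scale_le (n := n)
  have hw := one_le_hubY w
  have hw' := scale_mul_hubY_le (n := n) w
  cases hf with
  | star v j h1' h2' h' => exact (eqOrAllowed_star h1' h2' h' (.leaf w i h1 h2 h)).symm
  | leaf v j h1' h2' h' =>
    have hv' := one_le_hubY v
    have hv := scale_mul_hubY_le (n := n) v
    rcases lt_trichotomy v w with hvw | rfl | hvw
    · linarith [(foot_ray_meet hvw h1 (by linarith) h' h).2.2]
    · rw [footX_injective (eq_of_ray (by linarith) h h')]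
      exact Or.inl rfl
    · linarith [(foot_ray_meet hvw h1 (by linarith) h h').2.2]
  | chord v h1' h2' h' =>
    linarith [(chord_foot_ray_meet h1 h2' (by linarith) h' h).2.2.2]
  | clumpHigh j h1' h2' h' => linarith [(clump_ray_meet h1 h2'.le h' h).2]
  | clumpLow j h1' h2' h' => linarith [(clump_ray_meet h1 (by linarith) h' h).2]
  | _ => linarith

lemma eqOrAllowed_clumpHigh {i : Fin n} {f : EdgeLabel n} {x y : ℝ}
    (h1 : 2 * scale n < y) (h2 : y < 3 * scale n) (h : x = (1 - scale n) * footX i)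
    (hf : OnEdge f x y) : EqOrAllowed (.inl (.inr 3, i)) f := by
  have hs := scale_pos (n := n)
  have hl := scale_le (n := n)
  cases hf with
  | star v j h1' h2' h' => exact (eqOrAllowed_star h1' h2' h' (.clumpHigh i h1 h2 h)).symm
  | leaf v j h1' h2' h' => exact (eqOrAllowed_leaf h1' h2' h' (.clumpHigh i h1 h2 h)).symm
  | chord v h1' h2' h' => exact (clump_chord_ne (by linarith) h2.le h h').elim
  | clumpHigh j h1' h2' h' =>
    rw [footX_injective (mul_left_cancel₀ (by linarith : 1 - scale n ≠ 0) (h.symm.trans h'))]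
    exact Or.inl rfl
  | _ => linarith

lemma eqOrAllowed_clumpLow {i : Fin n} {f : EdgeLabel n} {x y : ℝ}
    (h1 : scale n < y) (h2 : y < 2 * scale n) (h : x = (1 - scale n) * footX i)
    (hf : OnEdge f x y) : EqOrAllowed (.inl (.inr 4, i)) f := by
  have hs := scale_pos (n := n)
  have hl := scale_le (n := n)
  cases hf with
  | star v j h1' h2' h' => exact (eqOrAllowed_star h1' h2' h' (.clumpLow i h1 h2 h)).symm
  | leaf v j h1' h2' h' => exact (eqOrAllowed_leaf h1' h2' h' (.clumpLow i h1 h2 h)).symm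
  | chord v h1' h2' h' => exact (clump_chord_ne (by linarith) (by linarith) h h').elim
  | clumpLow j h1' h2' h' =>
    rw [footX_injective (mul_left_cancel₀ (by linarith : 1 - scale n ≠ 0) (h.symm.trans h'))]
    exact Or.inl rfl
  | _ => linarith

lemma chord_ne_zero {w : Fin 3} {y : ℝ} (hy : y < hubY w)
    (h : hubY w * 0 = -chordFoot w * (hubY w - y)) : False := by
  have := chordFoot_pos w
  nlinarith

lemma eqOrAllowed_chord {w : Fin 3} {f : EdgeLabel n} {x y : ℝ}
    (h1 : -1 < y) (h2 : y < hubY w) (h : hubY w * x = -chordFoot w * (hubY w - y))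
    (hf : OnEdge f x y) : EqOrAllowed (.inr (hubEdge w)) f := by
  cases hf with
  | star v j h1' h2' h' => exact (eqOrAllowed_star h1' h2' h' (.chord w h1 h2 h)).symm
  | leaf v j h1' h2' h' => exact (eqOrAllowed_leaf h1' h2' h' (.chord w h1 h2 h)).symm
  | clumpHigh j h1' h2' h' => exact (eqOrAllowed_clumpHigh h1' h2' h' (.chord w h1 h2 h)).symm
  | clumpLow j h1' h2' h' => exact (eqOrAllowed_clumpLow h1' h2' h' (.chord w h1 h2 h)).symm
  | chord v h1' h2' h' =>
    have := chord_fan h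
    rw [chord_fan h'] at this
    have := mul_left_cancel₀ (by linarith : 1 + y ≠ 0) this
    rcases lt_trichotomy v w with hvw | rfl | hvw
    · linarith [chordFoot_lt hvw]
    · exact Or.inl rfl
    · linarith [chordFoot_lt hvw]
  | axisHigh h1' h2' h' => subst h'; exact (chord_ne_zero h2 h).elim
  | axisLow h1' h2' h' => subst h'; exact (chord_ne_zero h2 h).elim
  | fan j h1' h2' h' =>
    rw [chord_fan h] at h'
    have := mul_left_cancel₀ (by linarith : 1 + y ≠ 0) h'
    exact (footX_ne_chordFoot j w (by linarith)).elim
  | leg j h1' h2' h' =>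
    have hs := scale_pos (n := n)
    have hr := rad_lower j
    have hc := chordFoot_pos w
    rcases fan_leg_meet (neg_twelve_lt_chordFoot w) h1 h2' (chord_fan h) h' with ⟨a, b⟩ | ⟨a, b⟩
    · match w with
      | 0 => exact Or.inr (Or.inl (.chordLeg a))
      | 1 => simp [chordFoot] at b; linarith
      | 2 => simp [chordFoot] at b; linarith
    · linarith
  | _ => linarith

lemma eqOrAllowed_fan {i : Fin n} {f : EdgeLabel n} {x y : ℝ}
    (h1 : -1 < y) (h2 : y < 0) (h : x + 12 = (1 + y) * (footX i + 12))
    (hf : OnEdge f x y) : EqOrAllowed (.inl (.inl 2, i)) f := by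
  cases hf with
  | star v j h1' h2' h' => exact (eqOrAllowed_star h1' h2' h' (.fan i h1 h2 h)).symm
  | leaf v j h1' h2' h' => exact (eqOrAllowed_leaf h1' h2' h' (.fan i h1 h2 h)).symm
  | clumpHigh j h1' h2' h' => exact (eqOrAllowed_clumpHigh h1' h2' h' (.fan i h1 h2 h)).symm
  | clumpLow j h1' h2' h' => exact (eqOrAllowed_clumpLow h1' h2' h' (.fan i h1 h2 h)).symm
  | chord v h1' h2' h' => exact (eqOrAllowed_chord h1' h2' h' (.fan i h1 h2 h)).symm
  | fan j h1' h2' h' =>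
    rw [h] at h'
    have := mul_left_cancel₀ (by linarith : 1 + y ≠ 0) h'
    rw [footX_injective (add_right_cancel this)]
    exact Or.inl rfl
  | leg j h1' h2' h' =>
    have hs := scale_pos (n := n)
    have hr := rad_lower i
    have hr' := rad_lower j
    rcases fan_leg_meet (neg_twelve_lt_footX i) h1 h2 h h' with ⟨a, b⟩ | ⟨a, b⟩ <;>
      rcases side_cases i with ⟨hi, hi', -⟩ | ⟨hi, hi', -⟩ <;> rw [hi'] at b
    · exact Or.inr (Or.inl (.fanLeg (rad_lt_iff.1 (by linarith)) (by omega)))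
    · linarith
    · linarith
    · exact Or.inr (Or.inl (.fanLeg (rad_lt_iff.1 (by linarith)) (by omega)))
  | _ => linarith

lemma eqOrAllowed_leg {i : Fin n} {f : EdgeLabel n} {x y : ℝ}
    (h1 : -2 < y) (h2 : y < 0) (h : x = footX i + legSlope i * y)
    (hf : OnEdge f x y) : EqOrAllowed (.inl (.inr 1, i)) f := by
  have hs := scale_pos (n := n)
  cases hf with
  | star v j h1' h2' h' => linarith [scale_mul_hubY_pos (n := n) v]
  | chord v h1' h2' h' => exact (eqOrAllowed_chord h1' h2' h' (.leg i h1 h2 h)).symm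
  | fan j h1' h2' h' => exact (eqOrAllowed_fan h1' h2' h' (.leg i h1 h2 h)).symm
  | leg j h1' h2' h' => rw [leg_meet h2 h h']; exact Or.inl rfl
  | spineHigh h1' h2' h' => exact (leg_ne_of_le h2'.le h h').elim
  | _ => linarith

lemma eqOrAllowed_foot {i : Fin n} {f : EdgeLabel n} {x y : ℝ}
    (h1 : -3 < y) (h2 : y < -2) (h : x + 12 = (y + 3) * baseX i)
    (hf : OnEdge f x y) : EqOrAllowed (.inl (.inl 1, i)) f := by
  have hs := scale_pos (n := n)
  cases hf with
  | star v j h1' h2' h' => linarith [scale_mul_hubY_pos (n := n) v]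
  | foot j h1' h2' h' =>
    rw [baseX_injective (mul_left_cancel₀ (by linarith : y + 3 ≠ 0) (h.symm.trans h'))]
    exact Or.inl rfl
  | pole j h1' h2' h' =>
    obtain ⟨a, b⟩ := foot_pole_meet h1 h2 h h'
    exact Or.inr (Or.inl (.footPole a b))
  | spineHigh h1' h2' h' =>
    rw [h', neg_add_cancel, eq_comm, mul_eq_zero] at h
    exact (h.elim (by intro; linarith) (baseX_ne_zero i)).elim
  | _ => linarith

lemma eqOrAllowed_pole {i : Fin n} {f : EdgeLabel n} {x y : ℝ}
    (h1 : -4 < y) (h2 : y < -2) (h : x + 12 = baseX i)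
    (hf : OnEdge f x y) : EqOrAllowed (.inl (.inr 0, i)) f := by
  have hs := scale_pos (n := n)
  cases hf with
  | star v j h1' h2' h' => linarith [scale_mul_hubY_pos (n := n) v]
  | foot j h1' h2' h' => exact (eqOrAllowed_foot h1' h2' h' (.pole i h1 h2 h)).symm
  | pole j h1' h2' h' => rw [baseX_injective (h.symm.trans h')]; exact Or.inl rfl
  | spineHigh h1' h2' h' => exact (baseX_ne_zero i (by linarith)).elim
  | spineLow h1' h2' h' => exact (baseX_ne_zero i (by linarith)).elim
  | _ => linarith

lemma eqOrAllowed_base {i : Fin n} {f : EdgeLabel n} {x y : ℝ}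
    (h1 : -5 < y) (h2 : y < -4) (h : x + 12 = (y + 5) * baseX i)
    (hf : OnEdge f x y) : EqOrAllowed (.inl (.inl 0, i)) f := by
  have hs := scale_pos (n := n)
  cases hf with
  | star v j h1' h2' h' => linarith [scale_mul_hubY_pos (n := n) v]
  | base j h1' h2' h' =>
    rw [baseX_injective (mul_left_cancel₀ (by linarith : y + 5 ≠ 0) (h.symm.trans h'))]
    exact Or.inl rfl
  | spineLow h1' h2' h' =>
    rw [h', neg_add_cancel, eq_comm, mul_eq_zero] at h
    exact (h.elim (by intro; linarith) (baseX_ne_zero i)).elim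
  | _ => linarith

/-- Two edges have a common interior point only if they are equal or listed in `Allowed`. -/
lemma OnEdge.eqOrAllowed {e f : EdgeLabel n} {x y : ℝ} (he : OnEdge e x y) (hf : OnEdge f x y) :
    EqOrAllowed e f := by
  cases he with
  | star w i h1 h2 h => exact eqOrAllowed_star h1 h2 h hf
  | leaf w i h1 h2 h => exact eqOrAllowed_leaf h1 h2 h hf
  | chord w h1 h2 h => exact eqOrAllowed_chord h1 h2 h hf
  | clumpHigh i h1 h2 h => exact eqOrAllowed_clumpHigh h1 h2 h hf
  | clumpLow i h1 h2 h => exact eqOrAllowed_clumpLow h1 h2 h hf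
  | fan i h1 h2 h => exact eqOrAllowed_fan h1 h2 h hf
  | leg i h1 h2 h => exact eqOrAllowed_leg h1 h2 h hf
  | foot i h1 h2 h => exact eqOrAllowed_foot h1 h2 h hf
  | pole i h1 h2 h => exact eqOrAllowed_pole h1 h2 h hf
  | base i h1 h2 h => exact eqOrAllowed_base h1 h2 h hf
  | axisHigh h1 h2 h =>
    cases hf with
    | star w i h1' h2' h' => exact (eqOrAllowed_star h1' h2' h' (.axisHigh h1 h2 h)).symm
    | leaf w i h1' h2' h' => exact (eqOrAllowed_leaf h1' h2' h' (.axisHigh h1 h2 h)).symm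
    | chord w h1' h2' h' => exact (eqOrAllowed_chord h1' h2' h' (.axisHigh h1 h2 h)).symm
    | axisHigh => exact Or.inl rfl
    | _ => linarith [scale_le (n := n)]
  | axisLow h1 h2 h =>
    cases hf with
    | star w i h1' h2' h' => exact (eqOrAllowed_star h1' h2' h' (.axisLow h1 h2 h)).symm
    | leaf w i h1' h2' h' => exact (eqOrAllowed_leaf h1' h2' h' (.axisLow h1 h2 h)).symm
    | chord w h1' h2' h' => exact (eqOrAllowed_chord h1' h2' h' (.axisLow h1 h2 h)).symm
    | axisLow => exact Or.inl rfl
    | _ => linarith [scale_le (n := n)]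
  | spineLow h1 h2 h =>
    cases hf with
    | star w i h1' h2' h' => linarith [scale_mul_hubY_pos (n := n) w]
    | pole i h1' h2' h' => exact (eqOrAllowed_pole h1' h2' h' (.spineLow h1 h2 h)).symm
    | base i h1' h2' h' => exact (eqOrAllowed_base h1' h2' h' (.spineLow h1 h2 h)).symm
    | spineLow => exact Or.inl rfl
    | _ => linarith [scale_pos (n := n)]
  | spineHigh h1 h2 h =>
    cases hf with
    | star w i h1' h2' h' => linarith [scale_mul_hubY_pos (n := n) w]
    | leg i h1' h2' h' => exact (eqOrAllowed_leg h1' h2' h' (.spineHigh h1 h2 h)).symm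
    | pole i h1' h2' h' => exact (eqOrAllowed_pole h1' h2' h' (.spineHigh h1 h2 h)).symm
    | foot i h1' h2' h' => exact (eqOrAllowed_foot h1' h2' h' (.spineHigh h1 h2 h)).symm
    | spineHigh => exact Or.inl rfl
    | _ => linarith [scale_pos (n := n)]

end UpperDrawing

namespace UpperDrawing

variable {n : ℕ}

/-- The positions of the vertices. -/
noncomputable def pos : Fin 6 × (Fin 1 ⊕ Fin n) → ℝ × ℝ
  | (v, .inl _) => (![-12, -12, -12, 0, 0, 0] v, ![-5, -3, -1, 3, 2, 1] v)
  | (v, .inr i) => (![baseX i - 12, baseX i - 12, footX i, (1 - scale n) * footX i,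
      (1 - scale n) * footX i, (1 - scale n) * footX i] v,
      ![-4, -2, 0, 3 * scale n, 2 * scale n, scale n] v)

lemma pos_injective : Function.Injective (pos (n := n)) := by
  have hs := scale_pos (n := n)
  have hl := scale_le (n := n)
  have hne : (1 - scale n) ≠ 0 := by linarith
  rintro ⟨v, c | i⟩ ⟨w, d | j⟩ h
  · rw [Subsingleton.elim c d]
    fin_cases v <;> fin_cases w <;> simp [pos] at h ⊢
  · exfalso
    fin_cases v <;> fin_cases w <;> simp [pos] at h <;> linarith [h.2]
  · exfalso
    fin_cases v <;> fin_cases w <;> simp [pos] at h <;> linarith [h.2]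
  · have hvw : v = w := by
      fin_cases v <;> fin_cases w <;> simp [pos] at h ⊢ <;> linarith [h.2]
    subst hvw
    have hij : i = j := by
      fin_cases v <;> simp [pos, baseX_injective.eq_iff, footX_injective.eq_iff, hne] at h <;>
        exact h
    rw [hij]

lemma onEdge_segment (e : EdgeLabel n) {t : ℝ} (h0 : 0 < t) (h1 : t < 1) :
    OnEdge e ((1 - t) * (pos e.fst).1 + t * (pos e.snd).1)
      ((1 - t) * (pos e.fst).2 + t * (pos e.snd).2) := by
  have hs := scale_pos (n := n)
  have hl := scale_le (n := n)
  have hst : 0 < scale n * t := mul_pos hs h0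
  have hst' : 0 < scale n * (1 - t) := mul_pos hs (by linarith)
  have hs1 : 0 < (1 - scale n) * t := mul_pos (by linarith) h0
  have hs2 : 0 < (1 - scale n) * (1 - t) := mul_pos (by linarith) (by linarith)
  match e with
  | .inl (.inl v, i) =>
    fin_cases v
    · refine .base i ?_ ?_ ?_ <;> simp [EdgeLabel.fst, EdgeLabel.snd, pos] <;> linarith
    · refine .foot i ?_ ?_ ?_ <;> simp [EdgeLabel.fst, EdgeLabel.snd, pos] <;> linarith
    · refine .fan i ?_ ?_ ?_ <;> simp [EdgeLabel.fst, EdgeLabel.snd, pos] <;> linarith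
    · refine .star 0 i ?_ ?_ ?_ <;> simp [EdgeLabel.fst, EdgeLabel.snd, pos, hubY] <;> linarith
    · refine .star 1 i ?_ ?_ ?_ <;> simp [EdgeLabel.fst, EdgeLabel.snd, pos, hubY] <;> linarith
    · refine .star 2 i ?_ ?_ ?_ <;> simp [EdgeLabel.fst, EdgeLabel.snd, pos, hubY] <;> linarith
  | .inl (.inr k, i) =>
    fin_cases k
    · refine .pole i ?_ ?_ ?_ <;>
        simp [EdgeLabel.fst, EdgeLabel.snd, pos, edgeFst, edgeSnd] <;> linarith
    · refine .leg i ?_ ?_ ?_ <;>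
        simp [EdgeLabel.fst, EdgeLabel.snd, pos, edgeFst, edgeSnd] <;> try linarith
      rcases side_cases i with ⟨-, hi, hi', hl⟩ | ⟨-, hi, hi', hl⟩ <;> rw [hi, hi', hl] <;> ring
    · refine .leaf 0 i ?_ ?_ ?_ <;>
        simp [EdgeLabel.fst, EdgeLabel.snd, pos, edgeFst, edgeSnd, hubY] <;> linarith
    · refine .clumpHigh i ?_ ?_ ?_ <;>
        simp [EdgeLabel.fst, EdgeLabel.snd, pos, edgeFst, edgeSnd] <;> linarith
    · refine .clumpLow i ?_ ?_ ?_ <;>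
        simp [EdgeLabel.fst, EdgeLabel.snd, pos, edgeFst, edgeSnd] <;> linarith
    · refine .leaf 1 i ?_ ?_ ?_ <;>
        simp [EdgeLabel.fst, EdgeLabel.snd, pos, edgeFst, edgeSnd, hubY] <;> linarith
    · refine .leaf 2 i ?_ ?_ ?_ <;>
        simp [EdgeLabel.fst, EdgeLabel.snd, pos, edgeFst, edgeSnd, hubY] <;> linarith
  | .inr k =>
    fin_cases k
    · refine .spineLow ?_ ?_ ?_ <;>
        simp [EdgeLabel.fst, EdgeLabel.snd, pos, edgeFst, edgeSnd] <;> linarith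
    · refine .spineHigh ?_ ?_ ?_ <;>
        simp [EdgeLabel.fst, EdgeLabel.snd, pos, edgeFst, edgeSnd] <;> linarith
    · refine .chord 0 ?_ ?_ ?_ <;>
        simp [EdgeLabel.fst, EdgeLabel.snd, pos, edgeFst, edgeSnd, hubY, chordFoot] <;> linarith
    · refine .axisHigh ?_ ?_ ?_ <;>
        simp [EdgeLabel.fst, EdgeLabel.snd, pos, edgeFst, edgeSnd] <;> linarith
    · refine .axisLow ?_ ?_ ?_ <;>
        simp [EdgeLabel.fst, EdgeLabel.snd, pos, edgeFst, edgeSnd] <;> linarith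
    · refine .chord 1 ?_ ?_ ?_ <;>
        simp [EdgeLabel.fst, EdgeLabel.snd, pos, edgeFst, edgeSnd, hubY, chordFoot] <;> linarith
    · refine .chord 2 ?_ ?_ ?_ <;>
        simp [EdgeLabel.fst, EdgeLabel.snd, pos, edgeFst, edgeSnd, hubY, chordFoot] <;> linarith

lemma OnEdge.ne_pos_inl {e : EdgeLabel n} {x y : ℝ} (h : OnEdge e x y) (v : Fin 6) (c : Fin 1) :
    (x, y) ≠ pos (n := n) (v, .inl c) := by
  have hs := scale_pos (n := n)
  have hl := scale_le (n := n)
  intro hp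
  simp only [pos, Prod.mk.injEq] at hp
  obtain ⟨hx, hy⟩ := hp
  cases h with
  | star w i h1 h2 h =>
    have := scale_mul_hubY_pos (n := n) w
    have h3 : x = 0 := by fin_cases v <;> simp at hx hy <;> linarith
    rw [h3, mul_zero, eq_comm, mul_eq_zero] at h
    rcases h with h | h
    · exact footX_ne_zero i h
    · linarith
  | leaf w i h1 h2 h =>
    have := scale_mul_hubY_le (n := n) w
    fin_cases v <;> simp at hx hy <;> linarith
  | chord w h1 h2 h =>
    have h3 : x = 0 := by fin_cases v <;> simp at hx hy <;> linarith
    rw [h3] at h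
    exact chord_ne_zero h2 h
  | leg i h1 h2 h =>
    refine leg_ne_of_le ?_ h ?_ <;> fin_cases v <;> simp at hx hy <;> linarith
  | pole i h1 h2 h =>
    refine baseX_ne_zero i ?_
    fin_cases v <;> simp at hx hy <;> linarith
  | _ => fin_cases v <;> simp at hx hy <;> linarith

lemma OnEdge.ne_pos_inr {e : EdgeLabel n} {x y : ℝ} (h : OnEdge e x y) (v : Fin 6) (j : Fin n) :
    (x, y) ≠ pos (v, .inr j) := by
  have hs := scale_pos (n := n)
  have hl := scale_le (n := n)
  intro hp
  simp only [pos, Prod.mk.injEq] at hp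
  obtain ⟨hx, hy⟩ := hp
  have hclump : 0 < y → x = (1 - scale n) * footX j ∧ y ≤ 3 * scale n := by
    intro h
    fin_cases v <;> simp at hx hy <;> first | linarith | exact ⟨hx, by linarith⟩
  cases h with
  | star w i h1 h2 h =>
    have hy0 := (scale_mul_hubY_pos (n := n) w).trans h1
    linarith [(clump_ray_meet hy0 (hclump hy0).2 (hclump hy0).1 h).2]
  | leaf w i h1 h2 h => linarith [(clump_ray_meet h1 (hclump h1).2 (hclump h1).1 h).2]
  | chord w h1 h2 h =>
    rcases lt_trichotomy y 0 with hy0 | rfl | hy0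
    · fin_cases v <;> simp at hx hy <;> linarith
    · have hw := one_le_hubY w
      have hxj : x = footX j := by fin_cases v <;> simp at hx hy <;> linarith
      refine footX_ne_chordFoot j w (mul_left_cancel₀ (by linarith : hubY w ≠ 0) ?_)
      rw [← hxj, h]
      ring
    · exact clump_chord_ne hy0 (hclump hy0).2 (hclump hy0).1 h
  | spineLow h1 h2 h =>
    refine baseX_ne_zero j ?_
    fin_cases v <;> simp at hx hy <;> linarith
  | spineHigh h1 h2 h =>
    refine baseX_ne_zero j ?_
    fin_cases v <;> simp at hx hy <;> linarith
  | _ => fin_cases v <;> simp at hx hy <;> linarith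

lemma hubVertex_injective : Function.Injective hubVertex := by decide

lemma hubEdge_injective : Function.Injective hubEdge := by decide

lemma onEdge_star {w : Fin 3} {i : Fin n} {x y : ℝ}
    (h : OnEdge (.inl (.inl (hubVertex w), i)) x y) :
    0 < y ∧ y < hubY w ∧ hubY w * x = footX i * (hubY w - y) := by
  generalize he : (.inl (.inl (hubVertex w), i) : EdgeLabel n) = e at h
  cases h with
  | star v j h1 h2 h =>
    simp only [Sum.inl.injEq, Prod.mk.injEq, hubVertex_injective.eq_iff] at he
    obtain ⟨rfl, rfl⟩ := he
    exact ⟨(scale_mul_hubY_pos w).trans h1, h2, h⟩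
  | _ => fin_cases w <;> simp [hubVertex] at he

lemma onEdge_chord {w : Fin 3} {x y : ℝ} (h : OnEdge (n := n) (.inr (hubEdge w)) x y) :
    -1 < y ∧ hubY w * x = -chordFoot w * (hubY w - y) := by
  generalize he : (.inr (hubEdge w) : EdgeLabel n) = e at h
  cases h with
  | chord v h1 h2 h =>
    rw [Sum.inr.injEq, hubEdge_injective.eq_iff] at he
    subst he
    exact ⟨h1, h⟩
  | _ => fin_cases w <;> simp [hubEdge] at he

lemma onEdge_fan {i : Fin n} {x y : ℝ} (h : OnEdge (.inl (.inl 2, i)) x y) :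
    x + 12 = (1 + y) * (footX i + 12) := by
  generalize he : (.inl (.inl 2, i) : EdgeLabel n) = e at h
  cases h with
  | fan j h1 h2 h =>
    simp only [Sum.inl.injEq, Prod.mk.injEq, true_and] at he
    rwa [he]
  | star v => fin_cases v <;> simp [hubVertex] at he
  | _ => simp at he

lemma onEdge_leg {i : Fin n} {x y : ℝ} (h : OnEdge (.inl (.inr 1, i)) x y) :
    x = footX i + legSlope i * y := by
  generalize he : (.inl (.inr 1, i) : EdgeLabel n) = e at h
  cases h with
  | leg j h1 h2 h =>
    simp only [Sum.inl.injEq, Prod.mk.injEq, true_and] at he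
    rwa [he]
  | leaf v => fin_cases v <;> simp [hubEdge] at he
  | _ => simp at he

lemma onEdge_foot {i : Fin n} {x y : ℝ} (h : OnEdge (.inl (.inl 1, i)) x y) :
    x + 12 = (y + 3) * baseX i := by
  generalize he : (.inl (.inl 1, i) : EdgeLabel n) = e at h
  cases h with
  | foot j h1 h2 h =>
    simp only [Sum.inl.injEq, Prod.mk.injEq, true_and] at he
    rwa [he]
  | star v => fin_cases v <;> simp [hubVertex] at he
  | _ => simp at he

lemma onEdge_pole {i : Fin n} {x y : ℝ} (h : OnEdge (.inl (.inr 0, i)) x y) :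
    x + 12 = baseX i := by
  generalize he : (.inl (.inr 0, i) : EdgeLabel n) = e at h
  cases h with
  | pole j h1 h2 h =>
    simp only [Sum.inl.injEq, Prod.mk.injEq, true_and] at he
    rwa [he]
  | leaf v => fin_cases v <;> simp [hubEdge] at he
  | _ => simp at he

/-- Two edges which cross have at most one common point. -/
lemma Allowed.unique {e f : EdgeLabel n} (h : Allowed e f) {x y x' y' : ℝ} (he : OnEdge e x y)
    (hf : OnEdge f x y) (he' : OnEdge e x' y') (hf' : OnEdge f x' y') : x = x' ∧ y = y' := by
  have hs := scale_pos (n := n)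
  cases h with
  | @stars v w hvw i j hij h2 =>
    obtain ⟨p, q, a⟩ := onEdge_star he
    obtain ⟨-, r, b⟩ := onEdge_star hf
    obtain ⟨-, -, a'⟩ := onEdge_star he'
    obtain ⟨-, -, b'⟩ := onEdge_star hf'
    have hw := one_le_hubY w
    have hv := one_le_hubY v
    have hlt := hubY_lt hvw
    have key : (footX i * hubY w - footX j * hubY v) * (y - y') = 0 := by
      linear_combination hubY w * a - hubY v * b - hubY w * a' + hubY v * b'
    have hne : footX i * hubY w - footX j * hubY v ≠ 0 := by
      intro h0
      have h3 : footX i * (hubY w * hubY v) = footX j * (hubY w * hubY v) := by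
        linear_combination y * h0 + hubY v * b - hubY w * a
      have hne : hubY w * hubY v ≠ 0 := mul_ne_zero (by linarith) (by linarith)
      exact hij.ne (footX_injective (mul_right_cancel₀ hne h3))
    have hy : y = y' := by
      rcases mul_eq_zero.1 key with h | h
      · exact absurd h hne
      · linarith
    subst hy
    refine ⟨mul_left_cancel₀ (by linarith : hubY w ≠ 0) (b.trans b'.symm), rfl⟩
  | @fanLeg i j hij h2 =>
    have a := onEdge_fan he
    have b := onEdge_leg hf
    have a' := onEdge_fan he'
    have b' := onEdge_leg hf'
    have key : (footX j + 12 - legSlope i) * (y - y') = 0 := by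
      linear_combination a' - a + b - b'
    have ri := rad_lower i
    have rj := rad_lower j
    have hne : footX j + 12 - legSlope i ≠ 0 := by
      rcases side_cases i with ⟨hi, -, -, hl⟩ | ⟨hi, -, -, hl⟩ <;>
        rcases side_cases j with ⟨hj, hj', -⟩ | ⟨hj, hj', -⟩ <;> rw [hl, hj'] <;>
        first | omega | (intro; linarith)
    have hy : y = y' := by
      rcases mul_eq_zero.1 key with h | h
      · exact absurd h hne
      · linarith
    subst hy
    exact ⟨by linarith, rfl⟩
  | @footPole i j hij h2 =>
    have a := onEdge_foot he
    have b := onEdge_pole hf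
    have a' := onEdge_foot he'
    have b' := onEdge_pole hf'
    have hx : x = x' := by linarith
    subst hx
    exact ⟨rfl, add_right_cancel (mul_right_cancel₀ (baseX_ne_zero j) (a.symm.trans a'))⟩
  | @chordStar i h2 =>
    have a := (onEdge_chord (w := 1) he).2
    have b := (onEdge_star (w := 2) hf).2.2
    have a' := (onEdge_chord (w := 1) he').2
    have b' := (onEdge_star (w := 2) hf').2.2
    have ri := rad_lower i
    rcases side_cases i with ⟨hi, hi', -⟩ | ⟨hi, -⟩
    · rw [hi'] at b b'
      simp [hubY, chordFoot] at a b a' b'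
      have key : (rad i - 4) * (y - y') = 0 := by linarith
      have hy : y = y' := by
        rcases mul_eq_zero.1 key with h | h <;> linarith
      subst hy
      exact ⟨by linarith, rfl⟩
    · omega
  | @chordLeg i h2 =>
    have a := (onEdge_chord (w := 0) he).2
    have b := onEdge_leg hf
    have a' := (onEdge_chord (w := 0) he').2
    have b' := onEdge_leg hf'
    rcases side_cases i with ⟨hi, hi', -, hl⟩ | ⟨hi, -⟩
    · rw [hl] at b b'
      simp [hubY, chordFoot] at a b a' b'
      constructor <;> linarith
    · omega

end UpperDrawing

namespace UpperDrawing

variable {n : ℕ}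

/-- The number `2 * a + r` as an odd or even index of a leaf, depending on the parity `r`. -/
def lowerIndex (j : Fin n) (a : Fin (j / 2)) : Fin n := ⟨2 * a + j % 2, by omega⟩

/-- The index of the leaf number `a` among those on the left. -/
def oddIndex (a : Fin (n / 2)) : Fin n := ⟨2 * a + 1, by omega⟩

/-- Indices for the pairs of edges which may cross. -/
abbrev PairIndex (n : ℕ) :=
  (Fin 5 × (Σ j : Fin n, Fin (j / 2))) ⊕ (Fin 2 × Fin (n / 2))

/-- An enumeration of the pairs of edges which may cross. -/
def pair : PairIndex n → EdgeLabel n × EdgeLabel n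
  | .inl (c, ⟨j, a⟩) =>
    (![.inl (.inl 3, lowerIndex j a), .inl (.inl 3, lowerIndex j a), .inl (.inl 4, lowerIndex j a),
        .inl (.inl 2, j), .inl (.inl 1, j)] c,
      ![.inl (.inl 4, j), .inl (.inl 5, j), .inl (.inl 5, j),
        .inl (.inr 1, lowerIndex j a), .inl (.inr 0, lowerIndex j a)] c)
  | .inr (c, a) =>
    (![.inr 5, .inr 2] c, ![.inl (.inl 5, oddIndex a), .inl (.inr 1, oddIndex a)] c)

lemma Allowed.exists_pair {e f : EdgeLabel n} (h : Allowed e f) : ∃ d, pair d = (e, f) := by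
  have lower : ∀ {i j : Fin n}, i < j → (i : ℕ) % 2 = (j : ℕ) % 2 → ∃ a, lowerIndex j a = i := by
    intro i j hij h2
    have : (i : ℕ) < j := hij
    exact ⟨⟨i / 2, by omega⟩, Fin.ext (by simp only [lowerIndex]; omega)⟩
  have odd : ∀ {i : Fin n}, (i : ℕ) % 2 = 1 → ∃ a, oddIndex a = i := by
    intro i h2
    exact ⟨⟨i / 2, by omega⟩, Fin.ext (by simp only [oddIndex]; omega)⟩
  cases h with
  | @stars v w hvw i j hij h2 =>
    obtain ⟨a, rfl⟩ := lower hij h2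
    have hvw' : (v = 0 ∧ w = 1) ∨ (v = 0 ∧ w = 2) ∨ (v = 1 ∧ w = 2) := by omega
    obtain ⟨rfl, rfl⟩ | ⟨rfl, rfl⟩ | ⟨rfl, rfl⟩ := hvw'
    exacts [⟨.inl (0, ⟨j, a⟩), rfl⟩, ⟨.inl (1, ⟨j, a⟩), rfl⟩, ⟨.inl (2, ⟨j, a⟩), rfl⟩]
  | @fanLeg i j hij h2 =>
    obtain ⟨a, rfl⟩ := lower hij h2
    exact ⟨.inl (3, ⟨j, a⟩), rfl⟩
  | @footPole i j hij h2 =>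
    obtain ⟨a, rfl⟩ := lower hij h2
    exact ⟨.inl (4, ⟨j, a⟩), rfl⟩
  | chordStar h2 =>
    obtain ⟨a, rfl⟩ := odd h2
    exact ⟨.inr (0, a), rfl⟩
  | chordLeg h2 =>
    obtain ⟨a, rfl⟩ := odd h2
    exact ⟨.inr (1, a), rfl⟩

lemma sum_half (n : ℕ) : ∑ j : Fin n, (j : ℕ) / 2 = (n / 2) * ((n - 1) / 2) := by
  rw [Fin.sum_univ_eq_sum_range (fun j => j / 2) n]
  induction n with
  | zero => rfl
  | succ n ih =>
    rw [Finset.sum_range_succ, ih, Nat.add_sub_cancel]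
    obtain ⟨k, rfl | rfl⟩ := Nat.even_or_odd' n
    · rcases k with _ | k
      · rfl
      · rw [show (2 * (k + 1)) / 2 = k + 1 by omega, show (2 * (k + 1) - 1) / 2 = k by omega,
          show (2 * (k + 1) + 1) / 2 = k + 1 by omega]
        ring
    · rw [show (2 * k + 1) / 2 = k by omega, show (2 * k + 1 - 1) / 2 = k by omega,
        show (2 * k + 1 + 1) / 2 = k + 1 by omega]
      ring

lemma card_pairIndex (n : ℕ) :
    Fintype.card (PairIndex n) = 5 * (n / 2) * ((n - 1) / 2) + 2 * (n / 2) := by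
  simp [sum_half, mul_assoc]

/-- The label of an edge. -/
noncomputable def label (e : (starProd n).edgeSet) : EdgeLabel n :=
  Function.surjInv EdgeLabel.toEdge_surjective e

lemma toEdge_label (e : (starProd n).edgeSet) : (label e).toEdge = e :=
  Function.surjInv_eq EdgeLabel.toEdge_surjective e

/-- The straight-line drawing given by `pos`. -/
noncomputable def drawing (n : ℕ) : Drawing (starProd n) where
  vertexMap := pos
  vertexMap_injective := pos_injective
  arc e t := ((1 - t) * (pos (label e).fst).1 + t * (pos (label e).snd).1,
    (1 - t) * (pos (label e).fst).2 + t * (pos (label e).snd).2)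
  arc_continuousOn e := by fun_prop
  arc_injOn e := by
    intro s _ t _ hst
    have hne : pos (label e).fst ≠ pos (label e).snd := pos_injective.ne (label e).adj.ne
    contrapose! hne
    simp only [Prod.mk.injEq] at hst
    obtain ⟨h1, h2⟩ := hst
    refine Prod.ext (mul_left_cancel₀ (sub_ne_zero.2 hne) ?_)
      (mul_left_cancel₀ (sub_ne_zero.2 hne) ?_) <;> linarith
  arc_endpoints e := by
    refine ⟨(label e).fst, (label e).snd, ?_, by simp, by simp⟩
    conv_lhs => rw [← toEdge_label e]
    rfl
  arc_avoids_vertices e t ht w := by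
    have h := onEdge_segment (label e) ht.1 ht.2
    rcases w with ⟨v, c | j⟩
    exacts [h.ne_pos_inl v c, h.ne_pos_inr v j]

lemma onEdge_of_arc_eq {e : (starProd n).edgeSet} {p : ℝ × ℝ}
    (h : ∃ t ∈ Set.Ioo (0 : ℝ) 1, (drawing n).arc e t = p) : OnEdge (label e) p.1 p.2 := by
  obtain ⟨t, ht, rfl⟩ := h
  exact onEdge_segment (label e) ht.1 ht.2

lemma exists_of_mem_crossings {x : Sym2 (starProd n).edgeSet × (ℝ × ℝ)}
    (hx : x ∈ (drawing n).crossings) :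
    ∃ e f : EdgeLabel n, Allowed e f ∧ x.1 = s(e.toEdge, f.toEdge) ∧
      OnEdge e x.2.1 x.2.2 ∧ OnEdge f x.2.1 x.2.2 := by
  obtain ⟨e, f, hne, hx1, he, hf⟩ := hx
  have he := onEdge_of_arc_eq he
  have hf := onEdge_of_arc_eq hf
  rw [← toEdge_label e, ← toEdge_label f] at hx1
  rcases he.eqOrAllowed hf with h | h | h
  · exact absurd (by rw [← toEdge_label e, h, toEdge_label f]) hne
  · exact ⟨_, _, h, hx1, he, hf⟩
  · exact ⟨_, _, h, hx1.trans Sym2.eq_swap, hf, he⟩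

lemma injOn_crossings : Set.InjOn Prod.fst (drawing n).crossings := by
  intro x hx x' hx' hxx
  obtain ⟨e, f, h, h1, he, hf⟩ := exists_of_mem_crossings hx
  obtain ⟨e', f', h', h1', he', hf'⟩ := exists_of_mem_crossings hx'
  have key : x.2.1 = x'.2.1 ∧ x.2.2 = x'.2.2 := by
    have := hxx
    rw [h1, h1', Sym2.eq_iff, EdgeLabel.toEdge_injective.eq_iff, EdgeLabel.toEdge_injective.eq_iff,
      EdgeLabel.toEdge_injective.eq_iff, EdgeLabel.toEdge_injective.eq_iff] at this
    obtain ⟨rfl, rfl⟩ | ⟨rfl, rfl⟩ := this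
    · exact h.unique he hf he' hf'
    · exact h.unique he hf hf' he'
  exact Prod.ext hxx (Prod.ext key.1 key.2)

lemma mapsTo_crossings : Set.MapsTo Prod.fst (drawing n).crossings
    (Set.range fun d : PairIndex n => s((pair d).1.toEdge, (pair d).2.toEdge)) := by
  intro x hx
  obtain ⟨e, f, h, h1, -⟩ := exists_of_mem_crossings hx
  obtain ⟨d, hd⟩ := h.exists_pair
  exact ⟨d, by simp only [hd, h1]⟩

lemma finite_crossings : (drawing n).crossings.Finite :=
  Set.Finite.of_injOn mapsTo_crossings injOn_crossings (Set.finite_range _)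

lemma ncard_crossings_le :
    (drawing n).crossings.ncard ≤ 5 * (n / 2) * ((n - 1) / 2) + 2 * (n / 2) := by
  rw [← card_pairIndex, ← Nat.card_eq_fintype_card]
  exact (Set.ncard_le_ncard_of_injOn _ mapsTo_crossings injOn_crossings (Set.finite_range _)).trans
    (Finite.card_range_le _)

end UpperDrawing

lemma lower_bound_eq (n : ℕ) : n * (n - 1) + (n / 2) * ((n - 1) / 2) =
    5 * (n / 2) * ((n - 1) / 2) + 2 * (n / 2) := by
  obtain ⟨k, rfl | rfl⟩ := Nat.even_or_odd' n
  · rcases k with _ | k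
    · rfl
    · rw [show (2 * (k + 1)) / 2 = k + 1 by omega, show (2 * (k + 1) - 1) / 2 = k by omega,
        show 2 * (k + 1) - 1 = 2 * k + 1 by omega]
      ring
  · rw [show (2 * k + 1) / 2 = k by omega, show (2 * k + 1 - 1) / 2 = k by omega,
      show 2 * k + 1 - 1 = 2 * k by omega]
    ring

/-- The crossing number of `G⁶₆₂ □ Sₙ` is `5⌊n/2⌋⌊(n-1)/2⌋ + 2⌊n/2⌋` for all
`n ≥ 1`, where `Sₙ = K_{1,n}` is the star with `n` leaves. -/
theorem crossingNumber_G6_62_boxProd_star (n : ℕ) (hn : 1 ≤ n) :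
    crossingNumber (G6_62 □ completeBipartiteGraph (Fin 1) (Fin n)) =
      5 * (n / 2) * ((n - 1) / 2) + 2 * (n / 2) := by
  have hmem : (UpperDrawing.drawing n).crossings.ncard ∈
      {m : ℕ | ∃ D : Drawing (starProd n), D.crossings.Finite ∧ D.crossings.ncard = m} :=
    ⟨_, UpperDrawing.finite_crossings, rfl⟩
  refine le_antisymm ((Nat.sInf_le hmem).trans UpperDrawing.ncard_crossings_le)
    (le_csInf ⟨_, hmem⟩ ?_)
  rintro _ ⟨D, hD, rfl⟩
  rw [← lower_bound_eq]
  exact EdgeLabel.le_ncard_crossings D hD
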